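/- Let (X, T) be a non-periodic minimal subshift over a finite alphabet A such that the first difference of its complexity satisfies p_X(n+1) − p_X(n) ≤ 2 for all sufficiently large n. Let S = {D, G, E_{ab}, E_{bc}, M} be the set of five endomorphisms of {a,b,c}* defined by: D: a↦ab, b↦b, c↦c; G: a↦ba, b↦b, c↦c; E_{ab}: a↦b, b↦a, c↦c; E_{bc}: a↦a, b↦c, c↦b; M: a↦a, b↦b, c↦b. Then (X, T) is an S-adic subshift: there exist a morphism σ_2 : {a,b,c}* → A*, morphisms σ_n ∈ S for all n ≥ 3, and letters a_n ∈ {a,b,c} for n ≥ 2, such that X is exactly the set of x ∈ A^ℤ all of whose finite factors occur in σ_2 σ_3 ⋯ σ_n(a_n) for some n. Moreover this representation can be chosen so that: (i) for every n, the concatenation extension σ_n : X_n → X_{n-1} is one-to-one, and (ii) there exists an increasing sequence (n_i)_i of integers such that for every i the composition σ_{n_i} σ_{n_i+1} ⋯ σ_{n_{i+1}} is a proper morphism and each of the three letters a, b, c occurs in each image σ_{n_i} σ_{n_i+1} ⋯ σ_{n_{i+1}}(y) for every y ∈ {a,b,c}. -/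

import Mathlib

/-- The extension of a morphism (given by its values on letters) to words, acting by
concatenation. -/
def wordApply {A B : Type*} (σ : A → List B) (w : List A) : List B :=
  (w.map σ).flatten

/-- The factor `x_i x_{i+1} ⋯ x_{i+m-1}` of a biinfinite sequence `x`. -/
def seg {A : Type*} (x : ℤ → A) (i : ℤ) (m : ℕ) : List A :=
  (List.range m).map fun k => x (i + k)

/-- The shift by `p` on biinfinite sequences; `shiftBy 1` is the shift map `T`. -/
def shiftBy {A : Type*} (p : ℤ) (x : ℤ → A) : ℤ → A :=
  fun i => x (i + p)

/-- A morphism is proper if all its images begin with a common letter `l` and end with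
a common letter `r`. -/
def ProperMorphism {B C : Type*} (σ : B → List C) : Prop :=
  ∃ l r : C, ∀ x : B, (σ x).head? = some l ∧ (σ x).getLast? = some r

/-- Cumulative length function: `cum f k` is the (signed) sum of `f` over the interval
between `0` and `k`. -/
def cum (f : ℤ → ℕ) : ℤ → ℤ
  | Int.ofNat n => ∑ i ∈ Finset.range n, (f i : ℤ)
  | Int.negSucc n => -∑ i ∈ Finset.range (n + 1), (f (Int.negSucc i) : ℤ)

/-- `ExtSeq σ y z` expresses that `z` is the image of the biinfinite sequence `y`
under the concatenation extension of the morphism `σ`, i.e.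
`z = ⋯ σ(y_{-1}) . σ(y_0) σ(y_1) ⋯` with `σ(y_0)` starting at coordinate `0`. -/
def ExtSeq {B C : Type*} (σ : B → List C) (y : ℤ → B) (z : ℤ → C) : Prop :=
  ∀ k : ℤ, seg z (cum (fun j => (σ (y j)).length) k) (σ (y k)).length = σ (y k)

/-- The language of a subshift `X`: the set of words of length `n` occurring in
elements of `X`. -/
def Lang {A : Type*} (X : Set (ℤ → A)) (n : ℕ) : Set (List A) :=
  { w | ∃ x ∈ X, ∃ i : ℤ, seg x i n = w }

/-- The complexity function of the subshift `X`: the number of distinct words of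
length `n` occurring in elements of `X`. -/
noncomputable def complexity {A : Type*} (X : Set (ℤ → A)) (n : ℕ) : ℕ :=
  (Lang X n).ncard

/-- The three-letter alphabet `{a, b, c}`. -/
inductive ABC : Type
  | a : ABC
  | b : ABC
  | c : ABC
deriving DecidableEq

/-- `D : a ↦ ab, b ↦ b, c ↦ c`. -/
def D : ABC → List ABC
  | ABC.a => [ABC.a, ABC.b]
  | ABC.b => [ABC.b]
  | ABC.c => [ABC.c]

/-- `G : a ↦ ba, b ↦ b, c ↦ c`. -/
def G : ABC → List ABC
  | ABC.a => [ABC.b, ABC.a]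
  | ABC.b => [ABC.b]
  | ABC.c => [ABC.c]

/-- `E_{ab} : a ↦ b, b ↦ a, c ↦ c`. -/
def Eab : ABC → List ABC
  | ABC.a => [ABC.b]
  | ABC.b => [ABC.a]
  | ABC.c => [ABC.c]

/-- `E_{bc} : a ↦ a, b ↦ c, c ↦ b`. -/
def Ebc : ABC → List ABC
  | ABC.a => [ABC.a]
  | ABC.b => [ABC.c]
  | ABC.c => [ABC.b]

/-- `M : a ↦ a, b ↦ b, c ↦ b`. -/
def M : ABC → List ABC
  | ABC.a => [ABC.a]
  | ABC.b => [ABC.b]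
  | ABC.c => [ABC.b]

/-- For a sequence `τ` of endomorphisms of `{a,b,c}*`, the composition
`τ n ∘ τ (n+1) ∘ ⋯ ∘ τ (n+k-1)` applied to a letter. -/
def chain (τ : ℕ → ABC → List ABC) (n : ℕ) : ℕ → ABC → List ABC
  | 0, x => [x]
  | k + 1, x => ((τ (n + k) x).map (chain τ n k)).flatten

/-- The subshift over `{a,b,c}` generated by the tail `(τ k, b k)_{k ≥ j}` of a
directive sequence: the sequences all of whose finite factors occur in some word
`τ j ∘ ⋯ ∘ τ (j+k-1) (b (j+k))`. -/
def Ylevel (τ : ℕ → ABC → List ABC) (b : ℕ → ABC) (j : ℕ) : Set (ℤ → ABC) :=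
  { y | ∀ (i : ℤ) (m : ℕ), ∃ k : ℕ, seg y i m <:+: chain τ j k (b (j + k)) }

namespace SubshiftSadic

section Words

variable {A B C : Type*}

theorem seg_eq_map (x : ℤ → A) (i : ℤ) (m : ℕ) :
    seg x i m = (List.range m).map fun k : ℕ => x (i + k) := by
  unfold seg
  induction m with
  | zero => rfl
  | succ m ih => simpa [List.range_succ] using ih

@[simp] theorem length_seg (x : ℤ → A) (i : ℤ) (m : ℕ) : (seg x i m).length = m := by
  simp [seg_eq_map]

@[simp] theorem seg_zero (x : ℤ → A) (i : ℤ) : seg x i 0 = [] := rfl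

theorem seg_add (x : ℤ → A) (i : ℤ) (m n : ℕ) :
    seg x i (m + n) = seg x i m ++ seg x (i + m) n := by
  simp [seg_eq_map, List.range_add, Function.comp_def, add_assoc]

theorem seg_one (x : ℤ → A) (i : ℤ) : seg x i 1 = [x i] := by
  simp [seg_eq_map]

theorem seg_succ (x : ℤ → A) (i : ℤ) (m : ℕ) :
    seg x i (m + 1) = seg x i m ++ [x (i + m)] := by
  rw [seg_add, seg_one]

theorem seg_succ' (x : ℤ → A) (i : ℤ) (m : ℕ) :
    seg x i (m + 1) = x i :: seg x (i + 1) m := by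
  rw [add_comm, seg_add, seg_one]; simp

theorem getElem_seg (x : ℤ → A) (i : ℤ) (m k : ℕ) (h : k < (seg x i m).length) :
    (seg x i m)[k] = x (i + k) := by
  simp [seg_eq_map]

theorem seg_eq_seg_iff (x y : ℤ → A) (i j : ℤ) (m : ℕ) :
    seg x i m = seg y j m ↔ ∀ k : ℕ, k < m → x (i + k) = y (j + k) := by
  constructor
  · intro h k hk
    have := getElem_seg x i m k (by simpa using hk)
    rw [← this]
    simp only [h]
    exact getElem_seg y j m k _
  · intro h
    rw [seg_eq_map, seg_eq_map]
    exact List.map_congr_left fun k hk => h k (List.mem_range.1 hk)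

theorem seg_infix {x : ℤ → A} {i j : ℤ} {m n : ℕ} (h₁ : j ≤ i) (h₂ : i + m ≤ j + n) :
    seg x i m <:+: seg x j n := by
  obtain ⟨p, rfl⟩ : ∃ p : ℕ, i = j + p := ⟨(i - j).toNat, by omega⟩
  obtain ⟨r, rfl⟩ : ∃ r : ℕ, n = p + m + r := ⟨n - p - m, by omega⟩
  exact ⟨seg x j p, seg x (j + (p + m : ℕ)) r, by rw [seg_add, seg_add]⟩

theorem infix_seg {x : ℤ → A} {j : ℤ} {n : ℕ} {w : List A} (h : w <:+: seg x j n) :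
    ∃ i, j ≤ i ∧ i + w.length ≤ j + n ∧ seg x i w.length = w := by
  obtain ⟨s, t, h⟩ := h
  have hl := congrArg List.length h
  simp only [List.length_append, length_seg] at hl
  refine ⟨j + s.length, by omega, by omega, ?_⟩
  rw [← hl, seg_add, seg_add] at h
  have := List.append_inj h (by simp)
  exact (List.append_inj this.1 (by simp)).2.symm

@[simp] theorem wordApply_nil (σ : A → List B) : wordApply σ [] = [] := rfl

@[simp] theorem wordApply_cons (σ : A → List B) (a : A) (w : List A) :
    wordApply σ (a :: w) = σ a ++ wordApply σ w := rfl

@[simp] theorem wordApply_append (σ : A → List B) (v w : List A) :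
    wordApply σ (v ++ w) = wordApply σ v ++ wordApply σ w := by
  simp [wordApply]

theorem wordApply_comp (σ : B → List C) (τ : A → List B) (w : List A) :
    wordApply (fun t => wordApply σ (τ t)) w = wordApply σ (wordApply τ w) := by
  induction w with
  | nil => rfl
  | cons a w ih => simp [ih]

theorem wordApply_singleton (w : List A) : wordApply (fun t => [t]) w = w := by
  induction w with
  | nil => rfl
  | cons a w ih => simp [ih]

theorem wordApply_reverse (σ : A → List B) (w : List A) :
    wordApply (fun t => (σ t).reverse) w.reverse = (wordApply σ w).reverse := by
  induction w with
  | nil => rfl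
  | cons a w ih => simp [ih]

theorem wordApply_infix (σ : A → List B) {v w : List A} (h : v <:+: w) :
    wordApply σ v <:+: wordApply σ w := by
  obtain ⟨s, t, rfl⟩ := h
  exact ⟨wordApply σ s, wordApply σ t, by simp⟩

@[simp] theorem cum_zero (f : ℤ → ℕ) : cum f 0 = 0 := by
  change cum f (Int.ofNat 0) = 0
  simp [cum]

theorem cum_succ (f : ℤ → ℕ) (k : ℤ) : cum f (k + 1) = cum f k + f k := by
  obtain n | n := k
  · change cum f (Int.ofNat (n + 1)) = _
    simp only [cum, Finset.sum_range_succ]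
    rfl
  · obtain _ | n := n
    · change cum f 0 = _
      rw [cum_zero]
      simp [cum]
    · have : (Int.negSucc (n + 1) + 1 : ℤ) = Int.negSucc n := by omega
      rw [this]
      simp only [cum]
      rw [Finset.sum_range_succ _ (n + 1)]
      ring

/-- `Expands σ g y z` says that `z` is the concatenation of the words `σ (y k)`, the `k`-th of
them starting at coordinate `g k`. -/
def Expands (σ : B → List C) (g : ℤ → ℤ) (y : ℤ → B) (z : ℤ → C) : Prop :=
  ∀ k, g (k + 1) = g k + (σ (y k)).length ∧ seg z (g k) (σ (y k)).length = σ (y k)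

theorem ExtSeq.expands {σ : B → List C} {y : ℤ → B} {z : ℤ → C} (h : ExtSeq σ y z) :
    Expands σ (cum fun j => (σ (y j)).length) y z :=
  fun k => ⟨cum_succ _ k, h k⟩

theorem Expands.add {σ : B → List C} {g : ℤ → ℤ} {y : ℤ → B} {z : ℤ → C}
    (h : Expands σ g y z) (k : ℤ) (m : ℕ) :
    g (k + m) = g k + (wordApply σ (seg y k m)).length := by
  induction m with
  | zero => simp
  | succ m ih =>
    rw [seg_succ]
    push_cast
    rw [← add_assoc, (h (k + m)).1, ih]
    simp [add_assoc]

theorem Expands.seg_eq {σ : B → List C} {g : ℤ → ℤ} {y : ℤ → B} {z : ℤ → C}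
    (h : Expands σ g y z) (k : ℤ) (m : ℕ) :
    seg z (g k) (wordApply σ (seg y k m)).length = wordApply σ (seg y k m) := by
  induction m with
  | zero => simp
  | succ m ih =>
    rw [seg_succ, wordApply_append, List.length_append, seg_add, ih, ← h.add]
    simp [(h (k + m)).2]

theorem Expands.comp {A : Type*} {σ : B → List C} {τ : A → List B} {g g' : ℤ → ℤ}
    {y : ℤ → A} {z : ℤ → B} {w : ℤ → C} (h : Expands σ g z w) (h' : Expands τ g' y z) :
    Expands (fun t => wordApply σ (τ t)) (fun k => g (g' k)) y w := by
  intro k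
  obtain ⟨h₁, h₂⟩ := h' k
  constructor
  · simp only [h₁, h.add]
    rw [h₂]
  · have := h.seg_eq (g' k) (τ (y k)).length
    rwa [h₂] at this

/-- Reflection of a biinfinite sequence. -/
def mirror (x : ℤ → A) : ℤ → A := fun i => x (-1 - i)

/-- Reflection of a biinfinite sequence of cutting points. -/
def mirrorCut (c : ℤ → ℤ) : ℤ → ℤ := fun k => -c (-k)

@[simp] theorem mirror_mirror (x : ℤ → A) : mirror (mirror x) = x := by
  funext i; simp [mirror]

@[simp] theorem mirrorCut_mirrorCut (c : ℤ → ℤ) : mirrorCut (mirrorCut c) = c := by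
  funext i; simp [mirrorCut]

theorem seg_mirror (x : ℤ → A) (i : ℤ) (m : ℕ) :
    seg (mirror x) i m = (seg x (-i - m) m).reverse := by
  induction m generalizing i with
  | zero => rfl
  | succ m ih =>
    rw [seg_succ', ih, seg_succ, List.reverse_append]
    have h : -(i + 1) - (m : ℤ) = -i - ((m + 1 : ℕ) : ℤ) := by push_cast; ring
    rw [h]
    simp only [mirror, List.reverse_cons, List.reverse_nil, List.nil_append, List.cons_append]
    congr 2
    push_cast; ring

theorem Expands.reflect {σ : B → List C} {g : ℤ → ℤ} {y : ℤ → B} {z : ℤ → C}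
    (h : Expands σ g y z) :
    Expands (fun t => (σ t).reverse) (mirrorCut g) (mirror y) (mirror z) := by
  intro k
  obtain ⟨h₁, h₂⟩ := h (-1 - k)
  have e : (-1 - k + 1 : ℤ) = -k := by ring
  rw [e] at h₁
  have e' : -(k + 1) = -1 - k := by ring
  simp only [mirrorCut, mirror, e', List.length_reverse]
  refine ⟨by omega, ?_⟩
  have : seg (mirror z) (-g (-k)) (σ (y (-1 - k))).length
      = (σ (y (-1 - k))).reverse := by
    rw [seg_mirror, ← h₂]
    congr 2 <;> simp
    omega
  exact this

end Words

section Generated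

/-- The set `S` of the five endomorphisms. -/
abbrev elem : Set (ABC → List ABC) := {D, G, Eab, Ebc, M}

/-- The nonempty compositions of the five endomorphisms. -/
inductive Gen : (ABC → List ABC) → Prop
  | of {f : ABC → List ABC} : f ∈ elem → Gen f
  | comp {f g : ABC → List ABC} : Gen f → Gen g → Gen fun t => wordApply f (g t)

theorem Gen.reverse {f : ABC → List ABC} (h : Gen f) : Gen fun t => (f t).reverse := by
  induction h with
  | @of f h =>
    simp only [elem, Set.mem_insert_iff, Set.mem_singleton_iff] at h
    rcases h with rfl | rfl | rfl | rfl | rfl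
    · have : (fun t => (D t).reverse) = G := by funext t; cases t <;> rfl
      rw [this]; exact Gen.of (by simp)
    · have : (fun t => (G t).reverse) = D := by funext t; cases t <;> rfl
      rw [this]; exact Gen.of (by simp)
    · have : (fun t => (Eab t).reverse) = Eab := by funext t; cases t <;> rfl
      rw [this]; exact Gen.of (by simp)
    · have : (fun t => (Ebc t).reverse) = Ebc := by funext t; cases t <;> rfl
      rw [this]; exact Gen.of (by simp)
    · have : (fun t => (M t).reverse) = M := by funext t; cases t <;> rfl
      rw [this]; exact Gen.of (by simp)
  | @comp f g _ _ hf hg =>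
    have := Gen.comp hf hg
    simpa only [wordApply_reverse] using this

theorem Gen.id : Gen fun t => [t] := by
  have : (fun t => wordApply Eab (Eab t)) = fun t => [t] := by funext t; cases t <;> rfl
  rw [← this]
  exact Gen.comp (Gen.of (by simp)) (Gen.of (by simp))

/-- `Tr p q r` says that some composition of the five endomorphisms maps the letters to
`p`, `q`, `r`. -/
def Tr (p q r : List ABC) : Prop :=
  ∃ f, Gen f ∧ f .a = p ∧ f .b = q ∧ f .c = r

variable {p q r : List ABC}

theorem Tr.swap (h : Tr p q r) : Tr q p r := by
  obtain ⟨f, hf, rfl, rfl, rfl⟩ := h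
  exact ⟨_, Gen.comp hf (Gen.of (f := Eab) (by simp)), by simp [Eab], by simp [Eab],
    by simp [Eab]⟩

theorem Tr.swap' (h : Tr p q r) : Tr p r q := by
  obtain ⟨f, hf, rfl, rfl, rfl⟩ := h
  exact ⟨_, Gen.comp hf (Gen.of (f := Ebc) (by simp)), by simp [Ebc], by simp [Ebc],
    by simp [Ebc]⟩

theorem Tr.append (h : Tr p q r) : Tr (p ++ q) q r := by
  obtain ⟨f, hf, rfl, rfl, rfl⟩ := h
  exact ⟨_, Gen.comp hf (Gen.of (f := D) (by simp)), by simp [D], by simp [D],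
    by simp [D]⟩

theorem Tr.prepend (h : Tr p q r) : Tr (q ++ p) q r := by
  obtain ⟨f, hf, rfl, rfl, rfl⟩ := h
  exact ⟨_, Gen.comp hf (Gen.of (f := G) (by simp)), by simp [G], by simp [G],
    by simp [G]⟩

theorem Tr.dup (h : Tr p q r) : Tr p q q := by
  obtain ⟨f, hf, rfl, rfl, rfl⟩ := h
  exact ⟨_, Gen.comp hf (Gen.of (f := M) (by simp)), by simp [M], by simp [M],
    by simp [M]⟩

theorem Tr.base {u v w : ABC} (h₁ : u ≠ v) (h₂ : u ≠ w) (h₃ : v ≠ w) : Tr [u] [v] [w] := by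
  have h : Tr [.a] [.b] [.c] := ⟨_, Gen.id, rfl, rfl, rfl⟩
  cases u <;> cases v <;> cases w <;> simp at h₁ h₂ h₃
  · exact h
  · exact h.swap'
  · exact h.swap
  · exact h.swap.swap'
  · exact h.swap'.swap
  · exact h.swap'.swap.swap'

/-- The `k`-th power of a word. -/
def rep {A : Type*} (q : List A) (k : ℕ) : List A := (List.replicate k q).flatten

@[simp] theorem rep_zero {A : Type*} (q : List A) : rep q 0 = [] := rfl

theorem rep_succ {A : Type*} (q : List A) (k : ℕ) : rep q (k + 1) = q ++ rep q k := by
  simp [rep, List.replicate_succ]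

theorem rep_add {A : Type*} (q : List A) (k l : ℕ) : rep q (k + l) = rep q k ++ rep q l := by
  rw [rep, List.replicate_add, List.flatten_append]; rfl

theorem rep_one {A : Type*} (q : List A) : rep q 1 = q := by simp [rep]

theorem rep_succ' {A : Type*} (q : List A) (k : ℕ) : rep q (k + 1) = rep q k ++ q := by
  rw [rep_add, rep_one]

theorem Tr.app21 (h : Tr p q r) : Tr p (q ++ p) r := h.swap.append.swap

theorem Tr.app13 (h : Tr p q r) : Tr (p ++ r) q r := h.swap'.append.swap'

theorem Tr.app31 (h : Tr p q r) : Tr p q (r ++ p) := h.swap'.app21.swap'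

theorem Tr.app32 (h : Tr p q r) : Tr p q (r ++ q) := h.swap.app31.swap

theorem Tr.app23 (h : Tr p q r) : Tr p (q ++ r) r := h.swap.app13.swap

theorem Tr.pre13 (h : Tr p q r) : Tr (r ++ p) q r := h.swap'.prepend.swap'

theorem Tr.pre23 (h : Tr p q r) : Tr p (r ++ q) r := h.swap.pre13.swap

theorem Tr.prepend_rep (h : Tr p q r) (k : ℕ) : Tr (rep q k ++ p) q r := by
  induction k with
  | zero => simpa using h
  | succ k ih => simpa [rep_succ] using ih.prepend

theorem Tr.append_rep (h : Tr p q r) (k : ℕ) : Tr p q (r ++ rep q k) := by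
  induction k with
  | zero => simpa using h
  | succ k ih => simpa [rep_succ'] using ih.app32

theorem Tr.power_pair (h : Tr p q r) (k : ℕ) :
    Tr (rep q k ++ p) (rep q (k + 1) ++ p) r := by
  have := (h.prepend_rep k).app21
  rwa [← List.append_assoc, ← rep_succ] at this

theorem Tr.power_pair_left (h : Tr p q r) (k l : ℕ) :
    Tr (rep q k ++ p) (rep q (k + 1) ++ p) (r ++ rep q l ++ p) :=
  (h.append_rep l).app31.power_pair k

theorem Tr.power_pair_right (h : Tr p q r) (k l : ℕ) (hkl : k ≤ l + 1) :
    Tr (rep q k ++ p) (r ++ rep q l ++ p) (r ++ rep q (l + 1) ++ p) := by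
  obtain _ | k := k
  · have := ((h.append_rep l).app21.pre23.app31).swap'
    simpa [rep_succ', List.append_assoc] using this
  · obtain ⟨j, rfl⟩ : ∃ j, l = k + j := ⟨l - k, by omega⟩
    have := ((h.append_rep j).prepend_rep k).app21.pre13.app32.swap
    rw [add_comm k j, add_assoc j, rep_add q j, rep_add q j]
    simpa [rep_succ, List.append_assoc] using this

end Generated

end SubshiftSadic

namespace SubshiftSadic

/-- `Ret y P j l`: the word `l` follows position `j` in `y`, and its last letter is its only letter
satisfying `P`. -/
inductive Ret (y : ℤ → ABC) (P : ABC → Prop) : ℤ → List ABC → Prop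
  | last {j : ℤ} : P (y (j + 1)) → Ret y P j [y (j + 1)]
  | cons {j : ℤ} {l : List ABC} :
      ¬ P (y (j + 1)) → Ret y P (j + 1) l → Ret y P j (y (j + 1) :: l)

section

variable {y : ℤ → ABC} {P : ABC → Prop}

theorem Ret.head {j : ℤ} {t : ABC} {l : List ABC} (h : Ret y P j (t :: l)) : y (j + 1) = t := by
  cases h <;> rfl

theorem Ret.tail {j : ℤ} {t : ABC} {l : List ABC} (h : Ret y P j (t :: l)) (hl : l ≠ []) :
    Ret y P (j + 1) l := by
  cases h with
  | last => exact absurd rfl hl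
  | cons _ h => exact h

theorem Ret.drop {j : ℤ} {p l : List ABC} (h : Ret y P j (p ++ l)) (hl : l ≠ []) :
    Ret y P (j + p.length) l := by
  induction p generalizing j with
  | nil => simpa using h
  | cons t p ih =>
    have := ih (h.tail (by simp [hl]))
    simpa [add_assoc, add_comm (1 : ℤ)] using this

theorem Ret.letter {j : ℤ} {p l : List ABC} {t : ABC} (h : Ret y P j (p ++ t :: l)) :
    y (j + 1 + p.length) = t := by
  have := (h.drop (by simp)).head
  rwa [show j + 1 + (p.length : ℤ) = j + p.length + 1 by ring]

theorem Ret.seg_eq {j : ℤ} {p l : List ABC} (h : Ret y P j (p ++ l)) :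
    seg y (j + 1) p.length = p := by
  induction p generalizing j with
  | nil => rfl
  | cons t p ih =>
    rw [List.length_cons, seg_succ', h.head]
    by_cases hpl : p ++ l = []
    · simp at hpl
      simp [hpl.1]
    · rw [ih (h.tail hpl)]

theorem Ret.of_seg {j : ℤ} {m : ℕ} (h₁ : ∀ i : ℕ, i < m → ¬ P (y (j + 1 + i)))
    (h₂ : P (y (j + 1 + m))) : Ret y P j (seg y (j + 1) (m + 1)) := by
  induction m generalizing j with
  | zero =>
    rw [seg_one]; exact .last (by simpa using h₂)
  | succ m ih =>
    rw [seg_succ']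
    refine .cons (by simpa using h₁ 0 (by omega)) (ih (fun i hi => ?_) ?_)
    · convert h₁ (i + 1) (by omega) using 3; push_cast; ring
    · convert h₂ using 2; push_cast; ring

end

/-- The combinatorial properties of the sequence of labels of the occurrences of a word, when
`typ t = x₀` singles out the labels ending with a given letter `x₀`. -/
structure Labelling {α : Type*} (y : ℤ → ABC) (typ : ABC → α) (x₀ : α) : Prop where
  surj : ∀ t, ∃ k, y k = t
  main_right : ∀ k : ℤ, ∃ m : ℕ, typ (y (k + 1 + m)) = x₀
  off_main : ∃ t, typ t ≠ x₀
  fork_main : ∃ k k', typ (y k) = x₀ ∧ typ (y k') = x₀ ∧ y (k + 1) ≠ y (k' + 1)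
  two_of_off : ∀ k₁ k₂ k₃, typ (y k₁) ≠ x₀ → typ (y k₂) = typ (y k₁) →
    typ (y k₃) = typ (y k₁) → y (k₁ + 1) ≠ y (k₂ + 1) → y (k₁ + 1) ≠ y (k₃ + 1) →
    y (k₂ + 1) = y (k₃ + 1)
  two_of_main : ∀ k k', typ (y k) ≠ x₀ → typ (y k') = typ (y k) → y (k + 1) ≠ y (k' + 1) →
    ∀ k₁ k₂ k₃, typ (y k₁) = x₀ → typ (y k₂) = x₀ →
    typ (y k₃) = x₀ → y (k₁ + 1) ≠ y (k₂ + 1) → y (k₁ + 1) ≠ y (k₃ + 1) →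
    y (k₂ + 1) = y (k₃ + 1)
  typ_unique : ∀ (r : List ABC) (k₁ k₁' k₂ k₂' : ℤ),
    seg y (k₁ + 1) r.length = r → seg y (k₁' + 1) r.length = r →
    seg y (k₂ + 1) r.length = r → seg y (k₂' + 1) r.length = r →
    typ (y k₁) = typ (y k₁') → typ (y k₂) = typ (y k₂') →
    y (k₁ + r.length + 1) ≠ y (k₁' + r.length + 1) →
    y (k₂ + r.length + 1) ≠ y (k₂' + r.length + 1) →
    typ (y (k₁ + r.length)) ≠ x₀ → typ (y (k₂ + r.length)) ≠ x₀ → typ (y k₁) = typ (y k₂)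
  letter_unique : ∀ (r : List ABC) (k₁ k₁' k₂ k₂' : ℤ),
    seg y (k₁ + 1) r.length = r → seg y (k₁' + 1) r.length = r →
    seg y (k₂ + 1) r.length = r → seg y (k₂' + 1) r.length = r →
    y k₁ = y k₁' → y k₂ = y k₂' → typ (y k₁) ≠ x₀ → typ (y k₂) ≠ x₀ →
    y (k₁ + r.length + 1) ≠ y (k₁' + r.length + 1) →
    y (k₂ + r.length + 1) ≠ y (k₂' + r.length + 1) →
    typ (y (k₁ + r.length)) ≠ x₀ → typ (y (k₂ + r.length)) ≠ x₀ → y k₁ = y k₂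

theorem exists_window (K L : Set ℕ)
    (hK : ∀ k ∈ K, ∀ k' ∈ K, k < k' → ∀ e ∈ K ∪ L, e ≤ k + 1)
    (hL : ∀ l ∈ L, ∀ l' ∈ L, l < l' → ∀ e ∈ K ∪ L, e ≤ l + 1)
    (hKL : ∀ k ∈ K, k ∈ L → ∀ k' ∈ K, ∀ l' ∈ L, k < k' → ¬ k < l') :
    (∃ k l, K ⊆ {k, k + 1} ∧ L ⊆ {l}) ∨ ∃ k l, k ≤ l + 1 ∧ K ⊆ {k} ∧ L ⊆ {l, l + 1} := by
  by_cases h₁ : ∃ k ∈ K, ∃ k' ∈ K, k < k'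
  · obtain ⟨k, hk, k', hk', hkk⟩ := h₁
    left
    have hk'' : k' = k + 1 := by have := hK k hk k' hk' hkk k' (Or.inl hk'); omega
    subst hk''
    refine ⟨k, ?_⟩
    by_cases h₂ : ∃ l ∈ L, ∃ l' ∈ L, l < l'
    · obtain ⟨l, hl, l', hl', hll⟩ := h₂
      have h₃ := hL l hl l' hl' hll (k + 1) (Or.inl hk')
      have h₄ := hK k hk _ hk' hkk l' (Or.inr hl')
      have : k = l := by omega
      subst this
      exact absurd hll (hKL k hk hl _ hk' _ hl' hkk)
    · push Not at h₂
      have hK' : K ⊆ {k, k + 1} := by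
        intro e he
        have h₅ := hK k hk _ hk' hkk e (Or.inl he)
        by_contra hne
        simp at hne
        have := hK e he k hk (by omega) (k + 1) (Or.inl hk')
        omega
      rcases L.eq_empty_or_nonempty with rfl | ⟨l, hl⟩
      · exact ⟨0, hK', by simp⟩
      · refine ⟨l, hK', fun e he => ?_⟩
        have := h₂ l hl e he
        have := h₂ e he l hl
        simp; omega
  · push Not at h₁
    by_cases h₂ : ∃ l ∈ L, ∃ l' ∈ L, l < l'
    · right
      obtain ⟨l, hl, l', hl', hll⟩ := h₂
      have hl'' : l' = l + 1 := by have := hL l hl l' hl' hll l' (Or.inr hl'); omega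
      subst hl''
      have hL' : L ⊆ {l, l + 1} := by
        intro e he
        have h₅ := hL l hl _ hl' hll e (Or.inr he)
        by_contra hne
        simp at hne
        have := hL e he l hl (by omega) (l + 1) (Or.inr hl')
        omega
      rcases K.eq_empty_or_nonempty with rfl | ⟨k, hk⟩
      · exact ⟨0, l, by omega, by simp, hL'⟩
      · refine ⟨k, l, hL l hl _ hl' hll k (Or.inl hk), fun e he => ?_, hL'⟩
        have := h₁ k hk e he
        have := h₁ e he k hk
        simp; omega
    · push Not at h₂
      left
      have aux : ∀ K : Set ℕ, (∀ k ∈ K, ∀ k' ∈ K, k' ≤ k) → ∃ k, K ⊆ {k} := by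
        intro K hK
        rcases K.eq_empty_or_nonempty with rfl | ⟨k, hk⟩
        · exact ⟨0, by simp⟩
        · refine ⟨k, fun e he => ?_⟩
          have := hK k hk e he
          have := hK e he k hk
          simp; omega
      obtain ⟨k, hk⟩ := aux K h₁
      obtain ⟨l, hl⟩ := aux L h₂
      exact ⟨k, l, hk.trans (by simp), hl⟩

section

variable {y : ℤ → ABC} {P : ABC → Prop}

theorem Ret.step {j : ℤ} {l : List ABC} (h : Ret y P j l) :
    (P (y (j + 1)) ∧ l = [y (j + 1)]) ∨
      ¬ P (y (j + 1)) ∧ ∃ l', l = y (j + 1) :: l' ∧ Ret y P (j + 1) l' := by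
  cases h with
  | last h => exact Or.inl ⟨h, rfl⟩
  | cons h h' => exact Or.inr ⟨h, _, rfl, h'⟩

theorem Ret.end_letter {j : ℤ} {p l : List ABC} {t : ABC} (h : Ret y P j (p ++ [t] ++ l)) :
    y (j + (p ++ [t]).length) = t := by
  rw [List.append_assoc] at h
  have := h.letter
  rw [← this]; congr 1; simp; ring

theorem Ret.not_end {j : ℤ} {p l : List ABC} (h : Ret y P j (p ++ l)) (hp : p ≠ [])
    (hl : l ≠ []) : ¬ P (y (j + p.length)) := by
  obtain ⟨p, t, rfl⟩ : ∃ p' t, p = p' ++ [t] :=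
    ⟨_, _, (List.dropLast_append_getLast hp).symm⟩
  rw [List.append_assoc] at h
  have h' := h.drop (by simp)
  rcases h'.step with ⟨_, h₂⟩ | ⟨h₁, _⟩
  · simp [hl] at h₂
  · convert h₁ using 3; simp [add_assoc]

theorem Ret.loop {q f : List ABC} (hq : q ≠ [])
    {S : ℤ → Prop} (hS : ∀ j l, S j → Ret y P j l →
      l = f ∨ ∃ l', l = q ++ l' ∧ Ret y P (j + q.length) l' ∧ S (j + q.length))
    {j : ℤ} {l : List ABC} (hj : S j) (h : Ret y P j l) : ∃ e, l = rep q e ++ f := by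
  induction hn : l.length using Nat.strong_induction_on generalizing j l with
  | _ n ih =>
    rcases hS j l hj h with rfl | ⟨l', rfl, h', hj'⟩
    · exact ⟨0, rfl⟩
    · have := List.length_pos_iff.2 hq
      obtain ⟨e, rfl⟩ := ih l'.length (by simp at hn; omega) hj' h' rfl
      exact ⟨e + 1, by rw [rep_succ, List.append_assoc]⟩

end

theorem append_rep_eq {p q s : List ABC} (h : s ++ q = p ++ s) (d : ℕ) :
    s ++ rep q d = rep p d ++ s := by
  induction d with
  | zero => simp
  | succ d ih => rw [rep_succ, ← List.append_assoc, h, List.append_assoc, ih, rep_succ,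
      List.append_assoc]

namespace Labelling

variable {α : Type*} {y : ℤ → ABC} {typ : ABC → α} {x₀ : α}

/-- Abbreviation for the return words of a labelling. -/
local notation "R" => Ret y (fun t => typ t = x₀)

theorem typ_eq_of_fork (h : Labelling y typ x₀) {r l₁ l₁' l₂ l₂' : List ABC}
    {s₁ s₁' s₂ s₂' : ABC} {k₁ k₁' k₂ k₂' : ℤ}
    (h₁ : R k₁ (r ++ s₁ :: l₁)) (h₁' : R k₁' (r ++ s₁' :: l₁'))
    (h₂ : R k₂ (r ++ s₂ :: l₂)) (h₂' : R k₂' (r ++ s₂' :: l₂'))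
    (hs₁ : s₁ ≠ s₁') (hs₂ : s₂ ≠ s₂') (ht₁ : typ (y k₁) = typ (y k₁'))
    (ht₂ : typ (y k₂) = typ (y k₂'))
    (hr : r ≠ [] ∨ typ (y k₁) ≠ x₀ ∧ typ (y k₂) ≠ x₀) : typ (y k₁) = typ (y k₂) := by
  refine h.typ_unique r k₁ k₁' k₂ k₂' h₁.seg_eq h₁'.seg_eq h₂.seg_eq h₂'.seg_eq ht₁ ht₂
    ?_ ?_ ?_ ?_
  · rw [(h₁.drop (by simp)).head, (h₁'.drop (by simp)).head]; exact hs₁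
  · rw [(h₂.drop (by simp)).head, (h₂'.drop (by simp)).head]; exact hs₂
  · rcases eq_or_ne r [] with rfl | hr'
    · simpa using (hr.resolve_left (by simp)).1
    · exact h₁.not_end hr' (by simp)
  · rcases eq_or_ne r [] with rfl | hr'
    · simpa using (hr.resolve_left (by simp)).2
    · exact h₂.not_end hr' (by simp)

theorem letter_eq_of_fork (h : Labelling y typ x₀) {r l₁ l₁' l₂ l₂' : List ABC}
    {s₁ s₁' s₂ s₂' : ABC} {k₁ k₁' k₂ k₂' : ℤ}
    (h₁ : R k₁ (r ++ s₁ :: l₁)) (h₁' : R k₁' (r ++ s₁' :: l₁'))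
    (h₂ : R k₂ (r ++ s₂ :: l₂)) (h₂' : R k₂' (r ++ s₂' :: l₂'))
    (hs₁ : s₁ ≠ s₁') (hs₂ : s₂ ≠ s₂') (ht₁ : y k₁ = y k₁') (ht₂ : y k₂ = y k₂')
    (hx₁ : typ (y k₁) ≠ x₀) (hx₂ : typ (y k₂) ≠ x₀) : y k₁ = y k₂ := by
  refine h.letter_unique r k₁ k₁' k₂ k₂' h₁.seg_eq h₁'.seg_eq h₂.seg_eq h₂'.seg_eq ht₁ ht₂
    hx₁ hx₂ ?_ ?_ ?_ ?_
  · rw [(h₁.drop (by simp)).head, (h₁'.drop (by simp)).head]; exact hs₁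
  · rw [(h₂.drop (by simp)).head, (h₂'.drop (by simp)).head]; exact hs₂
  · rcases eq_or_ne r [] with rfl | hr'
    · simpa using hx₁
    · exact h₁.not_end hr' (by simp)
  · rcases eq_or_ne r [] with rfl | hr'
    · simpa using hx₂
    · exact h₂.not_end hr' (by simp)

theorem exists_fork {q f s p : List ABC} {q₀ f₀ t : ABC} {qt ft : List ABC}
    (hq : q = q₀ :: qt) (hf : f = f₀ :: ft) (hs : s ++ q = p ++ [t] ++ s)
    {l l' e : ℕ} (hl : l < l') (he : l < e)
    {k₁ k₁' j : ℤ} (h₁ : R k₁ (s ++ rep q l ++ f)) (h₁' : R k₁' (s ++ rep q l' ++ f))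
    (hj : R j (s ++ rep q e ++ f)) :
    ∃ (l₁ l₁' l₂ l₂' : List ABC) (k₂ : ℤ),
      R k₁ ((s ++ rep q l) ++ f₀ :: l₁) ∧ R k₁' ((s ++ rep q l) ++ q₀ :: l₁') ∧
      R k₂ ((s ++ rep q l) ++ f₀ :: l₂) ∧ R j ((s ++ rep q l) ++ q₀ :: l₂') ∧ y k₂ = t := by
  obtain ⟨d, rfl⟩ : ∃ d, l' = l + (d + 1) := ⟨l' - l - 1, by omega⟩
  obtain ⟨d', rfl⟩ : ∃ d', e = l + (d' + 1) := ⟨e - l - 1, by omega⟩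
  have e₁ : ∀ d, s ++ rep q (l + (d + 1)) ++ f = (s ++ rep q l) ++ q₀ :: (qt ++ rep q d ++ f) := by
    intro d
    rw [rep_add, rep_succ q d, hq]
    simp
  have e₂ : s ++ rep q (l + (d' + 1)) ++ f
      = (rep (p ++ [t]) d' ++ p ++ [t]) ++ (s ++ rep q l ++ f) := by
    rw [show l + (d' + 1) = d' + 1 + l by ring, rep_add, ← List.append_assoc s,
      append_rep_eq hs, rep_succ']
    simp
  have hj' := hj
  rw [e₂] at hj'
  refine ⟨ft, qt ++ rep q d ++ f, ft, qt ++ rep q d' ++ f,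
    j + (rep (p ++ [t]) d' ++ p ++ [t]).length, ?_, ?_, ?_, ?_, hj'.end_letter⟩
  · rw [← hf]; exact h₁
  · rw [← e₁]; exact h₁'
  · rw [← hf]; exact hj'.drop (by simp [hf])
  · rw [← e₁]; exact hj

theorem power_bound_typ (h : Labelling y typ x₀) {q f s p : List ABC} {q₀ f₀ t : ABC}
    {qt ft : List ABC} (hq : q = q₀ :: qt) (hf : f = f₀ :: ft) (hne : f₀ ≠ q₀)
    (hs : s ++ q = p ++ [t] ++ s) {l l' e : ℕ} (hl : l < l')
    {k₁ k₁' j : ℤ} (h₁ : R k₁ (s ++ rep q l ++ f)) (h₁' : R k₁' (s ++ rep q l' ++ f))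
    (hj : R j (s ++ rep q e ++ f)) (hjt : y j = t) (hr : s ++ rep q l ≠ [])
    (hk₁ : typ (y k₁) = x₀) (hk₁' : typ (y k₁') = x₀) (ht : typ t ≠ x₀) : e ≤ l := by
  by_contra! he
  obtain ⟨l₁, l₁', l₂, l₂', k₂, a₁, a₂, a₃, a₄, a₅⟩ := exists_fork hq hf hs hl he h₁ h₁' hj
  have := h.typ_eq_of_fork a₁ a₂ a₃ a₄ hne hne (by rw [hk₁, hk₁']) (by rw [a₅, hjt])
    (Or.inl hr)
  rw [hk₁, a₅] at this
  exact ht this.symm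

theorem power_bound_letter (h : Labelling y typ x₀) {q f s p : List ABC} {q₀ f₀ t w : ABC}
    {qt ft : List ABC} (hq : q = q₀ :: qt) (hf : f = f₀ :: ft) (hne : f₀ ≠ q₀)
    (hs : s ++ q = p ++ [t] ++ s) {l l' e : ℕ} (hl : l < l')
    {k₁ k₁' j : ℤ} (h₁ : R k₁ (s ++ rep q l ++ f)) (h₁' : R k₁' (s ++ rep q l' ++ f))
    (hj : R j (s ++ rep q e ++ f)) (hjt : y j = t)
    (hk₁ : y k₁ = w) (hk₁' : y k₁' = w) (ht : typ t ≠ x₀) (hw : typ w ≠ x₀)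
    (hwt : w ≠ t) : e ≤ l := by
  by_contra! he
  obtain ⟨l₁, l₁', l₂, l₂', k₂, a₁, a₂, a₃, a₄, a₅⟩ := exists_fork hq hf hs hl he h₁ h₁' hj
  have := h.letter_eq_of_fork a₁ a₂ a₃ a₄ hne hne (by rw [hk₁, hk₁']) (by rw [a₅, hjt])
    (by rwa [hk₁]) (by rwa [a₅])
  rw [hk₁, a₅] at this
  exact hwt this

variable (y typ x₀) in
/-- The conclusion: up to a composition of the five morphisms, the return words are letters. -/
def Tame : Prop :=
  ∃ p q r, Tr p q r ∧ ∀ k l, typ (y k) = x₀ → R k l → l = p ∨ l = q ∨ l = r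

theorem tame_of_single_loop (h : Labelling y typ x₀) {q f e₁ p : List ABC} {q₀ f₀ v : ABC}
    {qt ft : List ABC} (hq : q = q₀ :: qt) (hf : f = f₀ :: ft) (hne : f₀ ≠ q₀)
    (hp : q = p ++ [v]) (hv : typ v ≠ x₀) (hTr : Tr e₁ q f)
    (hmain : ∀ k l, typ (y k) = x₀ → R k l → l = e₁ ∨ ∃ e, l = rep q (e + 1) ++ f) :
    Tame y typ x₀ := by
  set K : Set ℕ := {k | 1 ≤ k ∧ ∃ k₁, typ (y k₁) = x₀ ∧ R k₁ (rep q k ++ f)} with hKdef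
  have hK : ∀ k ∈ K, ∀ k' ∈ K, k < k' → ∀ e ∈ K ∪ (∅ : Set ℕ), e ≤ k + 1 := by
    rintro k ⟨hk0, k₁, hk₁, hR₁⟩ k' ⟨-, k₁', hk₁', hR₁'⟩ hkk e he
    obtain ⟨he0, k₂, hk₂, hR₂⟩ := he.resolve_right (by simp)
    obtain ⟨e, rfl⟩ : ∃ d, e = d + 1 := ⟨e - 1, by omega⟩
    rw [rep_succ, List.append_assoc] at hR₂
    have hd := hR₂.drop (by simp [hf])
    have hy : y (k₂ + q.length) = v := by
      rw [hp] at hR₂ ⊢; exact hR₂.end_letter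
    have := h.power_bound_typ (s := []) hq hf hne (by simpa using hp) hkk hR₁ hR₁' hd hy
      (by obtain ⟨k, rfl⟩ : ∃ d, k = d + 1 := ⟨k - 1, by omega⟩
          simp [rep_succ, hq]) hk₁ hk₁' hv
    omega
  have hfin : ∃ k, K ⊆ {k, k + 1} := by
    rcases exists_window K ∅ hK (by simp) (by simp) with ⟨k, l, h₁, -⟩ | ⟨k, l, -, h₁, -⟩
    · exact ⟨k, h₁⟩
    · exact ⟨k, h₁.trans (by simp)⟩
  obtain ⟨k, hk⟩ := hfin
  have hT : Tr e₁ (rep q (k + 1) ++ f) (rep q k ++ f) := by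
    have h₂ : Tr f q e₁ := hTr.swap.swap'.swap
    exact (h₂.power_pair k).swap.swap'.swap
  refine ⟨_, _, _, hT, fun k' l hk' hl => ?_⟩
  rcases hmain k' l hk' hl with rfl | ⟨e, rfl⟩
  · exact Or.inl rfl
  · have : e + 1 ∈ K := ⟨by omega, k', hk', hl⟩
    rcases hk this with h' | h'
    · rw [h']; simp
    · rw [Set.mem_singleton_iff] at h'; rw [h']; simp

theorem tame_of_window {p q r : List ABC} (hT : Tr p q r) {K L : Set ℕ}
    (hK : ∀ k ∈ K, ∀ k' ∈ K, k < k' → ∀ e ∈ K ∪ L, e ≤ k + 1)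
    (hL : ∀ l ∈ L, ∀ l' ∈ L, l < l' → ∀ e ∈ K ∪ L, e ≤ l + 1)
    (hKL : ∀ k ∈ K, k ∈ L → ∀ k' ∈ K, ∀ l' ∈ L, k < k' → ¬ k < l')
    (hmain : ∀ k l, typ (y k) = x₀ → R k l →
      (∃ e ∈ K, l = rep q e ++ p) ∨ ∃ e ∈ L, l = r ++ rep q e ++ p) : Tame y typ x₀ := by
  rcases exists_window K L hK hL hKL with ⟨k, l, h₁, h₂⟩ | ⟨k, l, hkl, h₁, h₂⟩
  · refine ⟨_, _, _, hT.power_pair_left k l, fun k' l' hk' hl' => ?_⟩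
    rcases hmain k' l' hk' hl' with ⟨e, he, rfl⟩ | ⟨e, he, rfl⟩
    · rcases h₁ he with h | h
      · rw [h]; simp
      · rw [Set.mem_singleton_iff] at h; rw [h]; simp
    · have := h₂ he
      rw [Set.mem_singleton_iff] at this; rw [this]; simp
  · refine ⟨_, _, _, hT.power_pair_right k l hkl, fun k' l' hk' hl' => ?_⟩
    rcases hmain k' l' hk' hl' with ⟨e, he, rfl⟩ | ⟨e, he, rfl⟩
    · have := h₁ he
      rw [Set.mem_singleton_iff] at this; rw [this]; simp
    · rcases h₂ he with h | h
      · rw [h]; simp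
      · rw [Set.mem_singleton_iff] at h; rw [h]; simp

theorem exists_third {u v : ABC} (h : u ≠ v) :
    ∃ w, w ≠ u ∧ w ≠ v ∧ ∀ t : ABC, t = u ∨ t = v ∨ t = w := by
  cases u <;> cases v <;> first | exact absurd rfl h | skip
  · exact ⟨.c, by simp, by simp, fun t => by cases t <;> simp⟩
  · exact ⟨.b, by simp, by simp, fun t => by cases t <;> simp⟩
  · exact ⟨.c, by simp, by simp, fun t => by cases t <;> simp⟩
  · exact ⟨.a, by simp, by simp, fun t => by cases t <;> simp⟩
  · exact ⟨.b, by simp, by simp, fun t => by cases t <;> simp⟩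
  · exact ⟨.a, by simp, by simp, fun t => by cases t <;> simp⟩

theorem exists_pred_of_rep {q p f : List ABC} {v : ABC} (hp : q = p ++ [v]) (hf : f ≠ [])
    {j : ℤ} {e : ℕ} (h : R j (rep q (e + 1) ++ f)) : ∃ j', y j' = v ∧ R j' (rep q e ++ f) := by
  rw [rep_succ, List.append_assoc] at h
  refine ⟨j + q.length, ?_, h.drop (by simp [hf])⟩
  rw [hp] at h ⊢; exact h.end_letter

theorem tame_of_double_loop (h : Labelling y typ x₀) {u v w : ABC} (huv : u ≠ v)
    (huw : u ≠ w) (hvw : v ≠ w) (hu : typ u = x₀) (hv : typ v ≠ x₀) (hw : typ w ≠ x₀)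
    (hFv : ∀ k, y k = v → y (k + 1) = u ∨ y (k + 1) = v)
    (hFw : ∀ k, y k = w → y (k + 1) = u ∨ y (k + 1) = v)
    (hFx : (∀ k, typ (y k) = x₀ → y (k + 1) = w ∨ y (k + 1) = u) ∨
      ∀ k, typ (y k) = x₀ → y (k + 1) = w ∨ y (k + 1) = v) : Tame y typ x₀ := by
  have hloop : ∀ j l, (y (j + 1) = u ∨ y (j + 1) = v) → R j l →
      ∃ e, l = rep [v] e ++ [u] := by
    intro j l hj hl
    refine Ret.loop (q := [v]) (S := fun j => y (j + 1) = u ∨ y (j + 1) = v) (by simp)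
      ?_ hj hl
    rintro j l (hj | hj) hl
    · rcases hl.step with ⟨_, rfl⟩ | ⟨h', _⟩
      · rw [hj]; simp
      · rw [hj] at h'; exact absurd hu h'
    · rcases hl.step with ⟨h', _⟩ | ⟨_, l', rfl, hl'⟩
      · rw [hj] at h'; exact absurd h' hv
      · exact Or.inr ⟨l', by rw [hj]; rfl, hl', hFv _ hj⟩
  have hT : Tr [u] [v] [w] := Tr.base huv huw hvw
  have hK1 : ∀ k k' : ℕ, ∀ k₁ k₁', typ (y k₁) = x₀ → typ (y k₁') = x₀ →
      R k₁ (rep [v] k ++ [u]) → R k₁' (rep [v] k' ++ [u]) → k < k' → 1 ≤ k := by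
    intro k k' k₁ k₁' hk₁ hk₁' h₁ h₁' hkk
    by_contra hk
    obtain rfl : k = 0 := by omega
    obtain ⟨k', rfl⟩ : ∃ d, k' = d + 1 := ⟨k' - 1, by omega⟩
    rw [rep_succ] at h₁'
    have e₁ : y (k₁ + 1) = u := h₁.head
    have e₂ : y (k₁' + 1) = v := Ret.head h₁'
    rcases hFx with hF | hF
    · rcases hF _ hk₁' with h' | h' <;> rw [e₂] at h'
      · exact hvw h'
      · exact huv h'.symm
    · rcases hF _ hk₁ with h' | h' <;> rw [e₁] at h'
      · exact huw h'
      · exact huv h'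
  have hwpos : ∀ (l : ℕ) j, R j ([w] ++ rep [v] l ++ [u]) →
      y (j + 1) = w ∧ R (j + 1) (rep [v] l ++ [u]) := fun l j hj =>
    ⟨Ret.head hj, Ret.tail hj (by simp)⟩
  have hpred : ∀ e, e + 1 ∈ {e | ∃ k, typ (y k) = x₀ ∧ R k (rep [v] e ++ [u])} ∪
      {e | ∃ k, typ (y k) = x₀ ∧ R k ([w] ++ rep [v] e ++ [u])} →
      ∃ j, y j = v ∧ R j (rep [v] e ++ [u]) := by
    rintro e (⟨k, -, hk⟩ | ⟨k, -, hk⟩)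
    · exact exists_pred_of_rep (p := []) rfl (by simp) hk
    · exact exists_pred_of_rep (p := []) rfl (by simp) (hwpos _ _ hk).2
  refine tame_of_window hT (K := {e | ∃ k, typ (y k) = x₀ ∧ R k (rep [v] e ++ [u])})
    (L := {e | ∃ k, typ (y k) = x₀ ∧ R k ([w] ++ rep [v] e ++ [u])}) ?_ ?_ ?_ ?_
  · rintro k ⟨k₁, hk₁, h₁⟩ k' ⟨k₁', hk₁', h₁'⟩ hkk e he
    obtain _ | e := e
    · omega
    obtain ⟨j, hj, hjR⟩ := hpred e he
    have h1k := hK1 k k' k₁ k₁' hk₁ hk₁' h₁ h₁' hkk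
    obtain ⟨k, rfl⟩ : ∃ d, k = d + 1 := ⟨k - 1, by omega⟩
    have := h.power_bound_typ (q := [v]) (f := [u]) (s := []) (p := []) rfl rfl huv rfl
      hkk h₁ h₁' hjR hj (by simp [rep_succ]) hk₁ hk₁' hv
    omega
  · rintro k ⟨k₁, hk₁, h₁⟩ k' ⟨k₁', hk₁', h₁'⟩ hkk e he
    obtain _ | e := e
    · omega
    obtain ⟨j, hj, hjR⟩ := hpred e he
    obtain ⟨a₁, a₂⟩ := hwpos _ _ h₁
    obtain ⟨b₁, b₂⟩ := hwpos _ _ h₁'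
    have := h.power_bound_letter (q := [v]) (f := [u]) (s := []) (p := []) rfl rfl huv rfl
      hkk a₂ b₂ hjR hj a₁ b₁ hv hw hvw.symm
    omega
  · rintro k ⟨k₁, hk₁, h₁⟩ ⟨k₂, hk₂, h₂⟩ k' ⟨k₁', hk₁', h₁'⟩ l' ⟨k₂', hk₂', h₂'⟩ hkk hkl
    have h1k := hK1 k k' k₁ k₁' hk₁ hk₁' h₁ h₁' hkk
    obtain ⟨a₁, a₂⟩ := hwpos _ _ h₂
    obtain ⟨b₁, b₂⟩ := hwpos _ _ h₂'
    obtain ⟨d, rfl⟩ : ∃ d, k' = k + (d + 1) := ⟨k' - k - 1, by omega⟩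
    obtain ⟨d', rfl⟩ : ∃ d, l' = k + (d + 1) := ⟨l' - k - 1, by omega⟩
    rw [rep_add, rep_succ [v] d, List.append_assoc] at h₁'
    rw [rep_add, rep_succ [v] d', List.append_assoc] at b₂
    have hne : rep [v] k ≠ [] := by
      obtain ⟨k, rfl⟩ : ∃ d, k = d + 1 := ⟨k - 1, by omega⟩
      simp [rep_succ]
    have := h.typ_eq_of_fork h₁ h₁' a₂ b₂ huv huv (by rw [hk₁, hk₁']) (by rw [a₁, b₁])
      (Or.inl hne)
    rw [hk₁, a₁] at this
    exact hw this.symm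
  · intro k l hk hl
    have hcase : y (k + 1) = w ∨ (y (k + 1) = u ∨ y (k + 1) = v) := by
      rcases hFx with hF | hF <;> rcases hF k hk with h' | h' <;> simp [h']
    rcases hcase with h' | h'
    · right
      rcases hl.step with ⟨h'', _⟩ | ⟨_, l', rfl, hl'⟩
      · rw [h'] at h''; exact absurd h'' hw
      · obtain ⟨e, rfl⟩ := hloop _ _ (hFw _ h') hl'
        rw [h'] at hl ⊢
        exact ⟨e, ⟨k, hk, hl⟩, rfl⟩
    · left
      obtain ⟨e, rfl⟩ := hloop _ _ h' hl
      exact ⟨e, ⟨k, hk, hl⟩, rfl⟩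

theorem tame_of_alternating_loop (h : Labelling y typ x₀) {u v w : ABC} (huv : u ≠ v)
    (huw : u ≠ w) (hvw : v ≠ w) (hu : typ u = x₀) (hv : typ v ≠ x₀) (hw : typ w ≠ x₀)
    (hFv : ∀ k, y k = v → y (k + 1) = u ∨ y (k + 1) = w)
    (hFw : ∀ k, y k = w → y (k + 1) = v)
    (hFx : ∃ t, ∀ k, typ (y k) = x₀ → y (k + 1) ≠ t) (hcov : ∀ t, t = u ∨ t = v ∨ t = w) :
    Tame y typ x₀ := by
  have hloop : ∀ j l, y j = v → R j l → ∃ e, l = rep [w, v] e ++ [u] := by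
    intro j l hj hl
    refine Ret.loop (q := [w, v]) (S := fun j => y j = v) (by simp) ?_ hj hl
    intro j l hj hl
    rcases hFv j hj with hj | hj
    · rcases hl.step with ⟨_, rfl⟩ | ⟨h', _⟩
      · rw [hj]; simp
      · rw [hj] at h'; exact absurd hu h'
    · rcases hl.step with ⟨h', _⟩ | ⟨_, l', rfl, hl'⟩
      · rw [hj] at h'; exact absurd h' hw
      · have e := hFw _ hj
        rcases hl'.step with ⟨h', _⟩ | ⟨_, l'', rfl, hl''⟩
        · rw [e] at h'; exact absurd h' hv
        · refine Or.inr ⟨l'', by rw [hj, e]; rfl, ?_, ?_⟩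
          · convert hl'' using 1
            simp; ring
          · rw [← e]; congr 1; simp; ring
  have hstep : ∀ k l, typ (y k) = x₀ → R k l →
      (y (k + 1) = u ∧ l = [u]) ∨ (y (k + 1) = w ∧ ∃ e, l = rep [w, v] (e + 1) ++ [u]) ∨
      (y (k + 1) = v ∧ ∃ e, l = [v] ++ rep [w, v] e ++ [u]) := by
    intro k l hk hl
    rcases hcov (y (k + 1)) with h' | h' | h'
    · refine Or.inl ⟨h', ?_⟩
      rcases hl.step with ⟨_, rfl⟩ | ⟨h'', _⟩
      · rw [h']
      · rw [h'] at h''; exact absurd hu h''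
    · refine Or.inr (Or.inr ⟨h', ?_⟩)
      rcases hl.step with ⟨h'', _⟩ | ⟨_, l', rfl, hl'⟩
      · rw [h'] at h''; exact absurd h'' hv
      · obtain ⟨e, rfl⟩ := hloop _ _ h' hl'
        exact ⟨e, by rw [h']; rfl⟩
    · refine Or.inr (Or.inl ⟨h', ?_⟩)
      rcases hl.step with ⟨h'', _⟩ | ⟨_, l', rfl, hl'⟩
      · rw [h'] at h''; exact absurd h'' hw
      · have e := hFw _ h'
        rcases hl'.step with ⟨h'', _⟩ | ⟨_, l'', rfl, hl''⟩
        · rw [e] at h''; exact absurd h'' hv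
        · obtain ⟨d, rfl⟩ := hloop _ _ e hl''
          exact ⟨d, by rw [h', e, rep_succ]; rfl⟩
  have hT : Tr [u] [w, v] [v] := (Tr.base huw huv hvw.symm).app23
  obtain ⟨t, ht⟩ := hFx
  by_cases htv : t = v
  · subst htv
    refine h.tame_of_single_loop (q := [w, t]) (f := [u]) (e₁ := [u]) (p := [w]) rfl rfl huw rfl
      hv hT.swap.dup.swap fun k l hk hl => ?_
    rcases hstep k l hk hl with ⟨_, h'⟩ | ⟨_, h'⟩ | ⟨h', _⟩
    · exact Or.inl h'
    · exact Or.inr h'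
    · exact absurd h' (ht k hk)
  have hK1 : ∀ k k' : ℕ, ∀ k₁ k₁', typ (y k₁) = x₀ → typ (y k₁') = x₀ →
      R k₁ (rep [w, v] k ++ [u]) → R k₁' (rep [w, v] k' ++ [u]) → k < k' → 1 ≤ k := by
    intro k k' k₁ k₁' hk₁ hk₁' h₁ h₁' hkk
    by_contra hk
    obtain rfl : k = 0 := by omega
    obtain ⟨k', rfl⟩ : ∃ d, k' = d + 1 := ⟨k' - 1, by omega⟩
    rw [rep_succ] at h₁'
    have e₁ : y (k₁ + 1) = u := h₁.head
    have e₂ : y (k₁' + 1) = w := Ret.head h₁'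
    rcases hcov t with rfl | rfl | rfl
    · exact ht _ hk₁ e₁
    · exact htv rfl
    · exact ht _ hk₁' e₂
  have hKb : ∀ k k' : ℕ, ∀ k₁ k₁', typ (y k₁) = x₀ → typ (y k₁') = x₀ →
      R k₁ (rep [w, v] k ++ [u]) → R k₁' (rep [w, v] k' ++ [u]) → k < k' →
      ∀ e j, y j = v → R j (rep [w, v] e ++ [u]) → e ≤ k := by
    intro k k' k₁ k₁' hk₁ hk₁' h₁ h₁' hkk e j hj hjR
    have h1k := hK1 k k' k₁ k₁' hk₁ hk₁' h₁ h₁' hkk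
    obtain ⟨k, rfl⟩ : ∃ d, k = d + 1 := ⟨k - 1, by omega⟩
    exact h.power_bound_typ (q := [w, v]) (f := [u]) (s := []) (p := [w]) rfl rfl huw rfl
      hkk h₁ h₁' hjR hj (by simp [rep_succ]) hk₁ hk₁' hv
  have hvpos : ∀ (l : ℕ) j, R j ([v] ++ rep [w, v] l ++ [u]) →
      y (j + 1) = v ∧ R (j + 1) (rep [w, v] l ++ [u]) := fun l j hj =>
    ⟨Ret.head hj, Ret.tail hj (by simp)⟩
  refine tame_of_window hT (K := {e | ∃ k, typ (y k) = x₀ ∧ R k (rep [w, v] e ++ [u])})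
    (L := {e | ∃ k, typ (y k) = x₀ ∧ R k ([v] ++ rep [w, v] e ++ [u])}) ?_ ?_ ?_ ?_
  · rintro k ⟨k₁, hk₁, h₁⟩ k' ⟨k₁', hk₁', h₁'⟩ hkk e (⟨k₂, hk₂, h₂⟩ | ⟨k₂, hk₂, h₂⟩)
    · obtain _ | e := e
      · omega
      obtain ⟨j, hj, hjR⟩ := exists_pred_of_rep (p := [w]) rfl (by simp) h₂
      have := hKb k k' k₁ k₁' hk₁ hk₁' h₁ h₁' hkk e j hj hjR
      omega
    · have := hKb k k' k₁ k₁' hk₁ hk₁' h₁ h₁' hkk e _ (hvpos _ _ h₂).1 (hvpos _ _ h₂).2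
      omega
  · rintro k ⟨k₁, hk₁, h₁⟩ k' ⟨k₁', hk₁', h₁'⟩ hkk e he
    obtain _ | e := e
    · omega
    have : ∃ j, y j = w ∧ R j ([v] ++ rep [w, v] e ++ [u]) := by
      rcases he with ⟨k₂, hk₂, h₂⟩ | ⟨k₂, hk₂, h₂⟩
      · rw [rep_succ] at h₂
        exact ⟨_, Ret.head h₂, Ret.tail h₂ (by simp)⟩
      · rw [rep_succ] at h₂
        have h₃ := Ret.tail h₂ (by simp)
        exact ⟨_, Ret.head h₃, Ret.tail h₃ (by simp)⟩
    obtain ⟨j, hj, hjR⟩ := this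
    have := h.power_bound_typ (q := [w, v]) (f := [u]) (s := [v]) (p := [v]) rfl rfl huw rfl
      hkk h₁ h₁' hjR hj (by simp) hk₁ hk₁' hw
    omega
  · rintro k ⟨k₁, hk₁, h₁⟩ - k' ⟨k₁', hk₁', h₁'⟩ l' ⟨k₂', hk₂', h₂'⟩ hkk hkl
    have := hKb k k' k₁ k₁' hk₁ hk₁' h₁ h₁' hkk l' _ (hvpos _ _ h₂').1 (hvpos _ _ h₂').2
    omega
  · intro k l hk hl
    rcases hstep k l hk hl with ⟨_, rfl⟩ | ⟨_, e, rfl⟩ | ⟨_, e, rfl⟩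
    · exact Or.inl ⟨0, ⟨k, hk, hl⟩, rfl⟩
    · exact Or.inl ⟨_, ⟨k, hk, hl⟩, rfl⟩
    · exact Or.inr ⟨_, ⟨k, hk, hl⟩, rfl⟩

theorem tame_of_main_main (h : Labelling y typ x₀) {u v w : ABC} (huv : u ≠ v)
    (huw : u ≠ w) (hvw : v ≠ w) (hu : typ u = x₀) (hv : typ v ≠ x₀) (hw : typ w = x₀)
    (hcov : ∀ t, t = u ∨ t = v ∨ t = w) (hFv : ∀ k, y k = v → y (k + 1) ≠ w)
    (hFx : ∃ t, ∀ k, typ (y k) = x₀ → y (k + 1) ≠ t) : Tame y typ x₀ := by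
  obtain ⟨t, ht⟩ := hFx
  by_cases htv : t = v
  · subst htv
    refine ⟨_, _, _, Tr.base huv huw hvw, fun k l hk hl => ?_⟩
    rcases hl.step with ⟨_, rfl⟩ | ⟨h', _⟩
    · rcases hcov (y (k + 1)) with h' | h' | h' <;> simp [h']
    · rcases hcov (y (k + 1)) with h'' | h'' | h'' <;> rw [h''] at h'
      · exact absurd hu h'
      · exact absurd h'' (ht k hk)
      · exact absurd hw h'
  have htu : t = u := by
    rcases hcov t with rfl | rfl | rfl
    · rfl
    · exact absurd rfl htv
    · obtain ⟨k, hk⟩ := h.surj t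
      rcases hcov (y (k - 1)) with h' | h' | h'
      · exact absurd (by simpa using hk) (ht (k - 1) (by rw [h', hu]))
      · exact absurd (by simpa using hk) (hFv (k - 1) h')
      · exact absurd (by simpa using hk) (ht (k - 1) (by rw [h', hw]))
  subst htu
  refine h.tame_of_single_loop (q := [v]) (f := [t]) (e₁ := [w]) (p := []) rfl rfl huv rfl hv
    (Tr.base hvw.symm huw.symm huv.symm) fun k l hk hl => ?_
  rcases hl.step with ⟨h', rfl⟩ | ⟨h', l', rfl, hl'⟩
  · rcases hcov (y (k + 1)) with h'' | h'' | h''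
    · exact absurd h'' (ht k hk)
    · rw [h''] at h'; exact absurd h' hv
    · exact Or.inl (by rw [h''])
  · have hy : y (k + 1) = v := by
      rcases hcov (y (k + 1)) with h'' | h'' | h''
      · exact absurd h'' (ht k hk)
      · exact h''
      · rw [h''] at h'; exact absurd hw h'
    right
    obtain ⟨e, rfl⟩ : ∃ e, l' = rep [v] e ++ [t] := by
      refine Ret.loop (q := [v]) (S := fun j => y j = v) (by simp) ?_ hy hl'
      intro j l hj hl
      rcases hcov (y (j + 1)) with h'' | h'' | h''
      · rcases hl.step with ⟨_, rfl⟩ | ⟨h₃, _⟩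
        · exact Or.inl (by rw [h''])
        · rw [h''] at h₃; exact absurd hu h₃
      · rcases hl.step with ⟨h₃, _⟩ | ⟨_, l', rfl, hl'⟩
        · rw [h''] at h₃; exact absurd h₃ hv
        · exact Or.inr ⟨l', by rw [h'']; rfl, hl', h''⟩
      · exact absurd h'' (hFv j hj)
    exact ⟨e, by rw [hy, rep_succ]; rfl⟩

theorem false_of_trapped (h : Labelling y typ x₀) (S : ABC → Prop)
    (hS : ∀ k, S (y k) → S (y (k + 1))) (hx : ∀ t, S t → typ t ≠ x₀) (t : ABC) : ¬ S t := by
  intro ht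
  obtain ⟨k, rfl⟩ := h.surj t
  have : ∀ m : ℕ, S (y (k + m)) := by
    intro m
    induction m with
    | zero => simpa using ht
    | succ m ih => simpa [add_assoc] using hS _ ih
  obtain ⟨m, hm⟩ := h.main_right k
  refine hx _ (this (m + 1)) ?_
  rw [← hm]; congr 2; push_cast; ring

theorem exists_missing {y : ℤ → ABC} {S : ℤ → Prop} {k₁ k₂ : ℤ} (h₁ : S k₁) (h₂ : S k₂)
    (hne : y (k₁ + 1) ≠ y (k₂ + 1))
    (htwo : ∀ k₁ k₂ k₃, S k₁ → S k₂ → S k₃ → y (k₁ + 1) ≠ y (k₂ + 1) →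
      y (k₁ + 1) ≠ y (k₃ + 1) → y (k₂ + 1) = y (k₃ + 1)) :
    ∃ t, ∀ k, S k → y (k + 1) ≠ t := by
  obtain ⟨t, ht₁, ht₂, -⟩ := exists_third hne
  refine ⟨t, fun k hk hkt => ?_⟩
  have := htwo k₁ k₂ k h₁ h₂ hk hne (by rw [hkt]; exact ht₁.symm)
  rw [hkt] at this
  exact ht₂ this.symm

theorem ret_singleton {u : ABC} (hu : typ u = x₀) {k : ℤ} {l : List ABC} (hk : y (k + 1) = u)
    (hl : R k l) : l = [u] := by
  rcases hl.step with ⟨_, rfl⟩ | ⟨h, _⟩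
  · rw [hk]
  · rw [hk] at h; exact absurd hu h

theorem ret_cons {u : ABC} (hu : typ u ≠ x₀) {k : ℤ} {l : List ABC} (hk : y (k + 1) = u)
    (hl : R k l) : ∃ l', l = u :: l' ∧ R (k + 1) l' := by
  rcases hl.step with ⟨h, rfl⟩ | ⟨_, l', rfl, h⟩
  · rw [hk] at h; exact absurd h hu
  · exact ⟨l', by rw [hk], h⟩

theorem tame_of_single_fork (h : Labelling y typ x₀) {u v w g : ABC} (huv : u ≠ v)
    (huw : u ≠ w) (hvw : v ≠ w) (hu : typ u = x₀) (hv : typ v ≠ x₀) (hw : typ w ≠ x₀)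
    (hcov : ∀ t, t = u ∨ t = v ∨ t = w) (hFv : ∃ t, ∀ k, y k = v → y (k + 1) ≠ t)
    (hFw : ∀ k, y k = w → y (k + 1) = g)
    (hFx : ∃ t, ∀ k, typ (y k) = x₀ → y (k + 1) ≠ t) : Tame y typ x₀ := by
  have hgw : g ≠ w := by
    rintro rfl
    exact h.false_of_trapped (fun t => t = g) hFw (fun t ht => ht ▸ hw) g rfl
  obtain ⟨t, ht⟩ := hFv
  obtain ⟨t', ht'⟩ := hFx
  have hxw : t = w → t' ≠ w := by
    intro e e'
    rw [e] at ht
    rw [e'] at ht'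
    obtain ⟨k, hk⟩ := h.surj w
    have hk' : y (k - 1 + 1) = w := by simpa using hk
    rcases hcov (y (k - 1)) with h' | h' | h'
    · exact ht' _ (by rw [h', hu]) hk'
    · exact ht _ h' hk'
    · rw [hFw _ h'] at hk'; exact hgw hk'
  rcases hcov g with rfl | rfl | rfl
  · rcases hcov t with rfl | rfl | rfl
    · have hret : ∀ k l, y k = w → R k l → l = [t] := fun k l hk hl =>
        ret_singleton hu (hFw k hk) hl
      have hv' : ∀ k l, y k = v → R k l → ∃ e, l = rep [v] e ++ [w, t] := by
        intro k l hk hl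
        refine Ret.loop (q := [v]) (S := fun j => y j = v) (by simp) ?_ hk hl
        intro j l hj hl
        rcases hcov (y (j + 1)) with h'' | h'' | h''
        · exact absurd h'' (ht j hj)
        · obtain ⟨l', rfl, hl'⟩ := ret_cons hv h'' hl
          exact Or.inr ⟨l', rfl, hl', h''⟩
        · obtain ⟨l', rfl, hl'⟩ := ret_cons hw h'' hl
          rw [hret _ _ h'' hl']; exact Or.inl rfl
      have hmain : ∀ k l, typ (y k) = x₀ → R k l → (y (k + 1) = t ∧ l = [t]) ∨
          (y (k + 1) = w ∧ l = [w, t]) ∨ ∃ e, l = rep [v] (e + 1) ++ [w, t] := by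
        intro k l hk hl
        rcases hcov (y (k + 1)) with h'' | h'' | h''
        · exact Or.inl ⟨h'', ret_singleton hu h'' hl⟩
        · obtain ⟨l', rfl, hl'⟩ := ret_cons hv h'' hl
          obtain ⟨e, rfl⟩ := hv' _ _ h'' hl'
          exact Or.inr (Or.inr ⟨e, by rw [rep_succ]; rfl⟩)
        · obtain ⟨l', rfl, hl'⟩ := ret_cons hw h'' hl
          exact Or.inr (Or.inl ⟨h'', by rw [hret _ _ h'' hl']⟩)
      have hT : Tr [t] [v] [w, t] := (Tr.base huv huw hvw).app31
      rcases hcov t' with rfl | rfl | rfl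
      · refine h.tame_of_single_loop (q := [v]) (f := [w, t']) (e₁ := [w, t']) (p := []) rfl rfl
          hvw.symm rfl hv ?_ fun k l hk hl => ?_
        · exact hT.swap.swap'.dup.swap
        · rcases hmain k l hk hl with ⟨h', _⟩ | ⟨_, h'⟩ | h'
          · exact absurd h' (ht' k hk)
          · exact Or.inl h'
          · exact Or.inr h'
      · refine ⟨_, _, _, hT, fun k l hk hl => ?_⟩
        rcases hcov (y (k + 1)) with h'' | h'' | h''
        · exact Or.inl (ret_singleton hu h'' hl)
        · exact absurd h'' (ht' k hk)
        · obtain ⟨l', rfl, hl'⟩ := ret_cons hw h'' hl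
          rw [hret _ _ h'' hl']; simp
      · refine h.tame_of_single_loop (q := [v]) (f := [t', t]) (e₁ := [t]) (p := []) rfl rfl
          hvw.symm rfl hv hT fun k l hk hl => ?_
        rcases hmain k l hk hl with ⟨_, h'⟩ | ⟨h', _⟩ | h'
        · exact Or.inl h'
        · exact absurd h' (ht' k hk)
        · exact Or.inr h'
    · have hret : ∀ k l, y k = w → R k l → l = [g] := fun k l hk hl =>
        ret_singleton hu (hFw k hk) hl
      have hv' : ∀ k l, y k = t → R k l → l = [g] ∨ l = [w, g] := by
        intro k l hk hl
        rcases hcov (y (k + 1)) with h'' | h'' | h''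
        · exact Or.inl (ret_singleton hu h'' hl)
        · exact absurd h'' (ht k hk)
        · obtain ⟨l', rfl, hl'⟩ := ret_cons hw h'' hl
          rw [hret _ _ h'' hl']; simp
      have hmain : ∀ k l, typ (y k) = x₀ → R k l → (y (k + 1) = g ∧ l = [g]) ∨
          (y (k + 1) = w ∧ l = [w, g]) ∨ (y (k + 1) = t ∧ (l = [t, g] ∨ l = [t, w, g])) := by
        intro k l hk hl
        rcases hcov (y (k + 1)) with h'' | h'' | h''
        · exact Or.inl ⟨h'', ret_singleton hu h'' hl⟩
        · obtain ⟨l', rfl, hl'⟩ := ret_cons hv h'' hl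
          rcases hv' _ _ h'' hl' with rfl | rfl <;> simp [h'']
        · obtain ⟨l', rfl, hl'⟩ := ret_cons hw h'' hl
          exact Or.inr (Or.inl ⟨h'', by rw [hret _ _ h'' hl']⟩)
      by_cases htw : t' = w
      · refine ⟨[g], [t, g], [t, w, g], ?_, fun k l hk hl => ?_⟩
        · exact (Tr.base huv huw hvw).app31.swap'.pre23.swap'.app21
        · rcases hmain k l hk hl with ⟨_, h'⟩ | ⟨h', _⟩ | ⟨_, h'⟩
          · exact Or.inl h'
          · exact absurd h' (htw ▸ ht' k hk)
          · exact Or.inr h'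
      by_cases htu : t' = g
      · refine ⟨[w, g], [t, g], [t, w, g], ?_, fun k l hk hl => ?_⟩
        · exact (Tr.base huv huw hvw).app31.prepend.app23.swap'.swap
        · rcases hmain k l hk hl with ⟨h', _⟩ | ⟨_, h'⟩ | ⟨_, h'⟩
          · exact absurd h' (htu ▸ ht' k hk)
          · exact Or.inl h'
          · exact Or.inr h'
      · refine ⟨_, _, _, (Tr.base huv huw hvw).app31, fun k l hk hl => ?_⟩
        rcases hmain k l hk hl with ⟨_, h'⟩ | ⟨_, h'⟩ | ⟨h', _⟩
        · exact Or.inl h'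
        · exact Or.inr (Or.inr h')
        · rcases hcov t' with h'' | h'' | h''
          · exact absurd h'' htu
          · exact absurd h' (h'' ▸ ht' k hk)
          · exact absurd h'' htw
    · refine h.tame_of_double_loop huv huw hvw hu hv hw (fun k hk => ?_)
        (fun k hk => Or.inl (hFw k hk)) ?_
      · rcases hcov (y (k + 1)) with h' | h' | h'
        · exact Or.inl h'
        · exact Or.inr h'
        · exact absurd h' (ht k hk)
      · rcases hcov t' with rfl | rfl | rfl
        · right; intro k hk
          rcases hcov (y (k + 1)) with h' | h' | h'
          · exact absurd h' (ht' k hk)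
          · exact Or.inr h'
          · exact Or.inl h'
        · left; intro k hk
          rcases hcov (y (k + 1)) with h' | h' | h'
          · exact Or.inr h'
          · exact absurd h' (ht' k hk)
          · exact Or.inl h'
        · exact absurd rfl (hxw rfl)
  · rcases hcov t with rfl | rfl | rfl
    · refine (h.false_of_trapped (fun s => s ≠ t) (fun k hk => ?_) (fun s hs => ?_) g
        huv.symm).elim
      · rcases hcov (y k) with h' | h' | h'
        · exact absurd h' hk
        · exact ht k h'
        · rw [hFw k h']; exact huv.symm
      · rcases hcov s with rfl | rfl | rfl
        · exact absurd rfl hs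
        · exact hv
        · exact hw
    · refine h.tame_of_alternating_loop huv huw hvw hu hv hw (fun k hk => ?_) hFw ⟨t', ht'⟩ hcov
      rcases hcov (y (k + 1)) with h' | h' | h'
      · exact Or.inl h'
      · exact absurd h' (ht k hk)
      · exact Or.inr h'
    · refine h.tame_of_double_loop huv huw hvw hu hv hw (fun k hk => ?_)
        (fun k hk => Or.inr (hFw k hk)) ?_
      · rcases hcov (y (k + 1)) with h' | h' | h'
        · exact Or.inl h'
        · exact Or.inr h'
        · exact absurd h' (ht k hk)
      · rcases hcov t' with rfl | rfl | rfl
        · right; intro k hk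
          rcases hcov (y (k + 1)) with h' | h' | h'
          · exact absurd h' (ht' k hk)
          · exact Or.inr h'
          · exact Or.inl h'
        · left; intro k hk
          rcases hcov (y (k + 1)) with h' | h' | h'
          · exact Or.inr h'
          · exact absurd h' (ht' k hk)
          · exact Or.inl h'
        · exact absurd rfl (hxw rfl)
  · exact absurd rfl hgw

/-- The return words of a labelling are the images of letters under a composition of the five
morphisms. -/
theorem tame (h : Labelling y typ x₀) : Tame y typ x₀ := by
  have hFx : ∃ t, ∀ k, typ (y k) = x₀ → y (k + 1) ≠ t ∨ ¬ ∃ k k', typ (y k) ≠ x₀ ∧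
      typ (y k') = typ (y k) ∧ y (k + 1) ≠ y (k' + 1) := by
    by_cases hf : ∃ k k', typ (y k) ≠ x₀ ∧ typ (y k') = typ (y k) ∧ y (k + 1) ≠ y (k' + 1)
    · obtain ⟨k, k', h₁, h₂, h₃⟩ := hf
      obtain ⟨k₁, k₂, h₄, h₅, h₆⟩ := h.fork_main
      obtain ⟨t, ht⟩ := exists_missing (S := fun k => typ (y k) = x₀) h₄ h₅ h₆
        (h.two_of_main k k' h₁ h₂ h₃)
      exact ⟨t, fun k hk => Or.inl (ht k hk)⟩
    · exact ⟨.a, fun _ _ => Or.inr hf⟩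
  obtain ⟨u, hu⟩ : ∃ u, typ u = x₀ := by
    obtain ⟨m, hm⟩ := h.main_right 0
    exact ⟨_, hm⟩
  by_cases hf : ∃ k k', typ (y k) ≠ x₀ ∧ typ (y k') = typ (y k) ∧ y (k + 1) ≠ y (k' + 1)
  · obtain ⟨t, ht⟩ := hFx
    have hFx : ∃ t, ∀ k, typ (y k) = x₀ → y (k + 1) ≠ t :=
      ⟨t, fun k hk => (ht k hk).resolve_right (not_not.2 hf)⟩
    clear ht
    obtain ⟨k₀, k₀', hv, hvv, hne⟩ := hf
    obtain ⟨t', ht'⟩ := exists_missing (S := fun k => typ (y k) = typ (y k₀)) rfl hvv hne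
      fun k₁ k₂ k₃ h₁ h₂ h₃ => h.two_of_off k₁ k₂ k₃ (by rwa [h₁]) (h₂.trans h₁.symm)
        (h₃.trans h₁.symm)
    generalize hvd : y k₀ = v at *
    have huv : u ≠ v := by rintro rfl; exact hv hu
    obtain ⟨w, hwu, hwv, hcov⟩ := exists_third huv
    by_cases hw : typ w = x₀
    · rcases hcov t' with e | e | e
      · have hcov' : ∀ s, s = w ∨ s = v ∨ s = u := fun s => by
          rcases hcov s with h' | h' | h' <;> simp [h']
        exact h.tame_of_main_main hwv hwu huv.symm hw hv hu hcov'
          (fun k hk => e ▸ ht' k (by rw [hk])) hFx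
      · obtain ⟨s, hs⟩ := hFx
        have hret : ∀ k l, y k = v → R k l → l = [u] ∨ l = [w] := by
          intro k l hk hl
          rcases hcov (y (k + 1)) with h' | h' | h'
          · exact Or.inl (ret_singleton hu h' hl)
          · exact absurd h' (e ▸ ht' k (by rw [hk]))
          · exact Or.inr (ret_singleton hw h' hl)
        have hmain : ∀ k l, R k l → (y (k + 1) = u ∧ l = [u]) ∨
            (y (k + 1) = w ∧ l = [w]) ∨ (y (k + 1) = v ∧ (l = [v, u] ∨ l = [v, w])) := by
          intro k l hl
          rcases hcov (y (k + 1)) with h' | h' | h'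
          · exact Or.inl ⟨h', ret_singleton hu h' hl⟩
          · obtain ⟨l', rfl, hl'⟩ := ret_cons hv h' hl
            rcases hret _ _ h' hl' with rfl | rfl <;> simp [h']
          · exact Or.inr (Or.inl ⟨h', ret_singleton hw h' hl⟩)
        have hB : Tr [u] [v] [w] := Tr.base huv hwu.symm hwv.symm
        rcases hcov s with e' | e' | e'
        · refine ⟨[w], [v, u], [v, w], (Tr.base hwv hwu huv.symm).swap'.pre23.app31, ?_⟩
          intro k l hk hl
          rcases hmain k l hl with ⟨h', _⟩ | ⟨_, h'⟩ | ⟨_, h'⟩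
          · exact absurd h' (e' ▸ hs k hk)
          · exact Or.inl h'
          · exact Or.inr h'
        · refine ⟨[u], [w], [v], hB.swap', ?_⟩
          intro k l hk hl
          rcases hmain k l hl with ⟨_, h'⟩ | ⟨_, h'⟩ | ⟨h', _⟩
          · exact Or.inl h'
          · exact Or.inr (Or.inl h')
          · exact absurd h' (e' ▸ hs k hk)
        · refine ⟨[u], [v, u], [v, w], hB.swap'.pre23.app31.swap', ?_⟩
          intro k l hk hl
          rcases hmain k l hl with ⟨_, h'⟩ | ⟨h', _⟩ | ⟨_, h'⟩
          · exact Or.inl h'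
          · exact absurd h' (e' ▸ hs k hk)
          · exact Or.inr h'
      · exact h.tame_of_main_main huv hwu.symm hwv.symm hu hv hw hcov
          (fun k hk => e ▸ ht' k (by rw [hk])) hFx
    by_cases hwv' : typ w = typ v
    · have key : ∀ v w, u ≠ v → w ≠ u → w ≠ v → typ v ≠ x₀ → typ w ≠ x₀ →
          (∀ t, t = u ∨ t = v ∨ t = w) →
          (∀ k, y k = v → y (k + 1) ≠ w) → (∀ k, y k = w → y (k + 1) ≠ w) →
          Tame y typ x₀ := by
        intro v w huv hwu hwv hv hw hcov h₁ h₂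
        obtain ⟨s, hs⟩ := hFx
        refine h.tame_of_double_loop huv hwu.symm hwv.symm hu hv hw (fun k hk => ?_)
          (fun k hk => ?_) ?_
        · rcases hcov (y (k + 1)) with h' | h' | h'
          · exact Or.inl h'
          · exact Or.inr h'
          · exact absurd h' (h₁ k hk)
        · rcases hcov (y (k + 1)) with h' | h' | h'
          · exact Or.inl h'
          · exact Or.inr h'
          · exact absurd h' (h₂ k hk)
        · rcases hcov s with e | e | e
          · right; intro k hk
            rcases hcov (y (k + 1)) with h' | h' | h'
            · exact absurd h' (e ▸ hs k hk)
            · exact Or.inr h'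
            · exact Or.inl h'
          · left; intro k hk
            rcases hcov (y (k + 1)) with h' | h' | h'
            · exact Or.inr h'
            · exact absurd h' (e ▸ hs k hk)
            · exact Or.inl h'
          · exfalso
            obtain ⟨k, hk⟩ := h.surj w
            have hk' : y (k - 1 + 1) = w := by simpa using hk
            rcases hcov (y (k - 1)) with h' | h' | h'
            · exact e ▸ hs _ (by rw [h', hu]) <| hk'
            · exact h₁ _ h' hk'
            · exact h₂ _ h' hk'
      rcases hcov t' with e | e | e
      · exfalso
        refine h.false_of_trapped (fun s => s ≠ u) (fun k hk => ?_) (fun s hs => ?_) v huv.symm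
        · rw [← e]
          refine ht' k ?_
          rcases hcov (y k) with h' | h' | h'
          · exact absurd h' hk
          · rw [h']
          · rw [h', hwv']
        · rcases hcov s with h' | h' | h'
          · exact absurd h' hs
          · rwa [h']
          · rwa [h']
      · exact key w v hwu.symm huv.symm hwv.symm hw hv
          (fun s => by rcases hcov s with h' | h' | h' <;> simp [h'])
          (fun k hk => e ▸ ht' k (by rw [hk, hwv'])) (fun k hk => e ▸ ht' k (by rw [hk]))
      · exact key v w huv hwu hwv hv hw hcov
          (fun k hk => e ▸ ht' k (by rw [hk])) (fun k hk => e ▸ ht' k (by rw [hk, hwv']))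
    · obtain ⟨k₁, hk₁⟩ := h.surj w
      refine h.tame_of_single_fork (g := y (k₁ + 1)) huv hwu.symm hwv.symm hu hv hw hcov
        ⟨t', fun k hk => ht' k (by rw [hk])⟩ (fun k hk => ?_) hFx
      by_contra hne'
      have := h.typ_unique [] k k₁ k₀ k₀' rfl rfl rfl rfl (by rw [hk, hk₁])
        (by rw [hvd, hvv]) (by simpa using hne') (by simpa using hne) (by simpa [hk] using hw)
        (by simpa [hvd] using hv)
      rw [hk, hvd] at this
      exact hwv' this
  · push Not at hf
    have hdet : ∀ t, typ t ≠ x₀ → ∃ g, ∀ k, y k = t → y (k + 1) = g := by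
      intro t ht
      obtain ⟨k, hk⟩ := h.surj t
      exact ⟨y (k + 1), fun k' hk' => (hf k k' (by rwa [hk]) (by rw [hk, hk'])).symm⟩
    obtain ⟨v, hv⟩ := h.off_main
    have huv : u ≠ v := by rintro rfl; exact hv hu
    obtain ⟨w, hwu, hwv, hcov⟩ := exists_third huv
    obtain ⟨g, hg⟩ := hdet v hv
    have hgv : g ≠ v := by
      intro e
      exact h.false_of_trapped (fun t => t = v) (fun k hk => e ▸ hg k hk)
        (fun t ht => ht ▸ hv) v rfl
    by_cases hw : typ w = x₀
    · have hgx : typ g = x₀ := by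
        rcases hcov g with e | e | e
        · rw [e, hu]
        · exact absurd e hgv
        · rw [e, hw]
      refine ⟨[u], [v, g], [w], ?_, fun k l hk hl => ?_⟩
      · have hB : Tr [u] [v] [w] := Tr.base huv hwu.symm hwv.symm
        rcases hcov g with e | e | e
        · rw [e]; exact hB.app21
        · exact absurd e hgv
        · rw [e]; exact hB.app23
      · rcases hcov (y (k + 1)) with h' | h' | h'
        · exact Or.inl (ret_singleton hu h' hl)
        · obtain ⟨l', rfl, hl'⟩ := ret_cons hv h' hl
          rw [ret_singleton hgx (hg _ h') hl']; simp
        · exact Or.inr (Or.inr (ret_singleton hw h' hl))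
    · obtain ⟨g', hg'⟩ := hdet w hw
      have key : ∀ v w g', u ≠ v → w ≠ u → w ≠ v → typ v ≠ x₀ → typ w ≠ x₀ →
          (∀ t, t = u ∨ t = v ∨ t = w) → (∀ k, y k = v → y (k + 1) = u) →
          (∀ k, y k = w → y (k + 1) = g') → g' = u ∨ g' = v → Tame y typ x₀ := by
        intro v w g' huv hwu hwv hv hw hcov hg hg' hgg
        have h₁ : ∀ k l, y k = v → R k l → l = [u] := fun k l hk hl =>
          ret_singleton hu (hg k hk) hl
        have hB : Tr [u] [v] [w] := Tr.base huv hwu.symm hwv.symm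
        rcases hgg with e | e
        · refine ⟨[u], [v, u], [w, u], hB.app21.app31, fun k l hk hl => ?_⟩
          rcases hcov (y (k + 1)) with h' | h' | h'
          · exact Or.inl (ret_singleton hu h' hl)
          · obtain ⟨l', rfl, hl'⟩ := ret_cons hv h' hl
            rw [h₁ _ _ h' hl']; simp
          · obtain ⟨l', rfl, hl'⟩ := ret_cons hw h' hl
            rw [ret_singleton hu (by rw [hg' _ h', e]) hl']; simp
        · refine ⟨[u], [v, u], [w, v, u], hB.app21.app32, fun k l hk hl => ?_⟩
          rcases hcov (y (k + 1)) with h' | h' | h'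
          · exact Or.inl (ret_singleton hu h' hl)
          · obtain ⟨l', rfl, hl'⟩ := ret_cons hv h' hl
            rw [h₁ _ _ h' hl']; simp
          · obtain ⟨l', rfl, hl'⟩ := ret_cons hw h' hl
            have h'' : y (k + 1 + 1) = v := by rw [hg' _ h', e]
            obtain ⟨l'', rfl, hl''⟩ := ret_cons hv h'' hl'
            rw [h₁ _ _ h'' hl'']; simp
      have hcov' : ∀ t, t = u ∨ t = w ∨ t = v := fun s => by
        rcases hcov s with h' | h' | h' <;> simp [h']
      have hgw : g' ≠ w := by
        intro e
        exact h.false_of_trapped (fun t => t = w) (fun k hk => e ▸ hg' k hk)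
          (fun t ht => ht ▸ hw) w rfl
      rcases hcov g with e | e | e
      · refine key v w g' huv hwu hwv hv hw hcov (fun k hk => e ▸ hg k hk) hg' ?_
        rcases hcov g' with e' | e' | e'
        · exact Or.inl e'
        · exact Or.inr e'
        · exact absurd e' hgw
      · exact absurd e hgv
      · have hg'u : g' = u := by
          rcases hcov g' with e' | e' | e'
          · exact e'
          · exfalso
            refine h.false_of_trapped (fun s => s = v ∨ s = w) ?_ ?_ v (Or.inl rfl)
            · rintro k (hk | hk)
              · exact Or.inr (e ▸ hg k hk)
              · exact Or.inl (e' ▸ hg' k hk)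
            · rintro s (rfl | rfl)
              · exact hv
              · exact hw
          · exact absurd e' hgw
        exact key w v g hwu.symm huv.symm hwv.symm hw hv hcov' (fun k hk => hg'u ▸ hg' k hk) hg
          (Or.inr e)

end Labelling

end SubshiftSadic

namespace SubshiftSadic

section Factors

variable {A : Type*}

/-- The sequence `x` looks the same around `p` and around `q`, on relative coordinates
in `[lo, hi)`. -/
def Agree (x : ℤ → A) (p q lo hi : ℤ) : Prop :=
  ∀ d, lo ≤ d → d < hi → x (p + d) = x (q + d)

/-- The word `β` on `[lo, hi)` occurs in `x` around `i`. -/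
def Occ (x β : ℤ → A) (lo hi i : ℤ) : Prop :=
  ∀ d, lo ≤ d → d < hi → x (i + d) = β d

variable {x β : ℤ → A} {p q r lo hi lo' hi' : ℤ}

theorem Agree.symm (h : Agree x p q lo hi) : Agree x q p lo hi := fun d h₁ h₂ => (h d h₁ h₂).symm

theorem Agree.trans (h : Agree x p q lo hi) (h' : Agree x q r lo hi) : Agree x p r lo hi :=
  fun d h₁ h₂ => (h d h₁ h₂).trans (h' d h₁ h₂)

theorem Agree.mono (h : Agree x p q lo hi) (h₁ : lo ≤ lo') (h₂ : hi' ≤ hi) :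
    Agree x p q lo' hi' :=
  fun d h₃ h₄ => h d (by omega) (by omega)

theorem Agree.shift (h : Agree x p q lo hi) (t : ℤ) :
    Agree x (p + t) (q + t) (lo - t) (hi - t) := fun d h₁ h₂ => by
  have := h (t + d) (by omega) (by omega)
  rwa [← add_assoc, ← add_assoc] at this

theorem Agree.at_shift (h : Agree x p q lo hi) {p' q' lo' hi' : ℤ} (e : p' - p = q' - q)
    (h₁ : lo ≤ lo' + (p' - p)) (h₂ : hi' + (p' - p) ≤ hi) : Agree x p' q' lo' hi' := by
  have := h.shift (p' - p)
  rw [show p + (p' - p) = p' by ring, show q + (p' - p) = q' by rw [e]; ring] at this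
  exact this.mono (by omega) (by omega)

theorem Agree.glue (h : Agree x p q lo hi) {hi' : ℤ} (h' : Agree x p q hi hi') :
    Agree x p q lo hi' := fun d h₁ h₂ => by
  by_cases hd : d < hi
  · exact h d h₁ hd
  · exact h' d (by omega) h₂

theorem Agree.eq_at (h : Agree x p q lo hi) {p' q' : ℤ} (e : p' - p = q' - q)
    (h₁ : lo ≤ p' - p) (h₂ : p' - p < hi) : x p' = x q' := by
  have := h (p' - p) h₁ h₂
  rwa [show p + (p' - p) = p' by ring, show q + (p' - p) = q' by rw [e]; ring] at this

theorem agree_mirror : Agree (mirror x) p q lo hi ↔ Agree x (-p) (-q) (-hi) (-lo) := by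
  constructor
  · intro h d h₁ h₂
    have := h (-1 - d) (by omega) (by omega)
    simp only [mirror] at this
    convert this using 2 <;> ring
  · intro h d h₁ h₂
    have := h (-1 - d) (by omega) (by omega)
    simp only [mirror]
    convert this using 2 <;> ring

theorem agree_one_iff (m : ℤ) (hm : 0 ≤ m) :
    Agree x p q (-m) 1 ↔ Agree x p q (-m) 0 ∧ x p = x q := by
  constructor
  · intro h
    exact ⟨h.mono le_rfl (by norm_num), h.eq_at (by ring) (by omega) (by omega)⟩
  · rintro ⟨h, h'⟩ d h₁ h₂
    by_cases hd : d < 0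
    · exact h d h₁ hd
    · have : d = 0 := by omega
      subst this; simpa using h'

theorem Occ.agree (h : Occ x β lo hi p) (h' : Occ x β lo hi q) : Agree x p q lo hi :=
  fun d h₁ h₂ => (h d h₁ h₂).trans (h' d h₁ h₂).symm

theorem Occ.of_agree (h : Occ x β lo hi p) (h' : Agree x p q lo hi) : Occ x β lo hi q :=
  fun d h₁ h₂ => (h' d h₁ h₂).symm.trans (h d h₁ h₂)

theorem Occ.mono (h : Occ x β lo hi p) (h₁ : lo ≤ lo') (h₂ : hi' ≤ hi) : Occ x β lo' hi' p :=
  fun d h₃ h₄ => h d (by omega) (by omega)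

theorem occ_pred_iff (hlo : lo ≤ hi) :
    Occ x β (lo - 1) hi p ↔ Occ x β lo hi p ∧ x (p + (lo - 1)) = β (lo - 1) := by
  constructor
  · exact fun h => ⟨h.mono (by omega) le_rfl, h _ le_rfl (by omega)⟩
  · rintro ⟨h, h'⟩ d h₁ h₂
    by_cases hd : d = lo - 1
    · rw [hd, h']
    · exact h d (by omega) h₂

theorem occ_mirror : Occ (mirror x) (mirror β) (-hi) (-lo) (-p) ↔ Occ x β lo hi p := by
  constructor
  · intro h d h₁ h₂
    have := h (-1 - d) (by omega) (by omega)
    simp only [mirror] at this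
    convert this using 2 <;> ring
  · intro h d h₁ h₂
    have := h (-1 - d) (by omega) (by omega)
    simp only [mirror]
    convert this using 2; ring

theorem occ_translate (t : ℤ) :
    Occ x (fun d => β (d + t)) (lo - t) (hi - t) (p + t) ↔ Occ x β lo hi p := by
  constructor
  · intro h d h₁ h₂
    have := h (d - t) (by omega) (by omega)
    simpa using this
  · intro h d h₁ h₂
    have := h (d + t) (by omega) (by omega)
    simp only
    convert this using 2; ring

/-- There are at most two more words of length `m + 1` than words of length `m` in `x`, for
`m ≥ N`. -/
def RSBound (x : ℤ → A) (N : ℤ) : Prop :=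
  ∀ m ≥ N, ∀ p q : Fin 3 → ℤ, (∀ j, Agree x (p j) (q j) (-m) 0) →
    (∀ j k, j ≠ k → ¬ Agree x (p j) (p k) (-m) 1) →
    (∀ j k, ¬ Agree x (q j) (p k) (-m) 1) → False

/-- Uniform recurrence. -/
def Recurs (x : ℤ → A) : Prop :=
  ∀ p lo hi, ∃ R, ∀ q, ∃ t, q ≤ t ∧ t < q + R ∧ Agree x p t lo hi

theorem Recurs.mirror (h : Recurs x) : Recurs (mirror x) := by
  intro p lo hi
  obtain ⟨R, hR⟩ := h (-p) (-hi) (-lo)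
  refine ⟨R, fun q => ?_⟩
  obtain ⟨t, h₁, h₂, h₃⟩ := hR (-q - R + 1)
  exact ⟨-t, by omega, by omega, agree_mirror.2 (by simpa using h₃)⟩

variable {N m : ℤ}

theorem RSBound.no_three_classes (h : RSBound x N) (hm : N ≤ m) (hm0 : 0 ≤ m)
    {e₁ e₁' e₂ e₂' e₃ e₃' : ℤ}
    (h₁ : Agree x e₁ e₁' (-m) 0) (h₁' : x e₁ ≠ x e₁')
    (h₂ : Agree x e₂ e₂' (-m) 0) (h₂' : x e₂ ≠ x e₂')
    (h₃ : Agree x e₃ e₃' (-m) 0) (h₃' : x e₃ ≠ x e₃')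
    (h₁₂ : ¬ Agree x e₁ e₂ (-m) 0) (h₁₃ : ¬ Agree x e₁ e₃ (-m) 0)
    (h₂₃ : ¬ Agree x e₂ e₃ (-m) 0) : False := by
  refine h m hm ![e₁, e₂, e₃] ![e₁', e₂', e₃'] ?_ ?_ ?_
  · intro j; fin_cases j <;> assumption
  · intro j k hjk
    rw [agree_one_iff m hm0]
    rintro ⟨h, -⟩
    fin_cases j <;> fin_cases k <;> simp at hjk h
    · exact h₁₂ h
    · exact h₁₃ h
    · exact h₁₂ h.symm
    · exact h₂₃ h
    · exact h₁₃ h.symm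
    · exact h₂₃ h.symm
  · intro j k
    rw [agree_one_iff m hm0]
    rintro ⟨h, h'⟩
    fin_cases j <;> fin_cases k <;> simp at h h'
    · exact h₁' h'.symm
    · exact h₁₂ (h₁.trans h)
    · exact h₁₃ (h₁.trans h)
    · exact h₁₂ (h₂.trans h).symm
    · exact h₂' h'.symm
    · exact h₂₃ (h₂.trans h)
    · exact h₁₃ (h₃.trans h).symm
    · exact h₂₃ (h₃.trans h).symm
    · exact h₃' h'.symm

theorem RSBound.no_three_letters (h : RSBound x N) (hm : N ≤ m) (hm0 : 0 ≤ m)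
    {e₁ e₂ e₃ f f' : ℤ}
    (h₁₃ : Agree x e₁ e₃ (-m) 0) (h₂₃ : Agree x e₂ e₃ (-m) 0)
    (g₁₂ : x e₁ ≠ x e₂) (g₁₃ : x e₁ ≠ x e₃) (g₂₃ : x e₂ ≠ x e₃)
    (hf : Agree x f f' (-m) 0) (hf' : x f ≠ x f')
    (h₁ : ¬ Agree x e₁ f (-m) 0) : False := by
  have h₃ : ¬ Agree x e₃ f (-m) 0 := fun h => h₁ (h₁₃.trans h)
  have h₂ : ¬ Agree x e₂ f (-m) 0 := fun h => h₃ (h₂₃.symm.trans h)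
  refine h m hm ![e₁, e₂, f] ![e₃, e₃, f'] ?_ ?_ ?_
  · intro j; fin_cases j <;> assumption
  · intro j k hjk
    rw [agree_one_iff m hm0]
    rintro ⟨h, h'⟩
    fin_cases j <;> fin_cases k <;> simp at hjk h h'
    · exact g₁₂ h'
    · exact h₁ h
    · exact g₁₂ h'.symm
    · exact h₂ h
    · exact h₁ h.symm
    · exact h₂ h.symm
  · intro j k
    rw [agree_one_iff m hm0]
    rintro ⟨h, h'⟩
    fin_cases j <;> fin_cases k <;> simp at h h'
    · exact g₁₃ h'.symm
    · exact g₂₃ h'.symm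
    · exact h₃ h
    · exact g₁₃ h'.symm
    · exact g₂₃ h'.symm
    · exact h₃ h
    · exact h₁ (hf.trans h).symm
    · exact h₂ (hf.trans h).symm
    · exact hf' h'.symm

theorem RSBound.no_four_letters (h : RSBound x N) (hm : N ≤ m) (hm0 : 0 ≤ m)
    {e₁ e₂ e₃ e₄ : ℤ}
    (h₁ : Agree x e₁ e₄ (-m) 0) (h₂ : Agree x e₂ e₄ (-m) 0) (h₃ : Agree x e₃ e₄ (-m) 0)
    (g₁₂ : x e₁ ≠ x e₂) (g₁₃ : x e₁ ≠ x e₃) (g₂₃ : x e₂ ≠ x e₃)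
    (g₁ : x e₁ ≠ x e₄) (g₂ : x e₂ ≠ x e₄) (g₃ : x e₃ ≠ x e₄) : False := by
  refine h m hm ![e₁, e₂, e₃] ![e₄, e₄, e₄] ?_ ?_ ?_
  · intro j; fin_cases j <;> assumption
  · intro j k hjk
    rw [agree_one_iff m hm0]
    rintro ⟨h, h'⟩
    fin_cases j <;> fin_cases k <;> simp at hjk h h'
    · exact g₁₂ h'
    · exact g₁₃ h'
    · exact g₁₂ h'.symm
    · exact g₂₃ h'
    · exact g₁₃ h'.symm
    · exact g₂₃ h'.symm
  · intro j k
    rw [agree_one_iff m hm0]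
    rintro ⟨h, h'⟩
    fin_cases j <;> fin_cases k <;> simp at h h' <;> first
      | exact g₁ h'.symm
      | exact g₂ h'.symm
      | exact g₃ h'.symm

/-- The word `β` on `[lo, hi)` is right special together with arbitrarily long extensions to the
left. -/
def InfRS (x β : ℤ → A) (lo hi : ℤ) : Prop :=
  ∀ m, ∃ i i', Occ x β lo hi i ∧ Agree x i i' (-m) hi ∧ x (i + hi) ≠ x (i' + hi)

/-- The word `β` on `[lo, hi)` is left special together with arbitrarily long extensions to the
right. -/
def InfLS (x β : ℤ → A) (lo hi : ℤ) : Prop :=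
  ∀ m, ∃ i i', Occ x β lo hi i ∧ Agree x i i' lo m ∧ x (i + (lo - 1)) ≠ x (i' + (lo - 1))

theorem infRS_mirror : InfRS (mirror x) (mirror β) (-hi) (-lo) ↔ InfLS x β lo hi := by
  have e : ∀ i : ℤ, mirror x (i + -lo) = x (-i + (lo - 1)) := fun i => by
    simp only [mirror]; congr 1; ring
  constructor
  · intro h m
    obtain ⟨i, i', h₁, h₂, h₃⟩ := h m
    refine ⟨-i, -i', ?_, ?_, ?_⟩
    · rw [← occ_mirror]; simpa using h₁
    · simpa using agree_mirror.1 h₂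
    · rwa [e, e] at h₃
  · intro h m
    obtain ⟨i, i', h₁, h₂, h₃⟩ := h m
    refine ⟨-i, -i', occ_mirror.2 h₁, agree_mirror.2 (by simpa using h₂), ?_⟩
    rw [e, e]; simpa using h₃

theorem infLS_mirror : InfLS (mirror x) (mirror β) (-hi) (-lo) ↔ InfRS x β lo hi := by
  rw [← infRS_mirror]; simp

theorem infRS_translate (t : ℤ) :
    InfRS x (fun d => β (d + t)) (lo - t) (hi - t) ↔ InfRS x β lo hi := by
  constructor
  · intro h m
    obtain ⟨i, i', h₁, h₂, h₃⟩ := h (m + t)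
    refine ⟨i - t, i' - t, (occ_translate t).1 (by simpa using h₁),
      h₂.at_shift (by ring) (by omega) (by omega), ?_⟩
    convert h₃ using 2 <;> ring_nf
  · intro h m
    obtain ⟨i, i', h₁, h₂, h₃⟩ := h (m - t)
    refine ⟨i + t, i' + t, (occ_translate t).2 h₁,
      h₂.at_shift (by ring) (by omega) (by omega), ?_⟩
    convert h₃ using 2 <;> ring_nf

/-- `c` enumerates the occurrences of the word `β` on `[lo, hi)`, and `y` labels the return words
between them. -/
structure RState {L : Type*} (x β : ℤ → A) (lo hi : ℤ) (c : ℤ → ℤ) (y : ℤ → L) : Prop where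
  occ : ∀ i, Occ x β lo hi i ↔ ∃ k, c k = i
  mono : StrictMono c
  label : ∀ k k', y k = y k' ↔ c (k + 1) - c k = c (k' + 1) - c k' ∧
    Agree x (c k) (c k') lo (c (k + 1) - c k + hi)

/-- The labels on both sides of a cutting point are determined by a bounded neighbourhood. -/
def Loc (x : ℤ → A) (c : ℤ → ℤ) (y : ℤ → ABC) : Prop :=
  ∃ r, ∀ k i', Agree x (c k) i' (-r) r → ∃ k', c k' = i' ∧ y k' = y k ∧
    y (k' - 1) = y (k - 1)

/-- `y'`, with cutting points `c'`, is a desubstitution of `y`, with cutting points `c`. -/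
def Desub (τ : ABC → List ABC) (c : ℤ → ℤ) (y : ℤ → ABC) (c' : ℤ → ℤ) (y' : ℤ → ABC) : Prop :=
  ∃ g, (∀ k, c' k = c (g k)) ∧ Expands τ g y' y

/-- Iterated desubstitution. -/
def Path (c : ℤ → ℤ) (y : ℤ → ABC) (c' : ℤ → ℤ) (y' : ℤ → ABC) : Prop :=
  ∃ τ, Gen τ ∧ Desub τ c y c' y'

theorem Path.refl (c : ℤ → ℤ) (y : ℤ → ABC) : Path c y c y :=
  ⟨_, Gen.id, id, fun _ => rfl, fun k => ⟨by simp, by simp [seg_one]⟩⟩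

theorem Path.trans {c c' c'' : ℤ → ℤ} {y y' y'' : ℤ → ABC} (h : Path c y c' y')
    (h' : Path c' y' c'' y'') : Path c y c'' y'' := by
  obtain ⟨τ, hτ, g, hg, he⟩ := h
  obtain ⟨τ', hτ', g', hg', he'⟩ := h'
  exact ⟨_, hτ.comp hτ', _, fun k => by rw [hg', hg], he.comp he'⟩

theorem Path.translate {c c' : ℤ → ℤ} {y y' : ℤ → ABC} (h : Path c y c' y') (t : ℤ) :
    Path (fun k => c k + t) y (fun k => c' k + t) y' := by
  obtain ⟨τ, hτ, g, hg, he⟩ := h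
  exact ⟨τ, hτ, g, fun k => by simp [hg], he⟩

theorem Path.mirror {c c' : ℤ → ℤ} {y y' : ℤ → ABC} (h : Path c y c' y') :
    Path (mirrorCut c) (mirror y) (mirrorCut c') (mirror y') := by
  obtain ⟨τ, hτ, g, hg, he⟩ := h
  exact ⟨_, hτ.reverse, mirrorCut g, fun k => by simp [mirrorCut, hg], he.reflect⟩

theorem Loc.translate {c : ℤ → ℤ} {y : ℤ → ABC} (h : Loc x c y) (t : ℤ) :
    Loc x (fun k => c k + t) y := by
  obtain ⟨r, hr⟩ := h
  refine ⟨r + |t|, fun k i' h => ?_⟩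
  have h₁ := neg_abs_le t
  have h₂ := le_abs_self t
  obtain ⟨k', h₃, h₄⟩ := hr k (i' - t)
    (Agree.at_shift h (by simp) (by simp only; omega) (by simp only; omega))
  exact ⟨k', by simp only; omega, h₄⟩

theorem RState.translate {c : ℤ → ℤ} {y : ℤ → ABC} (h : RState x β lo hi c y) (t : ℤ) :
    RState x (fun d => β (d + t)) (lo - t) (hi - t) (fun k => c k + t) y where
  occ i := by
    rw [show i = i - t + t by ring, occ_translate, h.occ]
    exact exists_congr fun k => by omega
  mono _ _ hk := by simpa using h.mono hk
  label k k' := by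
    rw [h.label]
    refine and_congr (by ring_nf) ⟨fun h => ?_, fun h => ?_⟩
    · exact h.at_shift (by ring) (by omega) (by omega)
    · exact h.at_shift (by ring) (by omega) (by omega)

theorem RState.mirror {c : ℤ → ℤ} {y : ℤ → ABC} (h : RState x β lo hi c y) :
    RState (mirror x) (mirror β) (-hi) (-lo) (mirrorCut c) (mirror y) where
  occ i := by
    rw [show i = - -i by ring, occ_mirror, h.occ]
    constructor
    · rintro ⟨k, hk⟩; exact ⟨-k, by simp [mirrorCut, hk]⟩
    · rintro ⟨k, hk⟩; exact ⟨-k, by simp only [mirrorCut] at hk; omega⟩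
  mono k k' hk := by
    have := h.mono (show -k' < -k by omega)
    simp only [mirrorCut]; omega
  label k k' := by
    simp only [SubshiftSadic.mirror, mirrorCut]
    rw [h.label, show -1 - k + 1 = -k by ring, show -1 - k' + 1 = -k' by ring,
      show -(k + 1) = -1 - k by ring, show -(k' + 1) = -1 - k' by ring, agree_mirror]
    constructor
    · rintro ⟨h₁, h₂⟩
      exact ⟨by omega, h₂.at_shift (by omega) (by omega) (by omega)⟩
    · rintro ⟨h₁, h₂⟩
      exact ⟨by omega, h₂.at_shift (by omega) (by omega) (by omega)⟩

end Factors

end SubshiftSadic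

namespace SubshiftSadic

namespace RState

variable {A L : Type*} {x β : ℤ → A} {lo : ℤ} {c : ℤ → ℤ} {y : ℤ → L}

theorem lt_succ {hi : ℤ} (h : RState x β lo hi c y) (k : ℤ) : c k < c (k + 1) := h.mono (by omega)

theorem succ_le {hi : ℤ} (h : RState x β lo hi c y) {k j : ℤ} (hk : c k < c j) : c (k + 1) ≤ c j :=
  h.mono.monotone (by have := h.mono.lt_iff_lt.1 hk; omega)

theorem eq_succ {hi : ℤ} (h : RState x β lo hi c y) {k j : ℤ} (hk : c k < c j)
    (hj : c j ≤ c (k + 1)) : j = k + 1 :=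
  h.mono.injective (le_antisymm hj (h.succ_le hk))

theorem agree (h : RState x β lo 0 c y) (k k' : ℤ) : Agree x (c k) (c k') lo 0 :=
  ((h.occ _).2 ⟨k, rfl⟩).agree ((h.occ _).2 ⟨k', rfl⟩)

theorem cut (h : RState x β lo 0 c y) {p q lo' hi' : ℤ} (ha : Agree x p q lo' hi') {j t : ℤ}
    (hj : c j = p + t) (h₁ : lo' ≤ lo + t) (h₂ : t ≤ hi') : ∃ j', c j' = q + t :=
  (h.occ _).1 (((h.occ _).2 ⟨j, rfl⟩).of_agree
    (ha.at_shift (by rw [hj]; ring) (by omega) (by omega)))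

theorem label_of_agree (h : RState x β lo 0 c y) {k k' T : ℤ}
    (ha : Agree x (c k) (c k') lo T) (hT : c (k + 1) - c k ≤ T) : y k = y k' := by
  have h₁ : c (k' + 1) - c k' ≤ c (k + 1) - c k := by
    obtain ⟨j, hj⟩ := h.cut ha (j := k + 1) (t := c (k + 1) - c k) (by ring)
      (by have := h.lt_succ k; omega) hT
    have := h.succ_le (k := k') (j := j) (by have := h.lt_succ k; omega)
    omega
  have h₂ : c (k + 1) - c k ≤ c (k' + 1) - c k' := by
    obtain ⟨j, hj⟩ := h.cut ha.symm (j := k' + 1) (t := c (k' + 1) - c k') (by ring)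
      (by have := h.lt_succ k'; omega) (by omega)
    have := h.succ_le (k := k) (j := j) (by have := h.lt_succ k'; omega)
    omega
  exact (h.label k k').2 ⟨by omega, ha.mono le_rfl (by omega)⟩

theorem decode (h : RState x β lo 0 c y) {k k' T : ℤ}
    (ha : Agree x (c k) (c k') lo T) (i : ℕ) (hi : c (k + i) ≤ c k + T) :
    c (k' + i) - c k' = c (k + i) - c k ∧ ∀ j < i, y (k + j) = y (k' + j) := by
  induction i with
  | zero => simp
  | succ i ih =>
    push_cast at hi ⊢
    rw [← add_assoc] at hi ⊢
    rw [← add_assoc]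
    have h₁ := h.lt_succ (k + i)
    have h₂ : c k ≤ c (k + i) := h.mono.monotone (by omega)
    obtain ⟨h₃, h₄⟩ := ih (by omega)
    have h₅ : y (k + i) = y (k' + i) :=
      h.label_of_agree (T := T - (c (k + i) - c k))
        (ha.at_shift (by omega) (by omega) (by omega)) (by omega)
    refine ⟨by have := ((h.label _ _).1 h₅).1; omega, fun j hj => ?_⟩
    obtain hj | rfl := Nat.lt_succ_iff_lt_or_eq.1 hj
    · exact h₄ j hj
    · exact h₅

theorem extend (h : RState x β lo 0 c y) (hlo : lo ≤ 0) {k k' lo' : ℤ}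
    (ha : Agree x (c k) (c k') lo' 0) (i : ℕ) (hi : ∀ j < i, y (k + j) = y (k' + j)) :
    c (k' + i) - c k' = c (k + i) - c k ∧ Agree x (c k) (c k') lo' (c (k + i) - c k) := by
  induction i with
  | zero => simpa using ha
  | succ i ih =>
    push_cast
    rw [← add_assoc, ← add_assoc]
    obtain ⟨h₁, h₂⟩ := ih fun j hj => hi j (by omega)
    obtain ⟨h₃, h₄⟩ := (h.label _ _).1 (hi i (by omega))
    refine ⟨by omega, h₂.glue fun d hd hd' => ?_⟩
    exact h₄.eq_at (by omega) (by omega) (by omega)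

theorem fork (h : RState x β lo 0 c y) {k k' m : ℤ} (hm : -m ≤ lo)
    (ha : Agree x (c k) (c k') (-m) 0) (hy : y k ≠ y k') :
    ∃ d, 0 ≤ d ∧ c k + d < c (k + 1) ∧ c k' + d < c (k' + 1) ∧ Agree x (c k) (c k') (-m) d ∧
      x (c k + d) ≠ x (c k' + d) := by
  by_cases hf : ∃ d : ℕ, c k + d < c (k + 1) ∧ c k' + d < c (k' + 1) ∧
      x (c k + d) ≠ x (c k' + d)
  · classical
    obtain ⟨h₁, h₂, h₃⟩ := Nat.find_spec hf
    refine ⟨_, by omega, h₁, h₂, ha.glue fun d hd hd' => ?_, h₃⟩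
    by_contra hne
    obtain ⟨d, rfl⟩ := Int.eq_ofNat_of_zero_le hd
    exact Nat.find_min hf (m := d) (by omega) ⟨by omega, by omega, hne⟩
  · push Not at hf
    have key : ∀ d, 0 ≤ d → d < c (k + 1) - c k → d < c (k' + 1) - c k' →
        x (c k + d) = x (c k' + d) := fun d hd h₁ h₂ => by
      obtain ⟨d, rfl⟩ := Int.eq_ofNat_of_zero_le hd
      exact hf d (by omega) (by omega)
    rcases le_total (c (k + 1) - c k) (c (k' + 1) - c k') with hl | hl
    · refine absurd (h.label_of_agree (T := c (k + 1) - c k) ?_ le_rfl) hy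
      exact (ha.mono hm le_rfl).glue fun d h₁ h₂ => key d h₁ h₂ (by omega)
    · refine absurd (h.label_of_agree (T := c (k' + 1) - c k') ?_ le_rfl).symm hy
      exact (ha.mono hm le_rfl).symm.glue fun d h₁ h₂ => (key d h₁ (by omega) h₂).symm

/-- Two occurrences of `β` continue differently after `d` more letters, at a place which is not
preceded by the word `β` on `[lo - 1, 0)`. -/
def OffFork (x β : ℤ → A) (lo : ℤ) (c : ℤ → ℤ) (k k' m d : ℤ) : Prop :=
  0 ≤ d ∧ c k + d < c (k + 1) ∧ c k' + d < c (k' + 1) ∧ Agree x (c k) (c k') (-m) d ∧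
    x (c k + d) ≠ x (c k' + d) ∧ (x (c k + (lo - 1)) ≠ β (lo - 1) ∨ 0 < d)

theorem not_agree_main (h : RState x β lo 0 c y) (hlo : lo ≤ 0) {p k k' m d μ : ℤ}
    (hf : OffFork x β lo c k k' m d) (hμ : -μ ≤ lo - 1)
    (hp : Occ x β (lo - 1) 0 p) : ¬ Agree x (c k + d) p (-μ) 0 := fun ha => by
  obtain ⟨h₁, h₂, -, -, -, h₃⟩ := hf
  have ho := (occ_pred_iff hlo).1 (hp.of_agree (ha.symm.mono hμ le_rfl))
  obtain ⟨j, hj⟩ := (h.occ _).1 ho.1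
  rcases h₁.lt_or_eq with hd | rfl
  · have := h.succ_le (k := k) (j := j) (by omega)
    omega
  · rcases h₃ with h₃ | h₃
    · exact h₃ (by simpa using ho.2)
    · omega

theorem offFork_unique (h : RState x β lo 0 c y) (hlo : lo ≤ 0) {N : ℤ} (hN : RSBound x N)
    (hn : N ≤ -lo) (hI : InfRS x β (lo - 1) 0) {k k' m d j j' m' d' : ℤ}
    (hm : -m ≤ lo - 1) (hm' : -m' ≤ lo - 1)
    (hf : OffFork x β lo c k k' m d) (hf' : OffFork x β lo c j j' m' d') :
    d = d' ∧ Agree x (c k) (c j) (-min m m') d := by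
  obtain ⟨p, p', hp, hpp, hne⟩ := hI (min (m + d) (m' + d'))
  obtain ⟨h₁, h₂, h₃, h₄, h₅, -⟩ := id hf
  obtain ⟨g₁, g₂, g₃, g₄, g₅, -⟩ := id hf'
  have hk := h.lt_succ k
  have hj := h.lt_succ j
  have ha : Agree x (c k + d) (c j + d') (-min (m + d) (m' + d')) 0 := by
    by_contra ha
    refine hN.no_three_classes (m := min (m + d) (m' + d')) (by omega) (by omega)
      (h₄.at_shift (by ring) (by omega) (by omega)) h₅
      (g₄.at_shift (by ring) (by omega) (by omega)) g₅ hpp (by simpa using hne) ha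
      (h.not_agree_main hlo hf (by omega) hp)
      (h.not_agree_main hlo hf' (by omega) hp)
  have hd : d = d' := by
    rcases lt_trichotomy d d' with hd | hd | hd
    · obtain ⟨i, hi⟩ := h.cut ha (j := k) (t := -d) (by ring) (by omega) (by omega)
      have := h.succ_le (k := j) (j := i) (by omega)
      omega
    · exact hd
    · obtain ⟨i, hi⟩ := h.cut ha.symm (j := j) (t := -d') (by ring) (by omega) (by omega)
      have := h.succ_le (k := k) (j := i) (by omega)
      omega
  subst hd
  exact ⟨rfl, ha.at_shift (by ring) (by omega) (by omega)⟩

theorem fork_cuts_agree (h : RState x β lo 0 c y) (hlo : lo ≤ 0) {N : ℤ} (hN : RSBound x N)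
    (hn : N ≤ -lo) (hI : InfRS x β (lo - 1) 0) {k₁ k₁' k₂ k₂' m₁ m₂ : ℤ} (t : ℕ)
    (hm₁ : -m₁ ≤ lo - 1) (hm₂ : -m₂ ≤ lo - 1)
    (ha₁ : Agree x (c k₁) (c k₁') (-m₁) 0) (ha₂ : Agree x (c k₂) (c k₂') (-m₂) 0)
    (hy₁ : ∀ i < t, y (k₁ + i) = y (k₁' + i)) (hy₂ : ∀ i < t, y (k₂ + i) = y (k₂' + i))
    (hy : ∀ i < t, y (k₁ + i) = y (k₂ + i))
    (hne₁ : y (k₁ + t) ≠ y (k₁' + t)) (hne₂ : y (k₂ + t) ≠ y (k₂' + t))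
    (hx₁ : x (c (k₁ + t) + (lo - 1)) ≠ β (lo - 1))
    (hx₂ : x (c (k₂ + t) + (lo - 1)) ≠ β (lo - 1)) :
    Agree x (c k₁) (c k₂) (-min m₁ m₂) 0 := by
  obtain ⟨e₁, b₁⟩ := h.extend hlo ha₁ t hy₁
  obtain ⟨e₂, b₂⟩ := h.extend hlo ha₂ t hy₂
  obtain ⟨e₃, -⟩ := h.extend hlo (h.agree k₁ k₂) t hy
  set L := c (k₁ + t) - c k₁ with hL
  have hL0 : 0 ≤ L := by
    have : c k₁ ≤ c (k₁ + t) := h.mono.monotone (by omega)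
    omega
  obtain ⟨d₁, f₁, f₂, f₃, f₄, f₅⟩ := h.fork (m := m₁ + L) (by omega)
    (b₁.at_shift (p' := c (k₁ + t)) (q' := c (k₁' + t)) (by omega) (by omega) (by omega)) hne₁
  obtain ⟨d₂, g₁, g₂, g₃, g₄, g₅⟩ := h.fork (m := m₂ + L) (by omega)
    (b₂.at_shift (p' := c (k₂ + t)) (q' := c (k₂' + t)) (by omega) (by omega) (by omega)) hne₂
  obtain ⟨-, hag⟩ := h.offFork_unique hlo hN hn hI (by omega) (by omega)
    ⟨f₁, f₂, f₃, f₄, f₅, Or.inl hx₁⟩ ⟨g₁, g₂, g₃, g₄, g₅, Or.inl hx₂⟩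
  exact hag.at_shift (by omega) (by omega) (by omega)

end RState

end SubshiftSadic

namespace SubshiftSadic

namespace RState

variable {A : Type*} {x β : ℤ → A} {lo : ℤ} {c : ℤ → ℤ} {y : ℤ → ABC}

theorem exists_main (h : RState x β lo 0 c y) (hlo : lo ≤ 0) (hI : InfRS x β (lo - 1) 0)
    (hR : Recurs x) :
    ∃ R, ∀ q, ∃ k, q ≤ c k ∧ c k < q + R ∧ x (c k + (lo - 1)) = β (lo - 1) := by
  obtain ⟨p, -, hp, -, -⟩ := hI 0
  obtain ⟨R, hR⟩ := hR p (lo - 1) 0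
  refine ⟨R, fun q => ?_⟩
  obtain ⟨t, h₁, h₂, h₃⟩ := hR q
  have h₄ := (occ_pred_iff hlo).1 (hp.of_agree h₃)
  obtain ⟨k, rfl⟩ := (h.occ t).1 h₄.1
  exact ⟨k, h₁, h₂, h₄.2⟩

theorem labelling (h : RState x β lo 0 c y) (hlo : lo ≤ 0) {N : ℤ} (hN : RSBound x N)
    (hn : N ≤ -lo) (hI : InfRS x β (lo - 1) 0) (hR : Recurs x) {y₁ : ℤ → ABC} {typ : ABC → A}
    (htyp : ∀ k, typ (y₁ k) = x (c (k + 1) + (lo - 1))) (hsurj : ∀ t, ∃ k, y₁ k = t)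
    (hy : ∀ k k', y₁ k = y₁ k' → y k = y k')
    (hsucc : ∀ k k', typ (y₁ k) = typ (y₁ k') → y (k + 1) = y (k' + 1) →
      y₁ (k + 1) = y₁ (k' + 1))
    (hoff : ∀ k k', typ (y₁ k) ≠ β (lo - 1) → y k = y k' → y₁ k = y₁ k')
    (hstrict : ∃ k, x (c k + (lo - 1)) ≠ β (lo - 1)) :
    Labelling y₁ typ (β (lo - 1)) := by
  have hag : ∀ {k k' : ℤ}, typ (y₁ k) = typ (y₁ k') →
      Agree x (c (k + 1)) (c (k' + 1)) (lo - 1) 0 := by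
    intro k k' ht d h₁ h₂
    by_cases hd : d = lo - 1
    · rw [hd, ← htyp, ← htyp, ht]
    · exact h.agree _ _ d (by omega) h₂
  have hm : -(1 - lo) = lo - 1 := by ring
  have hfork : ∀ {k k' : ℤ}, typ (y₁ k) = typ (y₁ k') → y₁ (k + 1) ≠ y₁ (k' + 1) →
      ∃ d, 0 ≤ d ∧ c (k + 1) + d < c (k + 1 + 1) ∧ c (k' + 1) + d < c (k' + 1 + 1) ∧
      Agree x (c (k + 1)) (c (k' + 1)) (-(1 - lo)) d ∧
      x (c (k + 1) + d) ≠ x (c (k' + 1) + d) := fun ht hne =>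
    h.fork (by omega) (hm ▸ hag ht) fun h => hne (hsucc _ _ ht h)
  have hmain : ∀ m, ∃ p p', Occ x β (lo - 1) 0 p ∧ Agree x p p' (-m) 0 ∧ x p ≠ x p' := by
    simpa [InfRS] using hI
  have hseg : ∀ (r : List ABC) {k k' : ℤ}, seg y₁ (k + 1) r.length = r → seg y₁ (k' + 1) r.length = r →
      ∀ i < r.length, y (k + 1 + i) = y (k' + 1 + i) := fun r k k' hk hk' i hi =>
    hy _ _ ((seg_eq_seg_iff _ _ _ _ _).1 (hk.trans hk'.symm) i hi)
  have hlast : ∀ (r : List ABC) {k k' : ℤ}, seg y₁ (k + 1) r.length = r → seg y₁ (k' + 1) r.length = r →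
      typ (y₁ k) = typ (y₁ k') → typ (y₁ (k + r.length)) = typ (y₁ (k' + r.length)) := by
    intro r k k' hk hk' ht
    obtain hr | hr := Nat.eq_zero_or_pos r.length
    · simpa [hr] using ht
    · have := (seg_eq_seg_iff _ _ _ _ _).1 (hk.trans hk'.symm) (r.length - 1) (by omega)
      rw [show k + 1 + ((r.length - 1 : ℕ) : ℤ) = k + r.length by omega,
        show k' + 1 + ((r.length - 1 : ℕ) : ℤ) = k' + r.length by omega] at this
      rw [this]
  have hne : ∀ (r : List ABC) {k k' : ℤ}, seg y₁ (k + 1) r.length = r → seg y₁ (k' + 1) r.length = r →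
      typ (y₁ k) = typ (y₁ k') → y₁ (k + r.length + 1) ≠ y₁ (k' + r.length + 1) →
      y (k + 1 + r.length) ≠ y (k' + 1 + r.length) := by
    intro r k k' hk hk' ht hne he
    rw [add_right_comm, add_right_comm k'] at he
    exact hne (hsucc _ _ (hlast r hk hk' ht) he)
  refine ⟨hsurj, fun k => ?_, ?_, ?_, ?_, ?_, ?_, ?_⟩
  · obtain ⟨R, hR⟩ := h.exists_main hlo hI hR
    obtain ⟨j, h₁, -, h₂⟩ := hR (c (k + 1 + 1))
    have h₃ : k + 1 + 1 ≤ j := h.mono.le_iff_le.1 h₁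
    obtain ⟨m, hm⟩ := Int.eq_ofNat_of_zero_le (show 0 ≤ j - (k + 1 + 1) by omega)
    refine ⟨m, ?_⟩
    rw [htyp, show k + 1 + (m : ℤ) + 1 = j by omega, h₂]
  · obtain ⟨k, hk⟩ := hstrict
    exact ⟨y₁ (k - 1), by rw [htyp]; simpa using hk⟩
  · obtain ⟨p, p', h₁, h₂, h₃⟩ := hmain (1 - lo)
    have h₄ := h₁.of_agree (h₂.mono (by omega) le_rfl)
    obtain ⟨k, rfl⟩ := (h.occ p).1 (h₁.mono (by omega) le_rfl)
    obtain ⟨k', rfl⟩ := (h.occ p').1 (h₄.mono (by omega) le_rfl)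
    refine ⟨k - 1, k' - 1, ?_, ?_, fun he => h₃ ?_⟩
    · simpa [htyp] using ((occ_pred_iff hlo).1 h₁).2
    · simpa [htyp] using ((occ_pred_iff hlo).1 h₄).2
    · simp only [sub_add_cancel] at he
      have h₅ := h.lt_succ k
      exact ((h.label _ _).1 (hy _ _ he)).2.eq_at (by ring) (by omega) (by omega)
  · intro k₁ k₂ k₃ h₁ h₂ h₃ h₁₂ h₁₃
    by_contra h₂₃
    obtain ⟨d, f₁, f₂, f₃, f₄, f₅⟩ := hfork h₂.symm h₁₂
    obtain ⟨d', g₁, g₂, g₃, g₄, g₅⟩ := hfork h₃.symm h₁₃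
    obtain ⟨d'', i₁, i₂, i₃, i₄, i₅⟩ := hfork (h₂.trans h₃.symm) h₂₃
    have o₁ : x (c (k₁ + 1) + (lo - 1)) ≠ β (lo - 1) := by rwa [← htyp]
    have o₂ : x (c (k₂ + 1) + (lo - 1)) ≠ β (lo - 1) := by rwa [← htyp, h₂]
    have hF : OffFork x β lo c _ _ _ _ := ⟨f₁, f₂, f₃, f₄, f₅, Or.inl o₁⟩
    obtain ⟨rfl, -⟩ := h.offFork_unique hlo hN hn hI hm.le hm.le hF
      ⟨g₁, g₂, g₃, g₄, g₅, Or.inl o₁⟩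
    obtain ⟨rfl, -⟩ := h.offFork_unique hlo hN hn hI hm.le hm.le hF
      ⟨i₁, i₂, i₃, i₄, i₅, Or.inl o₂⟩
    obtain ⟨p, p', q₁, q₂, q₃⟩ := hmain (1 - lo + d)
    exact hN.no_three_letters (m := 1 - lo + d) (by omega) (by omega)
      (g₄.at_shift (by ring) (by omega) (by omega)) (i₄.at_shift (by ring) (by omega) (by omega))
      f₅ g₅ i₅ q₂ q₃ (h.not_agree_main hlo hF (by omega) q₁)
  · intro j j' hj hjj hne k₁ k₂ k₃ h₁ h₂ h₃ h₁₂ h₁₃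
    by_contra h₂₃
    obtain ⟨e, e₁, e₂, e₃, e₄, e₅⟩ := hfork hjj.symm hne
    have hF : OffFork x β lo c _ _ _ _ :=
      ⟨e₁, e₂, e₃, e₄, e₅, Or.inl (by rwa [← htyp])⟩
    have hzero : ∀ {k k' : ℤ}, typ (y₁ k) = β (lo - 1) → typ (y₁ k') = β (lo - 1) →
        y₁ (k + 1) ≠ y₁ (k' + 1) → x (c (k + 1)) ≠ x (c (k' + 1)) := by
      intro k k' hk hk' hne
      obtain ⟨d, f₁, f₂, f₃, f₄, f₅⟩ := hfork (hk.trans hk'.symm) hne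
      rcases f₁.lt_or_eq with hd | rfl
      · obtain ⟨-, ha⟩ := h.offFork_unique hlo hN hn hI hm.le hm.le hF
          ⟨f₁, f₂, f₃, f₄, f₅, Or.inr hd⟩
        refine absurd ?_ hj
        rw [htyp, ← hk, htyp]
        exact ha _ (by omega) (by omega)
      · simpa using f₅
    refine hN.no_three_letters (m := 1 - lo) (by omega) (by omega)
      (hm ▸ hag (h₁.trans h₃.symm)) (hm ▸ hag (h₂.trans h₃.symm)) (hzero h₁ h₂ h₁₂)
      (hzero h₁ h₃ h₁₃) (hzero h₂ h₃ h₂₃)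
      (e₄.at_shift (p' := c (j + 1) + e) (q' := c (j' + 1) + e) (by ring) (by omega) (by omega))
      e₅ fun ha => ?_
    refine h.not_agree_main hlo hF (μ := 1 - lo) hm.le ?_ ha.symm
    refine (occ_pred_iff hlo).2 ⟨(h.occ _).2 ⟨_, rfl⟩, by rw [← h₁, htyp]⟩
  · intro r k₁ k₁' k₂ k₂' h₁ h₁' h₂ h₂' t₁ t₂ n₁ n₂ o₁ o₂
    have := h.fork_cuts_agree hlo hN hn hI r.length hm.le hm.le (hm ▸ hag t₁) (hm ▸ hag t₂)
      (hseg r h₁ h₁') (hseg r h₂ h₂') (hseg r h₁ h₂) (hne r h₁ h₁' t₁ n₁) (hne r h₂ h₂' t₂ n₂)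
      (by rwa [add_right_comm, ← htyp]) (by rwa [add_right_comm, ← htyp])
    rw [htyp, htyp]
    exact this _ (by omega) (by omega)
  · intro r k₁ k₁' k₂ k₂' h₁ h₁' h₂ h₂' t₁ t₂ v₁ v₂ n₁ n₂ o₁ o₂
    have l₁ := h.lt_succ k₁
    have l₂ := h.lt_succ k₂
    obtain ⟨u₁, w₁⟩ := (h.label _ _).1 (hy _ _ t₁)
    obtain ⟨u₂, w₂⟩ := (h.label _ _).1 (hy _ _ t₂)
    have := h.fork_cuts_agree hlo hN hn hI r.length (m₁ := c (k₁ + 1) - c k₁ - lo)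
      (m₂ := c (k₂ + 1) - c k₂ - lo) (by omega) (by omega)
      (w₁.at_shift (by omega) (by omega) (by omega)) (w₂.at_shift (by omega) (by omega) (by omega))
      (hseg r h₁ h₁') (hseg r h₂ h₂') (hseg r h₁ h₂) (hne r h₁ h₁' (by rw [t₁]) n₁)
      (hne r h₂ h₂' (by rw [t₂]) n₂)
      (by rwa [add_right_comm, ← htyp]) (by rwa [add_right_comm, ← htyp])
    have hlen : c (k₁ + 1) - c k₁ = c (k₂ + 1) - c k₂ := by
      rcases lt_trichotomy (c (k₁ + 1) - c k₁) (c (k₂ + 1) - c k₂) with hl | hl | hl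
      · obtain ⟨i, hi⟩ := h.cut this (j := k₁) (t := c k₁ - c (k₁ + 1)) (by ring) (by omega)
          (by omega)
        have := h.succ_le (k := k₂) (j := i) (by omega)
        omega
      · exact hl
      · obtain ⟨i, hi⟩ := h.cut this.symm (j := k₂) (t := c k₂ - c (k₂ + 1)) (by ring) (by omega)
          (by omega)
        have := h.succ_le (k := k₁) (j := i) (by omega)
        omega
    exact hoff _ _ v₁ ((h.label _ _).2
      ⟨hlen, this.at_shift (by omega) (by omega) (by omega)⟩)

end RState

end SubshiftSadic

namespace SubshiftSadic

open Classical in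
theorem exists_strictMono_enum (K : Set ℤ) (h₁ : ∀ q, ∃ k ∈ K, q ≤ k)
    (h₂ : ∀ q, ∃ k ∈ K, k ≤ q) :
    ∃ g : ℤ → ℤ, StrictMono g ∧ ∀ i, i ∈ K ↔ ∃ k, g k = i := by
  have : Nonempty K := let ⟨k, hk, _⟩ := h₁ 0; ⟨⟨k, hk⟩⟩
  have : NoMaxOrder K := ⟨fun q => let ⟨k, hk, h⟩ := h₁ (q.1 + 1); ⟨⟨k, hk⟩, by
    rw [← Subtype.coe_lt_coe]; simp; omega⟩⟩
  have : NoMinOrder K := ⟨fun q => let ⟨k, hk, h⟩ := h₂ (q.1 - 1); ⟨⟨k, hk⟩, by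
    rw [← Subtype.coe_lt_coe]; simp; omega⟩⟩
  let : SuccOrder K := LinearLocallyFiniteOrder.succOrder K
  let : PredOrder K := LinearLocallyFiniteOrder.predOrder K
  let e := (orderIsoIntOfLinearSuccPredArch (ι := K)).symm
  refine ⟨fun k => (e k : ℤ), fun _ _ h => e.strictMono h,
    fun i => ⟨fun hi => ⟨e.symm ⟨i, hi⟩, by simp⟩, ?_⟩⟩
  rintro ⟨k, rfl⟩
  exact (e k).2

namespace RState

variable {A : Type*} {x β : ℤ → A} {lo : ℤ} {c : ℤ → ℤ} {y : ℤ → ABC}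

theorem labels_loc (h : RState x β lo 0 c y) (hlo : lo ≤ 0) {R : ℤ}
    (hR : ∀ k, c (k + 1) - c k ≤ R) :
    ∃ r, ∀ k i', Agree x (c k) i' (-r) r → ∃ k', c k' = i' ∧ y k' = y k ∧
      y (k' - 1) = y (k - 1) ∧ y (k' - 2) = y (k - 2) := by
  refine ⟨3 * R - lo, fun k i' ha => ?_⟩
  have h₁ := hR (k - 2)
  have h₂ := hR (k - 2 + 1)
  have h₃ := hR (k - 2 + 1 + 1)
  have h₁' := h.lt_succ (k - 2)
  have h₂' := h.lt_succ (k - 2 + 1)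
  have h₃' := h.lt_succ (k - 2 + 1 + 1)
  rw [show k - 2 + 1 + 1 = k by ring] at *
  obtain ⟨j, hj⟩ := h.cut ha (j := k - 2) (t := c (k - 2) - c k) (by ring) (by omega) (by omega)
  have hk : k - 2 + (2 : ℕ) = k := by norm_num
  have hk' : k - 2 + (3 : ℕ) = k + 1 := by push_cast; ring
  have hb : Agree x (c (k - 2)) (c j) lo (3 * R) :=
    ha.at_shift (by omega) (by omega) (by omega)
  obtain ⟨g₁, -⟩ := h.decode hb 2 (by rw [hk]; omega)
  obtain ⟨-, g₂⟩ := h.decode hb 3 (by rw [hk']; omega)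
  rw [hk] at g₁
  refine ⟨j + 2, by push_cast at g₁; omega, ?_, ?_, ?_⟩
  · have := g₂ 2 (by norm_num)
    rw [hk] at this
    exact this.symm
  · have := g₂ 1 (by norm_num)
    rw [show j + 2 - 1 = j + (1 : ℕ) by push_cast; ring, ← this]
    congr 1; push_cast; ring
  · have := g₂ 0 (by norm_num)
    rw [show j + 2 - 2 = j + (0 : ℕ) by push_cast; ring, ← this]
    congr 1; push_cast; ring

theorem exists_refinement (h : RState x β lo 0 c y) (hlo : lo ≤ 0) {N : ℤ} (hN : RSBound x N)
    (hn : N ≤ -lo) (hI : InfRS x β (lo - 1) 0) (hR : Recurs x) {y₁ : ℤ → ABC}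
    (hsurj : ∀ t, ∃ k, y₁ k = t)
    (hy : ∀ k k', y₁ k = y₁ k' → y k = y k')
    (hsucc : ∀ k k', x (c (k + 1) + (lo - 1)) = x (c (k' + 1) + (lo - 1)) →
      y (k + 1) = y (k' + 1) → y₁ (k + 1) = y₁ (k' + 1))
    (hoff : ∀ k k', x (c (k + 1) + (lo - 1)) ≠ β (lo - 1) → y k = y k' → y₁ k = y₁ k')
    (hstrict : ∃ k, x (c k + (lo - 1)) ≠ β (lo - 1)) :
    ∃ c' y', RState x β (lo - 1) 0 c' y' ∧ Path c y₁ c' y' := by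
  choose κ hκ using hsurj
  have hx : ∀ k k', y₁ k = y₁ k' → x (c (k + 1) + (lo - 1)) = x (c (k' + 1) + (lo - 1)) := by
    intro k k' he
    have h₁ := h.lt_succ k
    obtain ⟨h₂, h₃⟩ := (h.label _ _).1 (hy _ _ he)
    exact h₃.eq_at (by omega) (by omega) (by omega)
  obtain ⟨typ, htyp⟩ : ∃ typ : ABC → A, ∀ k, typ (y₁ k) = x (c (k + 1) + (lo - 1)) :=
    ⟨fun t => x (c (κ t + 1) + (lo - 1)), fun k => hx _ _ (hκ _)⟩
  have hlab := h.labelling hlo hN hn hI hR htyp (fun t => ⟨_, hκ t⟩) hy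
    (fun k k' => by rw [htyp, htyp]; exact hsucc k k')
    (fun k k' => by rw [htyp]; exact hoff k k') hstrict
  obtain ⟨p, q, r, ⟨f, hf, fp, fq, fr⟩, ht⟩ := hlab.tame
  have ht' : ∀ k l, typ (y₁ k) = β (lo - 1) → Ret y₁ (fun t => typ t = β (lo - 1)) k l →
      ∃ s, f s = l := by
    intro k l hk hl
    rcases ht k l hk hl with rfl | rfl | rfl
    exacts [⟨_, fp⟩, ⟨_, fq⟩, ⟨_, fr⟩]
  obtain ⟨R, hR⟩ := h.exists_main hlo hI hR
  obtain ⟨g, hg, hgK⟩ := exists_strictMono_enum {k | x (c k + (lo - 1)) = β (lo - 1)}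
    (fun q => by
      obtain ⟨k, h₁, -, h₂⟩ := hR (c q)
      exact ⟨k, h₂, h.mono.le_iff_le.1 h₁⟩)
    (fun q => by
      obtain ⟨k, -, h₁, h₂⟩ := hR (c q - R)
      exact ⟨k, h₂, h.mono.le_iff_le.1 (by omega)⟩)
  simp only [Set.mem_ofPred_eq] at hgK
  have hgt : ∀ j, g j < g (j + 1) := fun j => hg (by omega)
  have hgm : ∀ j, x (c (g j) + (lo - 1)) = β (lo - 1) := fun j => (hgK _).2 ⟨j, rfl⟩
  have hoc : ∀ j, Occ x β (lo - 1) 0 (c (g j)) := fun j =>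
    (occ_pred_iff hlo).2 ⟨(h.occ _).2 ⟨_, rfl⟩, hgm j⟩
  have hret : ∀ j, Ret y₁ (fun t => typ t = β (lo - 1)) (g j - 1)
      (seg y₁ (g j) (g (j + 1) - g j).toNat) := by
    intro j
    have h₁ := hgt j
    have := Ret.of_seg (y := y₁) (P := fun t => typ t = β (lo - 1)) (j := g j - 1)
      (m := (g (j + 1) - g j - 1).toNat) (fun i hi => ?_) ?_
    · rwa [show (g (j + 1) - g j - 1).toNat + 1 = (g (j + 1) - g j).toNat by omega,
        sub_add_cancel] at this
    · rw [htyp, sub_add_cancel, hgK]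
      rintro ⟨k, hk⟩
      have h₂ : j < k := hg.lt_iff_lt.1 (by omega)
      have h₃ : k < j + 1 := hg.lt_iff_lt.1 (by omega)
      omega
    · rw [htyp, sub_add_cancel, hgK]
      exact ⟨j + 1, by omega⟩
  have hex : ∀ j, ∃ s, f s = seg y₁ (g j) (g (j + 1) - g j).toNat := fun j =>
    ht' _ _ (by rw [htyp, sub_add_cancel, hgm]) (hret j)
  obtain ⟨S, hS⟩ : ∃ S : List ABC → ABC, ∀ l, (∃ s, f s = l) → f (S l) = l := by
    classical
    exact ⟨fun l => if hl : ∃ s, f s = l then hl.choose else .a, fun l hl => by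
      simp only [hl, dif_pos]; exact hl.choose_spec⟩
  refine ⟨fun j => c (g j), fun j => S (seg y₁ (g j) (g (j + 1) - g j).toNat), ⟨fun i => ?_, ?_,
    fun j j' => ?_⟩, f, hf, g, fun _ => rfl, fun j => ?_⟩
  · rw [occ_pred_iff hlo, h.occ]
    constructor
    · rintro ⟨⟨k, rfl⟩, h₂⟩
      obtain ⟨j, rfl⟩ := (hgK _).1 h₂
      exact ⟨j, rfl⟩
    · rintro ⟨j, rfl⟩
      exact ⟨⟨_, rfl⟩, hgm j⟩
  · exact h.mono.comp hg
  · have h₁ := hgt j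
    have h₁' := hgt j'
    obtain ⟨t, ht⟩ := Int.eq_ofNat_of_zero_le (show 0 ≤ g (j + 1) - g j by omega)
    obtain ⟨t', ht'⟩ := Int.eq_ofNat_of_zero_le (show 0 ≤ g (j' + 1) - g j' by omega)
    have e₁ : g (j + 1) = g j + t := by omega
    have e₂ : g (j' + 1) = g j' + t' := by omega
    have hSS : S (seg y₁ (g j) (g (j + 1) - g j).toNat) =
        S (seg y₁ (g j') (g (j' + 1) - g j').toNat) ↔ seg y₁ (g j) t = seg y₁ (g j') t' := by
      have h₂ := hS _ (hex j)
      have h₃ := hS _ (hex j')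
      rw [ht, ht'] at *
      simp only [Int.toNat_natCast] at *
      exact ⟨fun he => by rw [← h₂, ← h₃, he], fun he => by rw [he]⟩
    rw [hSS, e₁, e₂]
    constructor
    · intro he
      have htt : t = t' := by simpa using congrArg List.length he
      subst htt
      obtain ⟨h₂, h₃⟩ := h.extend hlo ((hoc j).agree (hoc j')) t fun i hi =>
        hy _ _ ((seg_eq_seg_iff _ _ _ _ _).1 he i hi)
      exact ⟨h₂.symm, by simpa using h₃⟩
    · rintro ⟨h₂, h₃⟩
      rw [add_zero] at h₃
      have h₄ := h.decode (h₃.mono (by omega) le_rfl) t (by omega)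
      have htt : t = t' := by
        have : c (g j' + t) = c (g j' + t') := by omega
        have := h.mono.injective this
        omega
      subst htt
      rw [seg_eq_seg_iff]
      intro i hi
      have hci : ∀ i : ℕ, i ≤ t → c (g j' + i) - c (g j') = c (g j + i) - c (g j) := by
        intro i hi
        refine (h.decode (h₃.mono (by omega) le_rfl) i ?_).1
        have : c (g j + i) ≤ c (g j + t) := h.mono.monotone (by omega)
        omega
      have := hsucc (g j + i - 1) (g j' + i - 1) ?_ ?_
      · simpa using this
      · simp only [sub_add_cancel]
        have h₅ := hci i (by omega)
        have h₆ : c (g j) ≤ c (g j + i) := h.mono.monotone (by omega)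
        have h₇ : c (g j + i) < c (g j + t) := h.mono (by omega)
        exact h₃.eq_at (by omega) (by omega) (by omega)
      · simp only [sub_add_cancel]
        exact h₄.2 i hi
  · have h₁ := hgt j
    simp only
    rw [hS _ (hex j), length_seg]
    exact ⟨by omega, rfl⟩

end RState

end SubshiftSadic

namespace SubshiftSadic

theorem path_of_letters {c : ℤ → ℤ} {y y₁ : ℤ → ABC} {f : ABC → List ABC} (hf : Gen f)
    (h : ∀ k, f (y₁ k) = [y k]) : Path c y c y₁ :=
  ⟨f, hf, id, fun _ => rfl, fun k => by simp [h, seg_one]⟩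

namespace RState

variable {A : Type*} {x β : ℤ → A} {lo : ℤ} {c : ℤ → ℤ} {y : ℤ → ABC}

theorem gap_le (h : RState x β lo 0 c y) (hlo : lo ≤ 0) (hI : InfRS x β (lo - 1) 0)
    (hR : Recurs x) : ∃ R, ∀ k, c (k + 1) - c k ≤ R := by
  obtain ⟨R, hR⟩ := h.exists_main hlo hI hR
  refine ⟨R, fun k => ?_⟩
  obtain ⟨j, h₁, h₂, -⟩ := hR (c k + 1)
  have := h.succ_le (k := k) (j := j) (by omega)
  omega

/-- If the words on `[lo, 0)` have exactly two return words, the occurrences of one of them can be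
separated according to the preceding return word. -/
theorem exists_split (h : RState x β lo 0 c y) (hlo : lo ≤ 0) (hI : InfRS x β (lo - 1) 0)
    (hR : Recurs x) (hstrict : ∃ k, x (c k + (lo - 1)) ≠ β (lo - 1)) {w : ABC}
    (hw : ∀ k, y k ≠ w) :
    ∃ v u, (∀ t, t = v ∨ t = w ∨ t = u) ∧ v ≠ u ∧ v ≠ w ∧ u ≠ w ∧
      (∀ k, x (c (k + 1) + (lo - 1)) ≠ β (lo - 1) ↔ y k = v) ∧ (∃ k, y k = v) ∧
      (∃ k, y (k - 1) = u ∧ y k = u) ∧ ∃ k, y (k - 1) = v ∧ y k = u := by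
  have hx : ∀ k k', y k = y k' → x (c (k + 1) + (lo - 1)) = x (c (k' + 1) + (lo - 1)) := by
    intro k k' he
    have h₁ := h.lt_succ k
    obtain ⟨h₂, h₃⟩ := (h.label _ _).1 he
    exact h₃.eq_at (by omega) (by omega) (by omega)
  obtain ⟨k₀, hk₀⟩ := hstrict
  have hv : y (k₀ - 1) ≠ w := hw _
  obtain ⟨u, huv, huw, hcov⟩ := Labelling.exists_third hv
  generalize hv' : y (k₀ - 1) = v at *
  obtain ⟨k, k', h₁, h₂, h₃⟩ : ∃ k k', x (c k + (lo - 1)) = β (lo - 1) ∧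
      x (c k' + (lo - 1)) = β (lo - 1) ∧ y k ≠ y k' := by
    obtain ⟨p, p', h₁, h₂, h₃⟩ := hI (1 - lo)
    have h₄ := h₁.of_agree (h₂.mono (by omega) le_rfl)
    obtain ⟨k, rfl⟩ := (h.occ p).1 (h₁.mono (by omega) le_rfl)
    obtain ⟨k', rfl⟩ := (h.occ p').1 (h₄.mono (by omega) le_rfl)
    refine ⟨k, k', ((occ_pred_iff hlo).1 h₁).2, ((occ_pred_iff hlo).1 h₄).2, fun he => h₃ ?_⟩
    have h₅ := h.lt_succ k
    exact ((h.label _ _).1 he).2.eq_at (by ring) (by omega) (by omega)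
  have hoffv : ∀ k, y k = v → x (c (k + 1) + (lo - 1)) ≠ β (lo - 1) := fun k hk => by
    rw [hx k (k₀ - 1) (hk.trans hv'.symm), sub_add_cancel]; exact hk₀
  have hmain : ∀ k, x (c k + (lo - 1)) = β (lo - 1) → y (k - 1) = u := fun k hk => by
    rcases hcov (y (k - 1)) with he | he | he
    · exact absurd (by rwa [sub_add_cancel]) (hoffv _ he)
    · exact absurd he (hw _)
    · exact he
  have hoff : ∀ k, x (c (k + 1) + (lo - 1)) ≠ β (lo - 1) → y k = v := fun k hk => by
    rcases hcov (y k) with he | he | he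
    · exact he
    · exact absurd he (hw _)
    · refine absurd ?_ hk
      rw [hx k (_ - 1) (he.trans (hmain _ h₁).symm), sub_add_cancel, h₁]
  refine ⟨v, u, hcov, huv.symm, hv, huw, fun k => ⟨hoff k, hoffv k⟩, ⟨_, hv'⟩, ?_, ?_⟩
  · by_cases he : y k = u
    · exact ⟨k, hmain _ h₁, he⟩
    · refine ⟨k', hmain _ h₂, ?_⟩
      rcases hcov (y k) with h₄ | h₄ | h₄
      · rcases hcov (y k') with h₅ | h₅ | h₅
        · exact absurd (h₄.trans h₅.symm) h₃
        · exact absurd h₅ (hw _)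
        · exact h₅
      · exact absurd h₄ (hw _)
      · exact absurd h₄ he
  · by_contra hcon
    push Not at hcon
    have key : ∀ m : ℕ, y (k₀ - 1 + m) = v := by
      intro m
      induction m with
      | zero => simpa using hv'
      | succ m ih =>
        have := hcon (k₀ - 1 + (m + 1 : ℕ)) (by rw [← ih]; congr 1; push_cast; ring)
        rcases hcov (y (k₀ - 1 + (m + 1 : ℕ))) with he | he | he
        · exact he
        · exact absurd he (hw _)
        · exact absurd he this
    obtain ⟨R, hR⟩ := h.exists_main hlo hI hR
    obtain ⟨j, h₄, -, h₅⟩ := hR (c (k₀ + 1))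
    have h₆ : k₀ + 1 ≤ j := h.mono.le_iff_le.1 h₄
    have h₇ := key (j - k₀).toNat
    rw [show k₀ - 1 + ((j - k₀).toNat : ℤ) = j - 1 by omega, hmain _ h₅] at h₇
    exact huv h₇

theorem left_step (h : RState x β lo 0 c y) (hlo : lo ≤ 0) {N : ℤ} (hN : RSBound x N)
    (hn : N ≤ -lo) (hI : InfRS x β (lo - 1) 0) (hR : Recurs x) :
    ∃ c' y' y₁, RState x β (lo - 1) 0 c' y' ∧ Path c y c y₁ ∧ Path c y₁ c' y' ∧ Loc x c y₁ ∧
      ((∀ k, ∃ j, c' j = c k) ∨ ∀ t, ∃ k, y₁ k = t) := by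
  obtain ⟨R, hgap⟩ := h.gap_le hlo hI hR
  obtain ⟨r, hr⟩ := h.labels_loc hlo hgap
  have hloc : Loc x c y := ⟨r, fun k i' ha => by
    obtain ⟨k', h₁, h₂, h₃, -⟩ := hr k i' ha
    exact ⟨k', h₁, h₂, h₃⟩⟩
  by_cases hstrict : ∃ k, x (c k + (lo - 1)) ≠ β (lo - 1)
  · by_cases hs : ∀ t, ∃ k, y k = t
    · obtain ⟨c', y', h₁, h₂⟩ := h.exists_refinement hlo hN hn hI hR (y₁ := y) hs
        (fun _ _ he => he) (fun _ _ _ he => he) (fun _ _ _ he => he) hstrict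
      exact ⟨c', y', y, h₁, .refl _ _, h₂, hloc, Or.inr hs⟩
    · push Not at hs
      obtain ⟨w, hw⟩ := hs
      obtain ⟨v, u, hcov, hvu, hvw, huw, htyp, ⟨k₁, e₁⟩, ⟨k₂, e₂, e₂'⟩, k₃, e₃, e₃'⟩ :=
        h.exists_split hlo hI hR hstrict hw
      have hyu : ∀ k, y k ≠ v → y k = u := fun k hk =>
        ((hcov (y k)).resolve_left hk).resolve_left (hw k)
      obtain ⟨f, hf, fa, fb, fc⟩ : Tr [v] [u] [u] := (Tr.base hvu hvw huw).dup
      let F : ABC → ABC → ABC := fun s t => if t = v then .a else if s = v then .c else .b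
      have hF : ∀ s t, t = v ∨ t = u → f (F s t) = [t] := by
        intro s t ht
        by_cases h₁ : t = v
        · simp [F, h₁, fa]
        · have h₂ := ht.resolve_left h₁
          by_cases h₃ : s = v
          · simp [F, h₃, fc, h₂, hvu.symm]
          · simp [F, h₃, fb, h₂, hvu.symm]
      have hf₁ : ∀ k, f (F (y (k - 1)) (y k)) = [y k] := fun k => hF _ _ <| by
        by_cases hk : y k = v
        · exact Or.inl hk
        · exact Or.inr (hyu k hk)
      have hs : ∀ t, ∃ k, F (y (k - 1)) (y k) = t := by
        rintro (_ | _ | _)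
        · exact ⟨k₁, by simp [F, e₁]⟩
        · exact ⟨k₂, by simp [F, e₂, e₂', hvu.symm]⟩
        · exact ⟨k₃, by simp [F, e₃, e₃', hvu.symm]⟩
      have hF₁ : ∀ k k', F (y (k - 1)) (y k) = F (y (k' - 1)) (y k') → y k = y k' := by
        intro k k' he
        simpa [hf₁] using congrArg f he
      have hF₂ : ∀ k k', x (c (k + 1) + (lo - 1)) = x (c (k' + 1) + (lo - 1)) →
          y (k + 1) = y (k' + 1) →
          F (y (k + 1 - 1)) (y (k + 1)) = F (y (k' + 1 - 1)) (y (k' + 1)) := by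
        intro k k' hx he
        have h₁ : y k = v ↔ y k' = v := by rw [← htyp, ← htyp, hx]
        simp [F, he, h₁]
      have hF₃ : ∀ k k', x (c (k + 1) + (lo - 1)) ≠ β (lo - 1) → y k = y k' →
          F (y (k - 1)) (y k) = F (y (k' - 1)) (y k') := by
        intro k k' hx he
        have h₁ := (htyp k).1 hx
        have h₂ := he ▸ h₁
        simp [F, h₁, h₂]
      obtain ⟨c', y', h₁, h₂⟩ := h.exists_refinement hlo hN hn hI hR hs hF₁ hF₂ hF₃ hstrict
      refine ⟨c', y', _, h₁, path_of_letters hf hf₁, h₂, ⟨r, fun k i' ha => ?_⟩, Or.inr hs⟩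
      obtain ⟨k', h₁, h₂, h₃, h₄⟩ := hr k i' ha
      exact ⟨k', h₁, by simp only [h₂, h₃], by
        simp only [h₃, show k' - 1 - 1 = k' - 2 by ring, show k - 1 - 1 = k - 2 by ring, h₄]⟩
  · push Not at hstrict
    refine ⟨c, y, y, ⟨fun i => ?_, h.mono, fun k k' => ?_⟩, .refl _ _, .refl _ _, hloc,
      Or.inl fun k => ⟨k, rfl⟩⟩
    · rw [occ_pred_iff hlo, h.occ]
      exact ⟨fun h => h.1, fun ⟨k, hk⟩ => ⟨⟨k, hk⟩, hk ▸ hstrict k⟩⟩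
    · rw [h.label]
      refine and_congr_right fun _ => ⟨fun ha d h₁ h₂ => ?_, fun ha => ha.mono (by omega) le_rfl⟩
      by_cases hd : d = lo - 1
      · rw [hd, hstrict, hstrict]
      · exact ha d (by omega) h₂

end RState

end SubshiftSadic

namespace SubshiftSadic

section Subshift

variable {A : Type*} [TopologicalSpace A] {X : Set (ℤ → A)}

theorem mem_of_forall_seg (hclosed : IsClosed X) (hinv : ∀ x ∈ X, ∀ p : ℤ, shiftBy p x ∈ X)
    {x : ℤ → A} (hx : x ∈ X) {z : ℤ → A} (hz : ∀ i m, ∃ p, seg x p m = seg z i m) : z ∈ X := by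
  rw [← hclosed.closure_eq, mem_closure_iff]
  intro o ho hzo
  obtain ⟨I, u, h₁, h₂⟩ := isOpen_pi_iff.1 ho z hzo
  obtain ⟨B, hB⟩ : ∃ B : ℕ, ∀ i ∈ I, -(B : ℤ) ≤ i ∧ i < B := by
    refine ⟨∑ i ∈ I, i.natAbs + 1, fun i hi => ?_⟩
    have := Finset.single_le_sum (f := fun i : ℤ => i.natAbs) (fun _ _ => Nat.zero_le _) hi
    omega
  obtain ⟨p, hp⟩ := hz (-B) (2 * B)
  rw [seg_eq_seg_iff] at hp
  refine ⟨shiftBy (p + B) x, h₂ fun i hi => ?_, hinv x hx _⟩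
  obtain ⟨h₃, h₄⟩ := hB i hi
  have h₅ := hp (i + B).toNat (by omega)
  rw [show ((i + B).toNat : ℤ) = i + B by omega] at h₅
  have : shiftBy (p + B) x i = z i := by
    rw [shiftBy, show i + (p + B) = p + (i + B) by ring, h₅]; congr 1; ring
  rw [this]
  exact (h₁ i hi).2

variable [DiscreteTopology A]

theorem isOpen_cylinder (I : Finset ℤ) (f : ℤ → A) : IsOpen {z : ℤ → A | ∀ i ∈ I, z i = f i} := by
  have : {z : ℤ → A | ∀ i ∈ I, z i = f i} = (I : Set ℤ).pi fun i => {f i} := by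
    ext z; simp [Set.mem_pi]
  rw [this]
  exact isOpen_set_pi I.finite_toSet fun i _ => isOpen_discrete _

theorem exists_occurrence (hmin : ∀ x ∈ X, X ⊆ closure { z | ∃ p : ℤ, z = shiftBy p x })
    {x z : ℤ → A} (hx : x ∈ X) (hz : z ∈ X) (f : ℤ → ℤ) (lo hi : ℤ) :
    ∃ p, ∀ d, lo ≤ d → d < hi → x (f d + p) = z (f d) := by
  obtain ⟨_, h, p, rfl⟩ := mem_closure_iff.1 (hmin x hx hz) _
    (isOpen_cylinder ((Finset.Ico lo hi).image f) z) (fun _ _ => rfl)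
  refine ⟨p, fun d h₁ h₂ => ?_⟩
  exact h (f d) (Finset.mem_image_of_mem _ (Finset.mem_Ico.2 ⟨h₁, h₂⟩))

theorem recurs_of_minimal [Finite A] (hclosed : IsClosed X)
    (hinv : ∀ x ∈ X, ∀ p : ℤ, shiftBy p x ∈ X)
    (hmin : ∀ x ∈ X, X ⊆ closure { z | ∃ p : ℤ, z = shiftBy p x })
    {x : ℤ → A} (hx : x ∈ X) : Recurs x := by
  intro p lo hi
  obtain ⟨T, hT⟩ := hclosed.isCompact.elim_finite_subcover
    (fun t : ℤ => {z : ℤ → A | ∀ i ∈ (Finset.Ico lo hi).image (t + ·), z i = x (p - t + i)})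
    (fun t => isOpen_cylinder _ _) (fun z hz => by
      obtain ⟨t, ht⟩ := exists_occurrence hmin hz hx (p + ·) lo hi
      refine Set.mem_iUnion.2 ⟨p + t, fun i hi => ?_⟩
      obtain ⟨d, hd, rfl⟩ := Finset.mem_image.1 hi
      rw [Finset.mem_Ico] at hd
      convert ht d hd.1 hd.2 using 2 <;> ring)
  obtain ⟨B, hB⟩ : ∃ B : ℕ, ∀ i ∈ T, -(B : ℤ) ≤ i ∧ i < B := by
    refine ⟨∑ i ∈ T, i.natAbs + 1, fun i hi => ?_⟩
    have := Finset.single_le_sum (f := fun i : ℤ => i.natAbs) (fun _ _ => Nat.zero_le _) hi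
    omega
  refine ⟨2 * B, fun q => ?_⟩
  obtain ⟨t, ht, h⟩ := Set.mem_iUnion₂.1 (hT (hinv x hx (q + B)))
  obtain ⟨h₁, h₂⟩ := hB t ht
  refine ⟨q + B + t, by omega, by omega, fun d hd hd' => ?_⟩
  have := h (t + d) (Finset.mem_image_of_mem _ (Finset.mem_Ico.2 ⟨hd, hd'⟩))
  rw [shiftBy] at this
  convert this.symm using 2 <;> ring

theorem lang_eq_range (hmin : ∀ x ∈ X, X ⊆ closure { z | ∃ p : ℤ, z = shiftBy p x })
    {x : ℤ → A} (hx : x ∈ X) (n : ℕ) : Lang X n = Set.range fun i => seg x i n := by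
  ext w
  constructor
  · rintro ⟨z, hz, i, rfl⟩
    obtain ⟨p, hp⟩ := exists_occurrence hmin hx hz (i + ·) 0 n
    refine ⟨i + p, (seg_eq_seg_iff ..).2 fun k hk => ?_⟩
    rw [← hp k (by omega) (by omega)]
    congr 1; ring
  · rintro ⟨i, rfl⟩
    exact ⟨x, hx, i, rfl⟩

end Subshift

variable {A : Type*} {x : ℤ → A}

theorem finite_range_seg [Finite A] (x : ℤ → A) (n : ℕ) : (Set.range fun i => seg x i n).Finite :=
  (List.finite_length_eq A n).subset (by rintro _ ⟨i, rfl⟩; simp [length_seg])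

theorem agree_iff_seg {p q : ℤ} {n : ℕ} : Agree x p q (-n) 0 ↔ seg x (p - n) n = seg x (q - n) n := by
  rw [seg_eq_seg_iff]
  constructor
  · intro h k hk
    exact h.eq_at (by ring) (by omega) (by omega)
  · intro h d h₁ h₂
    have := h (d + n).toNat (by omega)
    rw [show ((d + n).toNat : ℤ) = d + n by omega] at this
    convert this using 2 <;> ring

theorem agree_one_iff_seg {p q : ℤ} {n : ℕ} :
    Agree x p q (-n) 1 ↔ seg x (p - n) (n + 1) = seg x (q - n) (n + 1) := by
  rw [seg_eq_seg_iff]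
  constructor
  · intro h k hk
    exact h.eq_at (by ring) (by omega) (by omega)
  · intro h d h₁ h₂
    have := h (d + n).toNat (by omega)
    rw [show ((d + n).toNat : ℤ) = d + n by omega] at this
    convert this using 2 <;> ring

theorem dropLast_seg (i : ℤ) (n : ℕ) : (seg x i (n + 1)).dropLast = seg x i n := by
  rw [seg_succ, List.dropLast_concat]

theorem rsBound_of_complexity [Finite A] {N : ℕ}
    (h : ∀ n ≥ N, (Set.range fun i => seg x i (n + 1)).ncard ≤
      (Set.range fun i => seg x i n).ncard + 2) : RSBound x N := by
  intro m hm p q h₁ h₂ h₃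
  obtain ⟨n, rfl⟩ := Int.eq_ofNat_of_zero_le (a := m) (by omega)
  simp only [agree_iff_seg, agree_one_iff_seg] at h₁ h₂ h₃
  have hn := h n (by omega)
  set L := Set.range fun i => seg x i (n + 1) with hL
  set P := Set.range fun j => seg x (p j - n) (n + 1) with hP
  have hf := finite_range_seg x (n + 1)
  have hsub : P ⊆ L := by rintro _ ⟨j, rfl⟩; exact ⟨_, rfl⟩
  have hcard : P.ncard = 3 := by
    rw [hP, ← Set.image_univ, Set.ncard_image_of_injective, Set.ncard_univ]
    · simp
    · intro j k hjk
      by_contra hne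
      exact h₂ j k hne hjk
  have h₄ := Set.ncard_sdiff_add_ncard_of_subset hsub hf
  have h₅ : (Set.range fun i => seg x i n) ⊆ List.dropLast '' (L \ P) := by
    rintro _ ⟨i, rfl⟩
    by_cases hi : seg x i (n + 1) ∈ P
    · obtain ⟨j, hj⟩ := hi
      refine ⟨seg x (q j - n) (n + 1), ⟨⟨_, rfl⟩, ?_⟩, ?_⟩
      · rintro ⟨k, hk⟩
        exact h₃ j k hk.symm
      · rw [dropLast_seg, ← h₁, ← dropLast_seg]
        exact (congrArg List.dropLast hj).trans (dropLast_seg _ _)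
    · exact ⟨_, ⟨⟨i, rfl⟩, hi⟩, dropLast_seg _ _⟩
  have h₆ := (Set.ncard_le_ncard h₅ ((hf.subset Set.sdiff_subset).image _)).trans
    (Set.ncard_image_le (hf.subset Set.sdiff_subset))
  omega

theorem ncard_range_seg_mirror (x : ℤ → A) (n : ℕ) :
    (Set.range fun i => seg (mirror x) i n).ncard = (Set.range fun i => seg x i n).ncard := by
  rw [← Set.ncard_image_of_injective _ List.reverse_injective]
  congr 1
  ext w
  constructor
  · rintro ⟨_, ⟨i, rfl⟩, rfl⟩
    exact ⟨-i - n, by simp only; rw [seg_mirror]; simp⟩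
  · rintro ⟨i, rfl⟩
    exact ⟨_, ⟨-i - n, rfl⟩, by simp only; rw [seg_mirror]; simp⟩

/-- Large neighbourhoods of `x` recur only after a long time. -/
def Gap (x : ℤ → A) : Prop := ∀ D : ℕ, ∃ n : ℕ, ∀ p q, Agree x p q (-n) n → p < q → D < q - p

theorem Gap.mirror (h : Gap x) : Gap (mirror x) := fun D => by
  obtain ⟨n, hn⟩ := h D
  refine ⟨n, fun p q ha hpq => ?_⟩
  have := hn (-q) (-p) (by simpa using (agree_mirror.1 ha).symm) (by omega)
  omega

theorem Recurs.gap (h : Recurs x) (hper : ∀ e : ℕ, 1 ≤ e → ∃ i, x (i + e) ≠ x i) : Gap x := by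
  intro D
  induction D with
  | zero => exact ⟨0, fun p q _ _ => by push_cast; omega⟩
  | succ D ih =>
    obtain ⟨n, hn⟩ := ih
    obtain ⟨i, hi⟩ := hper (D + 1) (by omega)
    obtain ⟨R, hR⟩ := h i 0 (D + 2)
    refine ⟨max n R.toNat, fun p q ha hpq => ?_⟩
    have h₁ := hn p q (ha.mono (by omega) (by omega)) hpq
    by_contra hcon
    have e : q = p + (D + 1 : ℕ) := by push_cast at hcon ⊢; omega
    subst e
    obtain ⟨t, h₂, h₃, h₄⟩ := hR p
    refine hi ?_
    rw [h₄ (D + 1 : ℕ) (by omega) (by omega)]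
    have h₅ := h₄ 0 le_rfl (by omega)
    simp only [add_zero] at h₅
    rw [h₅]
    exact (ha.eq_at (p' := t) (q' := t + (D + 1 : ℕ)) (by ring) (by omega) (by omega)).symm

/-- There are right special words of every length. -/
theorem Gap.exists_fork (h : Gap x) (hR : Recurs x) (n : ℤ) :
    ∃ p q, Agree x p q (-n) 0 ∧ x p ≠ x q := by
  by_contra hcon
  push Not at hcon
  obtain ⟨R, hR⟩ := hR 0 (-n) 0
  obtain ⟨t, h₁, -, h₂⟩ := hR 1
  obtain ⟨n₀, hn₀⟩ := h t.toNat
  have key : ∀ k : ℕ, Agree x 0 t (-n) k := by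
    intro k
    induction k with
    | zero => exact h₂
    | succ k ih =>
      by_cases hk : -n ≤ k
      · refine ih.glue fun d h₃ h₄ => ?_
        have : d = k := by push_cast at h₄; omega
        subst this
        exact hcon _ _ (ih.at_shift (by ring) (by omega) (by omega))
      · exact fun d h₃ h₄ => absurd h₄ (by push_cast; omega)
  have := hn₀ (n₀ + n.natAbs) (t + (n₀ + n.natAbs))
    ((key (2 * n₀ + n.natAbs)).at_shift (by ring) (by omega) (by push_cast; omega)) (by omega)
  omega

end SubshiftSadic

namespace SubshiftSadic

variable {A : Type*} {x β : ℤ → A} {N lo hi : ℤ}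

/-- The properties of a point of a minimal aperiodic subshift of low complexity which are used to
desubstitute it. They are invariant under mirroring. -/
structure Good (x : ℤ → A) (N : ℤ) : Prop where
  nonneg : 0 ≤ N
  recurs : Recurs x
  gap : Gap x
  rs : RSBound x N
  ls : RSBound (mirror x) N

theorem Good.mirror (h : Good x N) : Good (mirror x) N :=
  ⟨h.nonneg, h.recurs.mirror, h.gap.mirror, h.ls, by rw [mirror_mirror]; exact h.rs⟩

/-- König's lemma: a word which is right special together with arbitrarily long extensions to the
left is a suffix of a left infinite word all of whose suffixes are right special. -/
theorem InfRS.exists_branch [Finite A] (h : InfRS x β lo hi) :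
    ∃ β' : ℤ → A, (∀ d, lo ≤ d → d < hi → β' d = β d) ∧ ∀ l, InfRS x β' l hi := by
  let _ : TopologicalSpace A := ⊥
  have _ : DiscreteTopology A := ⟨rfl⟩
  choose i i' h₁ h₂ h₃ using h
  obtain ⟨β', hβ'⟩ := exists_clusterPt_of_compactSpace
    (Filter.map (fun (m : ℕ) (d : ℤ) => x (i m + d)) Filter.atTop)
  have key : ∀ (I : Finset ℤ) (m : ℕ), ∃ k ≥ m, ∀ d ∈ I, x (i k + d) = β' d := fun I =>
    (MapClusterPt.frequently hβ' ((isOpen_cylinder I β').mem_nhds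
      fun _ _ => rfl)).forall_exists_of_atTop
  refine ⟨β', fun d hd hd' => ?_, fun l m => ?_⟩
  · obtain ⟨k, -, hk⟩ := key {d} 0
    rw [← hk d (by simp), h₁ k d hd hd']
  · obtain ⟨k, hk, hk'⟩ := key (Finset.Ico l hi) m.toNat
    exact ⟨i k, i' k, fun d hd hd' => hk' d (Finset.mem_Ico.2 ⟨hd, hd'⟩),
      (h₂ k).mono (by omega) le_rfl, h₃ k⟩

theorem RSBound.no_three_classes_left (h : RSBound (mirror x) N) {m : ℤ} (hm : N ≤ m)
    (hm0 : 0 ≤ m) {e₁ e₁' e₂ e₂' e₃ e₃' : ℤ}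
    (h₁ : Agree x e₁ e₁' 0 m) (h₁' : x (e₁ - 1) ≠ x (e₁' - 1))
    (h₂ : Agree x e₂ e₂' 0 m) (h₂' : x (e₂ - 1) ≠ x (e₂' - 1))
    (h₃ : Agree x e₃ e₃' 0 m) (h₃' : x (e₃ - 1) ≠ x (e₃' - 1))
    (h₁₂ : ¬ Agree x e₁ e₂ 0 m) (h₁₃ : ¬ Agree x e₁ e₃ 0 m)
    (h₂₃ : ¬ Agree x e₂ e₃ 0 m) : False := by
  have e : ∀ p q, Agree (mirror x) (-p) (-q) (-m) 0 ↔ Agree x p q 0 m := fun p q => by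
    rw [agree_mirror]; simp
  have e' : ∀ p, mirror x (-p) = x (p - 1) := fun p => by
    rw [mirror]; congr 1; ring
  refine h.no_three_classes hm hm0 ((e _ _).2 h₁) ?_ ((e _ _).2 h₂) ?_ ((e _ _).2 h₃) ?_
    (mt (e _ _).1 h₁₂) (mt (e _ _).1 h₁₃) (mt (e _ _).1 h₂₃) <;> rwa [e', e']

theorem Good.exists_left_special (hG : Good x N) (h : ∀ l, InfRS x β l 0) (n₀ : ℕ) :
    ∃ n ≥ n₀, ∃ i i', Occ x β (-n) 0 i ∧ Agree x i i' (-n) 0 ∧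
      x (i + (-n - 1)) ≠ x (i' + (-n - 1)) := by
  by_contra hcon
  push Not at hcon
  have key : ∀ k : ℕ, ∀ p, Occ x β (-n₀) 0 p → Occ x β (-(n₀ + k : ℕ)) 0 p := by
    intro k p hp
    induction k with
    | zero => exact hp
    | succ k ih =>
      obtain ⟨i, -, hi, -, -⟩ := h (-(n₀ + (k + 1) : ℕ)) 0
      have e : -((n₀ + (k + 1) : ℕ) : ℤ) = -(n₀ + k : ℕ) - 1 := by push_cast; ring
      rw [e] at hi ⊢
      have hi' := hi.mono (lo' := -(n₀ + k : ℕ)) (by omega) le_rfl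
      rw [occ_pred_iff (by omega)] at hi ⊢
      exact ⟨ih, by rw [← hi.2, hcon _ (by omega) i p hi' (hi'.agree ih)]⟩
  obtain ⟨p, -, hp, -, -⟩ := h (-n₀) 0
  obtain ⟨R, hR⟩ := hG.recurs p (-n₀) 0
  obtain ⟨q, hpq, -, hq⟩ := hR (p + 1)
  obtain ⟨n, hn⟩ := hG.gap (q - p).toNat
  have h₁ := (key (2 * n) p hp).agree (key (2 * n) q (hp.of_agree hq))
  have := hn (p - n) (q - n) (h₁.at_shift (by ring) (by push_cast; omega) (by omega)) (by omega)
  omega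

theorem Good.exists_infLS [Finite A] (hG : Good x N) (h : ∀ l, InfRS x β l 0) (l₀ : ℤ) :
    ∃ l ≤ l₀, InfLS x β l 0 := by
  by_contra hno
  push Not at hno
  obtain ⟨γ, hγ⟩ : ∃ γ, ∀ m, InfLS x γ 0 m := by
    have h₀ : InfRS (SubshiftSadic.mirror x) (SubshiftSadic.mirror x) 0 0 := fun m => by
      obtain ⟨p, q, h₁, h₂⟩ := hG.mirror.gap.exists_fork hG.mirror.recurs m
      exact ⟨p, q, fun d hd hd' => by omega, h₁, by simpa using h₂⟩
    obtain ⟨γ', -, hγ'⟩ := h₀.exists_branch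
    refine ⟨SubshiftSadic.mirror γ', fun m => infRS_mirror.1 ?_⟩
    rw [mirror_mirror]
    exact hγ' _
  have hβγ : ∀ n : ℕ, -n ≤ l₀ → ∀ i, Occ x β (-n) 0 i → ¬ Occ x γ 0 n (i - n) := by
    intro n hn i hi hi'
    refine hno _ hn fun m => ?_
    obtain ⟨g, g', h₁, h₂, h₃⟩ := hγ n (m + n)
    refine ⟨g + n, g' + n, hi.of_agree ?_, h₂.at_shift (by ring) (by omega) (by omega), ?_⟩
    · exact (hi'.agree h₁).at_shift (by ring) (by omega) (by omega)
    · convert h₃ using 2 <;> ring_nf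
  obtain ⟨m₀, hm₀⟩ : ∃ m₀ : ℕ, ∀ m : ℕ, ∀ i, Occ x γ 0 m₀ i →
      ∃ j, Occ x γ 0 m j ∧ x (j - 1) = x (i - 1) := by
    have : ∀ a, ∃ m₀ : ℕ, ∀ i, Occ x γ 0 m₀ i → x (i - 1) = a →
        ∀ m : ℕ, ∃ j, Occ x γ 0 m j ∧ x (j - 1) = a := fun a => by
      by_cases hm : ∀ m : ℕ, ∃ j, Occ x γ 0 m j ∧ x (j - 1) = a
      · exact ⟨0, fun _ _ _ => hm⟩
      · push Not at hm
        obtain ⟨m, hm⟩ := hm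
        exact ⟨m, fun i hi hi' => absurd hi' (hm i hi)⟩
    choose μ hμ using this
    obtain ⟨m₀, hm₀⟩ := (Set.finite_range μ).bddAbove
    exact ⟨m₀, fun m i hi => hμ _ i
      (hi.mono le_rfl (by exact_mod_cast hm₀ ⟨_, rfl⟩)) rfl m⟩
  obtain ⟨n₁, hn₁, i₁, i₁', a₁, a₂, a₃⟩ :=
    hG.exists_left_special h (max m₀ (max N.toNat (-l₀).toNat))
  obtain ⟨m, hm⟩ : ∃ m, ∀ i i', Occ x β (-n₁) 0 i → Agree x i i' (-n₁) m →
      x (i + (-n₁ - 1)) = x (i' + (-n₁ - 1)) := by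
    have := hno (-n₁) (by omega)
    simp only [InfLS] at this
    push Not at this
    exact this
  obtain ⟨n₂, hn₂, i₂, i₂', b₁, b₂, b₃⟩ := hG.exists_left_special h (n₁ + m.toNat + 1)
  obtain ⟨g, g', c₁, c₂, c₃⟩ := hγ n₁ n₁
  set s₂ := i₂ - n₂ with hs₂
  set s₂' := i₂' - n₂ with hs₂'
  have hA : Agree x s₂ s₂' 0 n₂ := b₂.at_shift (by omega) (by omega) (by omega)
  have hA' : x (s₂ - 1) ≠ x (s₂' - 1) := by convert b₃ using 2 <;> omega
  have hP : Occ x γ 0 n₁ s₂ := by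
    by_contra hP
    refine hG.ls.no_three_classes_left (m := n₁) (by omega) (by omega)
      (e₁ := i₁ - n₁) (e₁' := i₁' - n₁) (e₂ := s₂) (e₂' := s₂') (e₃ := g) (e₃' := g')
      (a₂.at_shift (by omega) (by omega) (by omega)) (by convert a₃ using 2 <;> omega)
      (hA.mono le_rfl (by omega)) hA' c₂ (by simpa [← sub_eq_add_neg] using c₃) (fun hh => ?_) (fun hh => ?_)
      (fun hh => hP (c₁.of_agree hh.symm))
    · have ho : Occ x β (-n₁) 0 (s₂ + n₁) :=
        a₁.of_agree (hh.at_shift (by omega) (by omega) (by omega))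
      refine b₃ ?_
      convert hm _ (s₂' + n₁) ho (b₂.at_shift (by omega) (by omega) (by omega)) using 2 <;> omega
    · exact hβγ n₁ (by omega) i₁ a₁ (c₁.of_agree hh.symm)
  have hex : ∃ k : ℕ, ¬ Occ x γ 0 k s₂ := ⟨n₂, hβγ n₂ (by omega) i₂ b₁⟩
  obtain ⟨s, h₁, h₂, hs, hs'⟩ : ∃ s : ℕ, n₁ ≤ s ∧ s < n₂ ∧ Occ x γ 0 s s₂ ∧ x (s₂ + s) ≠ γ s := by
    classical
    have k₁ := Nat.find_spec hex
    have k₂ : n₁ < Nat.find hex := by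
      by_contra hlt
      exact k₁ (hP.mono le_rfl (by omega))
    have k₃ : Occ x γ 0 (Nat.find hex - 1 : ℕ) s₂ := by
      by_contra hlt
      exact Nat.find_min hex (by omega) hlt
    have k₄ : Nat.find hex ≤ n₂ := Nat.find_min' hex (hβγ n₂ (by omega) i₂ b₁)
    refine ⟨Nat.find hex - 1, by omega, by omega, k₃, fun he => k₁ fun d hd hd' => ?_⟩
    by_cases hd'' : d < (Nat.find hex - 1 : ℕ)
    · exact k₃ d hd hd''
    · have : d = (Nat.find hex - 1 : ℕ) := by omega
      rw [this, he]
  have hs₃ : Occ x γ 0 s s₂' := hs.of_agree (hA.mono le_rfl (by omega))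
  obtain ⟨j, hj, hj'⟩ := hm₀ (s + 1) s₂ (hs.mono le_rfl (by omega))
  obtain ⟨k, hk, hk'⟩ := hm₀ (s + 1) s₂' (hs₃.mono le_rfl (by omega))
  have hRS : ∀ {t t'}, Occ x γ 0 s t → Occ x γ 0 (s + 1 : ℕ) t' → x (t' - 1) = x (t - 1) →
      Agree x (t + s) (t' + s) (-(s + 1 : ℕ)) 0 := by
    intro t t' ht ht' he d hd hd'
    by_cases hd'' : d = -(s + 1 : ℕ)
    · convert he.symm using 2 <;> (push_cast at hd''; omega)
    · exact (ht.agree (ht'.mono le_rfl (by omega))).eq_at (by ring) (by omega) (by omega)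
  obtain ⟨u, u', d₁, d₂, d₃⟩ := h (-(s + 1 : ℕ)) (s + 1 : ℕ)
  have hU : ∀ {t}, Occ x γ 0 s t → ¬ Agree x (t + s) u (-(s + 1 : ℕ)) 0 := fun ht hh => by
    refine hβγ s (by omega) (_ + s) ((d₁.of_agree hh.symm).mono (by omega) le_rfl) ?_
    simpa using ht
  have hs₂γ : x (j + s) = γ s := hj s (by omega) (by omega)
  have hs₂γ' : x (k + s) = γ s := hk s (by omega) (by omega)
  refine hG.rs.no_three_classes (m := (s + 1 : ℕ)) (by omega) (by omega) (hRS hs hj hj')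
    (by rwa [hs₂γ]) (hRS hs₃ hk hk') ?_ d₂ (by simpa using d₃) (fun hh => hA' ?_) (hU hs) (hU hs₃)
  · rw [hs₂γ', ← hA s (by omega) (by omega)]; exact hs'
  · exact hh.eq_at (by omega) (by push_cast; omega) (by omega)

theorem Good.exists_infLS_of_branch [Finite A] (hG : Good x N) (h : ∀ l, InfRS x β l hi)
    (l₀ : ℤ) : ∃ l ≤ l₀, InfLS x β l hi := by
  obtain ⟨l, h₁, h₂⟩ := hG.exists_infLS (β := fun d => β (d + hi)) (fun l => by
    have := (infRS_translate (β := β) (lo := l + hi) (hi := hi) hi).2 (h _)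
    simpa using this) (l₀ - hi)
  refine ⟨l + hi, by omega, fun m => ?_⟩
  obtain ⟨i, i', h₃, h₄, h₅⟩ := h₂ (m - hi)
  refine ⟨i - hi, i' - hi, (occ_translate hi).1 (by simpa using h₃),
    h₄.at_shift (by ring) (by omega) (by omega), ?_⟩
  convert h₅ using 2 <;> ring_nf

end SubshiftSadic

namespace SubshiftSadic

namespace RState

variable {A L : Type*} {x β : ℤ → A} {lo N : ℤ} {c : ℤ → ℤ} {y : ℤ → L}

/-- The occurrences `c k` and `c k'` are followed by words which differ for the first time after
`d` letters, before the next occurrence. -/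
def Fork (x : ℤ → A) (lo : ℤ) (c : ℤ → ℤ) (k k' d : ℤ) : Prop :=
  0 ≤ d ∧ c k + d < c (k + 1) ∧ c k' + d < c (k' + 1) ∧ Agree x (c k) (c k') lo d ∧
    x (c k + d) ≠ x (c k' + d)

theorem Fork.pos {k k' d : ℤ} (h : Fork x lo c k k' d) (hx : x (c k) = x (c k')) : 0 < d := by
  refine lt_of_le_of_ne h.1 fun hd => h.2.2.2.2 ?_
  rw [← hd]; simpa using hx

theorem Fork.not_occ (h : RState x β lo 0 c y) {k k' d : ℤ} (hf : Fork x lo c k k' d)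
    {e : ℤ} (h₀ : 0 < e) (h₁ : e ≤ d) : ¬ Occ x β lo 0 (c k + e) := fun ho => by
  obtain ⟨j, hj⟩ := (h.occ _).1 ho
  have := h.succ_le (k := k) (j := j) (by omega)
  have := hf.2.1
  omega

theorem Fork.at_end {k k' d l : ℤ} (h : Fork x lo c k k' d) (hl : lo ≤ d - l) :
    Agree x (c k + d) (c k' + d) (-l) 0 :=
  h.2.2.2.1.at_shift (by ring) (by omega) (by omega)

theorem Fork.unique (h : RState x β lo 0 c y) (hlo : lo ≤ 0) (hN : RSBound x N) (hn : N ≤ -lo)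
    (hI : InfRS x β lo 0) {k k' d j j' d' : ℤ} (hf : Fork x lo c k k' d)
    (hf' : Fork x lo c j j' d') (hd : 0 < d) (hd' : 0 < d') :
    d = d' ∧ Agree x (c k) (c j) lo d := by
  have key : ∀ {k k' d j j' d' : ℤ}, Fork x lo c k k' d → Fork x lo c j j' d' → 0 < d → d ≤ d' →
      d = d' ∧ Agree x (c k) (c j) lo d := by
    intro k k' d j j' d' hf hf' hd hdd
    obtain ⟨p, p', h₁, h₂, h₃⟩ := hI (d - lo)
    have ha : Agree x (c k + d) (c j + d') (-(d - lo)) 0 := by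
      by_contra ha
      refine hN.no_three_classes (m := d - lo) (by omega) (by omega) (hf.at_end (by omega))
        hf.2.2.2.2 (hf'.at_end (by omega)) hf'.2.2.2.2 h₂ (by simpa using h₃) ha
        (fun hh => ?_) (fun hh => ?_)
      · exact hf.not_occ h hd le_rfl (h₁.of_agree (hh.symm.mono (by omega) le_rfl))
      · exact hf'.not_occ h (by omega) le_rfl
          (h₁.of_agree (hh.symm.mono (by omega) le_rfl))
    have ho := ((h.occ _).2 ⟨k, rfl⟩).of_agree
      (ha.at_shift (p' := c k) (q' := c j + (d' - d)) (by ring) (by omega) (by omega))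
    obtain rfl : d = d' := by
      by_contra hne
      exact hf'.not_occ h (by omega) (by omega) ho
    exact ⟨rfl, ha.at_shift (by ring) (by omega) (by omega)⟩
  rcases le_total d d' with hdd | hdd
  · exact key hf hf' hd hdd
  · obtain ⟨rfl, h₁⟩ := key hf' hf hd' hdd
    exact ⟨rfl, h₁.symm⟩

/-- No four return words are pairwise distinct if two of them start with the same letter. -/
theorem false_of_four_aux (h : RState x β lo 0 c y) (hlo : lo ≤ 0) (hN : RSBound x N)
    (hn : N ≤ -lo) (hI : InfRS x β lo 0) {k₀ k₁ k₂ k₃ : ℤ} (h₀₁ : y k₀ ≠ y k₁) (h₀₂ : y k₀ ≠ y k₂)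
    (h₀₃ : y k₀ ≠ y k₃) (h₁₂ : y k₁ ≠ y k₂) (h₁₃ : y k₁ ≠ y k₃) (h₂₃ : y k₂ ≠ y k₃)
    (hx : x (c k₀) = x (c k₁)) : False := by
  have hfork : ∀ {k k'}, y k ≠ y k' → ∃ d, Fork x lo c k k' d := fun {k k'} hk => by
    obtain ⟨d, hd⟩ := h.fork (m := -lo) (by omega) (by simpa using h.agree k k') hk
    rw [neg_neg] at hd
    exact ⟨d, hd⟩
  obtain ⟨d, hd⟩ := hfork h₀₁
  have hpos := hd.pos hx
  have key : ∀ {k}, y k₀ ≠ y k → y k₁ ≠ y k → x (c k₀) ≠ x (c k) := by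
    intro k hk₀ hk₁ hxk
    obtain ⟨d', hd'⟩ := hfork hk₀
    obtain ⟨d'', hd''⟩ := hfork hk₁
    obtain ⟨rfl, -⟩ := hd.unique h hlo hN hn hI hd' hpos (hd'.pos hxk)
    obtain ⟨rfl, -⟩ := hd.unique h hlo hN hn hI hd'' hpos (hd''.pos (hx.symm.trans hxk))
    obtain ⟨p, p', g₁, g₂, g₃⟩ := hI (d - lo)
    refine hN.no_three_letters (m := d - lo) (by omega) (by omega) (hd'.at_end (by omega))
      (hd''.at_end (by omega)) hd.2.2.2.2 hd'.2.2.2.2 hd''.2.2.2.2 g₂ (by simpa using g₃)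
      fun hh => ?_
    exact hd.not_occ h hpos le_rfl (g₁.of_agree (hh.symm.mono (by omega) le_rfl))
  have h₂ := key h₀₂ h₁₂
  have h₃ := key h₀₃ h₁₃
  have h₄ : x (c k₂) ≠ x (c k₃) := fun he => by
    obtain ⟨d', hd'⟩ := hfork h₂₃
    obtain ⟨-, ha⟩ := hd.unique h hlo hN hn hI hd' hpos (hd'.pos he)
    exact h₂ (ha.eq_at (by ring) (by omega) (by omega))
  refine hN.no_three_letters (m := -lo) (by omega) (by omega) (e₁ := c k₀) (e₂ := c k₂)
    (e₃ := c k₃) (by simpa using h.agree _ _) (by simpa using h.agree _ _) h₂ h₃ h₄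
    (hd.at_end (by omega)) hd.2.2.2.2 fun hh => ?_
  exact hd.not_occ h hpos le_rfl
    (((h.occ _).2 ⟨k₀, rfl⟩).of_agree (by simpa using hh))

theorem false_of_four (h : RState x β lo 0 c y) (hlo : lo ≤ 0) (hN : RSBound x N)
    (hn : N ≤ -lo) (hI : InfRS x β lo 0) {k₀ k₁ k₂ k₃ : ℤ} (h₀₁ : y k₀ ≠ y k₁) (h₀₂ : y k₀ ≠ y k₂)
    (h₀₃ : y k₀ ≠ y k₃) (h₁₂ : y k₁ ≠ y k₂) (h₁₃ : y k₁ ≠ y k₃) (h₂₃ : y k₂ ≠ y k₃) : False := by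
  have aux := fun {k₀ k₁ k₂ k₃} => h.false_of_four_aux hlo hN hn hI (k₀ := k₀) (k₁ := k₁)
    (k₂ := k₂) (k₃ := k₃)
  have ha : ∀ k k', Agree x (c k) (c k') (- -lo) 0 := by simpa using h.agree
  refine hN.no_four_letters (m := -lo) (by omega) (by omega) (ha k₀ k₃) (ha k₁ k₃) (ha k₂ k₃)
    (aux h₀₁ h₀₂ h₀₃ h₁₂ h₁₃ h₂₃) (aux h₀₂ h₀₁ h₀₃ h₁₂.symm h₂₃ h₁₃)
    (aux h₁₂ h₀₁.symm h₁₃ h₀₂.symm h₂₃ h₀₃) (aux h₀₃ h₀₁ h₀₂ h₁₃.symm h₂₃.symm h₁₂)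
    (aux h₁₃ h₀₁.symm h₁₂ h₀₃.symm h₂₃.symm h₀₂) (aux h₂₃ h₀₂.symm h₁₂.symm h₀₃.symm h₁₃.symm h₀₁)

/-- There are at most three return words, and they can be labelled by three letters. -/
theorem exists_letters (h : RState x β lo 0 c y) (hlo : lo ≤ 0) (hN : RSBound x N)
    (hn : N ≤ -lo) (hI : InfRS x β lo 0) : ∃ y' : ℤ → ABC, RState x β lo 0 c y' := by
  suffices ∃ y' : ℤ → ABC, ∀ k k', y' k = y' k' ↔ y k = y k' by
    obtain ⟨y', hy'⟩ := this
    exact ⟨y', h.occ, h.mono, fun k k' => (hy' k k').trans (h.label k k')⟩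
  classical
  obtain ⟨k₁, k₂, hk⟩ : ∃ k₁ k₂, ∀ k, y k = y 0 ∨ y k = y k₁ ∨ y k = y k₂ := by
    by_contra hcon
    push Not at hcon
    obtain ⟨k₁, h₁, -⟩ := hcon 0 0
    obtain ⟨k₂, h₂, h₃, -⟩ := hcon k₁ k₁
    obtain ⟨k₃, h₄, h₅, h₆⟩ := hcon k₁ k₂
    exact h.false_of_four hlo hN hn hI h₁.symm h₂.symm h₄.symm h₃.symm h₅.symm h₆.symm
  refine ⟨fun k => if y k = y 0 then .a else if y k = y k₁ then .b else .c, fun k k' => ?_⟩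
  have h₁ := hk k
  have h₂ := hk k'
  dsimp only
  split_ifs <;> simp_all <;> grind

end RState

variable {A : Type*} {x β : ℤ → A} {lo N : ℤ}

theorem exists_rState (hG : Good x N) (hlo : lo ≤ 0) (hn : N ≤ -lo) (hI : InfRS x β lo 0) :
    ∃ (c : ℤ → ℤ) (y : ℤ → ABC), RState x β lo 0 c y := by
  obtain ⟨p, -, hp, -, -⟩ := hI 0
  obtain ⟨R, hR⟩ := hG.recurs p lo 0
  obtain ⟨c, hc, hc'⟩ := exists_strictMono_enum {i | Occ x β lo 0 i}
    (fun q => let ⟨t, h₁, _, h₃⟩ := hR q; ⟨t, hp.of_agree h₃, h₁⟩)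
    (fun q => let ⟨t, _, h₂, h₃⟩ := hR (q - R); ⟨t, hp.of_agree h₃, by omega⟩)
  simp only [Set.mem_ofPred_eq] at hc'
  have h : RState x β lo 0 c fun k => seg x (c k) (c (k + 1) - c k).toNat := by
    refine ⟨hc', hc, fun k k' => ?_⟩
    have h₁ := hc (show k < k + 1 by omega)
    have h₂ := hc (show k' < k' + 1 by omega)
    constructor
    · intro he
      have h₃ := congrArg List.length he
      simp only [length_seg] at h₃
      rw [← h₃, seg_eq_seg_iff] at he
      refine ⟨by omega, (((hc' _).2 ⟨k, rfl⟩).agree ((hc' _).2 ⟨k', rfl⟩)).glue fun d h₄ h₅ => ?_⟩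
      simpa [h₄] using he d.toNat (by omega)
    · rintro ⟨h₃, h₄⟩
      rw [← h₃, seg_eq_seg_iff]
      exact fun d hd => h₄ d (by omega) (by omega)
  exact ⟨c, h.exists_letters hlo hG.rs hn hI⟩

theorem RState.expands {c : ℤ → ℤ} {y : ℤ → ABC} (h : RState x β lo 0 c y) (hlo : lo ≤ 0) :
    ∃ φ : ABC → List A, Expands φ c y x := by
  classical
  refine ⟨fun t => if ht : ∃ k, y k = t then
    seg x (c ht.choose) (c (ht.choose + 1) - c ht.choose).toNat else [], fun k => ?_⟩
  have ht : ∃ j, y j = y k := ⟨k, rfl⟩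
  obtain ⟨h₁, h₂⟩ := (h.label _ _).1 ht.choose_spec
  have := h.lt_succ k
  simp only [dif_pos ht, length_seg]
  refine ⟨by omega, ?_⟩
  rw [seg_eq_seg_iff]
  exact fun d hd => (h₂ d (by omega) (by omega)).symm

end SubshiftSadic

namespace SubshiftSadic

variable {A : Type*} {x β : ℤ → A} {lo hi N : ℤ} {c : ℤ → ℤ} {y : ℤ → ABC}

theorem RState.congr {β' : ℤ → A} (h : RState x β lo hi c y)
    (he : ∀ d, lo ≤ d → d < hi → β' d = β d) : RState x β' lo hi c y where
  occ i := by
    rw [← h.occ]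
    exact ⟨fun ho d h₁ h₂ => (ho d h₁ h₂).trans (he d h₁ h₂),
      fun ho d h₁ h₂ => (ho d h₁ h₂).trans (he d h₁ h₂).symm⟩
  mono := h.mono
  label := h.label

theorem RState.left_step_of_le (h : RState x β lo hi c y) (hlo : lo ≤ hi) (hN : RSBound x N)
    (hn : N ≤ hi - lo) (hI : InfRS x β (lo - 1) hi) (hR : Recurs x) :
    ∃ c' y' y₁, RState x β (lo - 1) hi c' y' ∧ Path c y c y₁ ∧ Path c y₁ c' y' ∧ Loc x c y₁ ∧
      ((∀ k, ∃ j, c' j = c k) ∨ ∀ t, ∃ k, y₁ k = t) := by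
  have h₁ := h.translate hi
  have h₂ := (infRS_translate hi).2 hI
  rw [sub_self] at h₁ h₂
  rw [show lo - 1 - hi = lo - hi - 1 by ring] at h₂
  obtain ⟨c', y', y₁, g₁, g₂, g₃, g₄, g₅⟩ := h₁.left_step (by omega) hN (by omega) h₂ hR
  refine ⟨fun k => c' k + -hi, y', y₁, ?_, ?_, ?_, ?_, ?_⟩
  · have := g₁.translate (-hi)
    simpa [show lo - hi - 1 + hi = lo - 1 by ring] using this
  · simpa using g₂.translate (-hi)
  · simpa using g₃.translate (-hi)
  · simpa using g₄.translate (-hi)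
  · refine g₅.imp_left fun g k => ?_
    obtain ⟨j, hj⟩ := g k
    exact ⟨j, by simp only; omega⟩

/-- A level of the desubstitution which is recognizable and uses all three letters. -/
structure Full (x : ℤ → A) (c : ℤ → ℤ) (y : ℤ → ABC) : Prop where
  mono : StrictMono c
  loc : Loc x c y
  surj : ∀ t, ∃ k, y k = t

theorem Path.exists_eq {c' : ℤ → ℤ} {y' : ℤ → ABC} (h : Path c y c' y') (k : ℤ) :
    ∃ j, c j = c' k := by
  obtain ⟨_, _, g, hg, -⟩ := h
  exact ⟨g k, (hg k).symm⟩

theorem RState.left_steps (h : RState x β lo hi c y) (hlo : lo ≤ hi) (hG : Good x N)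
    (hn : N ≤ hi - lo) (hI : ∀ l, InfRS x β l hi) (n : ℕ) :
    ∃ c' y', RState x β (lo - n) hi c' y' ∧ Path c y c' y' ∧ ((∀ k, ∃ j, c' j = c k) ∨
      ∃ c₁ y₁, Full x c₁ y₁ ∧ Path c y c₁ y₁ ∧ Path c₁ y₁ c' y') := by
  induction n with
  | zero => exact ⟨c, y, by simpa using h, .refl _ _, Or.inl fun k => ⟨k, rfl⟩⟩
  | succ n ih =>
    obtain ⟨c', y', h₁, h₂, h₃⟩ := ih
    obtain ⟨c'', y'', y₁, g₁, g₂, g₃, g₄, g₅⟩ := h₁.left_step_of_le (by omega) hG.rs (by omega)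
      (hI _) hG.recurs
    rw [show lo - n - 1 = lo - (n + 1 : ℕ) by push_cast; ring] at g₁
    refine ⟨c'', y'', g₁, h₂.trans (g₂.trans g₃), ?_⟩
    rcases h₃ with h₃ | ⟨c₁, y₂, h₃, h₄, h₅⟩
    · rcases g₅ with g₅ | g₅
      · refine Or.inl fun k => ?_
        obtain ⟨j, hj⟩ := h₃ k
        obtain ⟨i, hi⟩ := g₅ j
        exact ⟨i, hi.trans hj⟩
      · exact Or.inr ⟨c', y₁, ⟨h₁.mono, g₄, g₅⟩, h₂.trans g₂, g₃⟩
    · exact Or.inr ⟨c₁, y₂, h₃, h₄, h₅.trans (g₂.trans g₃)⟩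

theorem RState.exists_full_left [Finite A] (h : RState x β lo hi c y) (hlo : lo ≤ hi)
    (hG : Good x N) (hn : N ≤ hi - lo) (hI : InfRS x β lo hi) :
    ∃ (β' : ℤ → A) (lo' : ℤ) (c' : ℤ → ℤ) (y' : ℤ → ABC) (c₁ : ℤ → ℤ) (y₁ : ℤ → ABC),
      lo' ≤ lo - 1 ∧ RState x β' lo' hi c' y' ∧ InfLS x β' lo' hi ∧ Full x c₁ y₁ ∧
      Path c y c₁ y₁ ∧ Path c₁ y₁ c' y' := by
  obtain ⟨β', he, hβ'⟩ := hI.exists_branch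
  obtain ⟨n, hgap⟩ := hG.gap (c 1 - c 0).toNat
  obtain ⟨lo', hlo', hL⟩ := hG.exists_infLS_of_branch hβ' (min (lo - 1) (hi - 2 * n))
  obtain ⟨c', y', h₁, -, h₂⟩ := (h.congr he).left_steps hlo hG hn hβ' (lo - lo').toNat
  rw [show lo - ((lo - lo').toNat : ℤ) = lo' by omega] at h₁
  rcases h₂ with h₂ | ⟨c₁, y₁, h₂, h₃, h₄⟩
  · exfalso
    have hc := h.mono (show (0 : ℤ) < 1 by omega)
    obtain ⟨j, hj⟩ := h₂ 0
    obtain ⟨j', hj'⟩ := h₂ 1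
    have ha := ((h₁.occ _).2 ⟨j, hj⟩).agree ((h₁.occ _).2 ⟨j', hj'⟩)
    have := hgap (c 0 + (hi - n)) (c 1 + (hi - n))
      (ha.at_shift (by ring) (by omega) (by omega)) (by omega)
    omega
  · exact ⟨β', lo', c', y', c₁, y₁, by omega, h₁, hL, h₂, h₃, h₄⟩

theorem RState.exists_full_right [Finite A] (h : RState x β lo hi c y) (hlo : lo ≤ hi)
    (hG : Good x N) (hn : N ≤ hi - lo) (hI : InfLS x β lo hi) :
    ∃ (β' : ℤ → A) (hi' : ℤ) (c' : ℤ → ℤ) (y' : ℤ → ABC), hi + 1 ≤ hi' ∧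
      RState x β' lo hi' c' y' ∧ InfRS x β' lo hi' ∧ Path c y c' y' := by
  obtain ⟨β', lo', c', y', c₁, y₁, h₁, h₂, h₃, -, h₄, h₅⟩ :=
    h.mirror.exists_full_left (by omega) hG.mirror (by omega) (infRS_mirror.2 hI)
  refine ⟨SubshiftSadic.mirror β', -lo', mirrorCut c', SubshiftSadic.mirror y', by omega, ?_, ?_,
    ?_⟩
  · simpa [mirror_mirror] using h₂.mirror
  · rw [← infLS_mirror]
    simpa [mirror_mirror] using h₃
  · simpa [mirror_mirror, mirrorCut_mirrorCut] using (h₄.trans h₅).mirror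

theorem RState.exists_full [Finite A] (h : RState x β lo hi c y) (hlo : lo ≤ hi)
    (hG : Good x N) (hn : N ≤ hi - lo) (hI : InfRS x β lo hi) :
    ∃ (β' : ℤ → A) (lo' hi' : ℤ) (c' : ℤ → ℤ) (y' : ℤ → ABC) (c₁ : ℤ → ℤ) (y₁ : ℤ → ABC),
      lo' ≤ lo - 1 ∧ hi + 1 ≤ hi' ∧ RState x β' lo' hi' c' y' ∧ InfRS x β' lo' hi' ∧
      Full x c₁ y₁ ∧ Path c y c₁ y₁ ∧ Path c₁ y₁ c' y' := by
  obtain ⟨β', lo', c', y', c₁, y₁, h₁, h₂, h₃, h₄, h₅, h₆⟩ := h.exists_full_left hlo hG hn hI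
  obtain ⟨β'', hi', c'', y'', g₁, g₂, g₃, g₄⟩ :=
    h₂.exists_full_right (by omega) hG (by omega) h₃
  exact ⟨β'', lo', hi', c'', y'', c₁, y₁, h₁, g₁, g₂, g₃, h₄, h₅, h₆.trans g₄⟩

/-- The data of a labelled sequence of return words to an infinitely right special word. -/
structure Stage (x : ℤ → A) (N : ℤ) where
  β : ℤ → A
  lo : ℤ
  hi : ℤ
  c : ℤ → ℤ
  y : ℤ → ABC
  le : lo ≤ hi
  large : N ≤ hi - lo
  state : RState x β lo hi c y
  infRS : InfRS x β lo hi

theorem exists_full_sequence [Finite A] (hG : Good x N) :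
    ∃ (φ : ABC → List A) (c : ℕ → ℤ → ℤ) (y : ℕ → ℤ → ABC), Expands φ (c 0) (y 0) x ∧
      ∀ n : ℕ, Full x (c n) (y n) ∧ (∀ k k', Agree x (c n k) (c n k') (-n) n) ∧
        Path (c n) (y n) (c (n + 1)) (y (n + 1)) := by
  have h₀ : InfRS x x 0 0 := fun m => by
    obtain ⟨p, q, h₁, h₂⟩ := hG.gap.exists_fork hG.recurs m
    exact ⟨p, q, fun d hd hd' => by omega, h₁, by simpa using h₂⟩
  obtain ⟨β, -, hβ⟩ := h₀.exists_branch
  have hN := hG.nonneg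
  obtain ⟨c, y, h⟩ := exists_rState hG (lo := -N) (by omega) (by omega) (hβ _)
  obtain ⟨φ, hφ⟩ := h.expands (by omega)
  have step : ∀ S : Stage x N, ∃ (S' : Stage x N) (c₁ : ℤ → ℤ) (y₁ : ℤ → ABC),
      S'.lo ≤ S.lo - 1 ∧ S.hi + 1 ≤ S'.hi ∧ Full x c₁ y₁ ∧ Path S.c S.y c₁ y₁ ∧
        Path c₁ y₁ S'.c S'.y := fun S => by
    have hle := S.le
    have hla := S.large
    obtain ⟨β', lo', hi', c', y', c₁, y₁, h₁, h₂, h₃, h₄, h₅, h₆, h₇⟩ :=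
      S.state.exists_full hle hG hla S.infRS
    exact ⟨⟨β', lo', hi', c', y', by omega, by omega, h₃, h₄⟩, c₁, y₁, h₁, h₂, h₅, h₆, h₇⟩
  choose next cF yF h₁ h₂ h₃ h₄ h₅ using step
  let S : ℕ → Stage x N := fun n => Nat.rec
    ⟨β, -N, 0, c, y, by omega, by omega, h, hβ _⟩ (fun _ S => next S) n
  have hS : ∀ n, (S n).lo ≤ -n ∧ n ≤ (S n).hi := fun n => by
    induction n with
    | zero => exact ⟨by change -N ≤ _; push_cast; omega, le_rfl⟩
    | succ n ih =>
      have g₁ := h₁ (S n)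
      have g₂ := h₂ (S n)
      refine ⟨?_, ?_⟩ <;> simp only [S] at ih g₁ g₂ ⊢ <;> push_cast <;> omega
  obtain ⟨τ, -, g, hg, he⟩ := h₄ (S 0)
  refine ⟨fun t => wordApply φ (τ t), fun n => cF (S n), fun n => yF (S n), ?_,
    fun n => ⟨h₃ _, fun k k' => ?_, ?_⟩⟩
  · have := hφ.comp he
    rwa [show (fun k => c (g k)) = cF (S 0) from (funext hg).symm] at this
  · obtain ⟨j, hj⟩ := (h₄ (S n)).exists_eq k
    obtain ⟨j', hj'⟩ := (h₄ (S n)).exists_eq k'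
    obtain ⟨g₁, g₂⟩ := hS n
    exact (((S n).state.occ _).2 ⟨j, hj⟩).agree (((S n).state.occ _).2 ⟨j', hj'⟩) |>.mono g₁ g₂
  · exact (h₅ (S n)).trans (h₄ (next (S n)))

end SubshiftSadic

namespace SubshiftSadic

section Blocks

variable {B C : Type*} {σ : B → List C} {g : ℤ → ℤ} {y : ℤ → B} {z : ℤ → C}

theorem add_natCast_le_of_strictMono (hg : StrictMono g) (k : ℤ) (n : ℕ) :
    g k + n ≤ g (k + n) := by
  induction n with
  | zero => simp
  | succ n ih =>
    have := hg (show k + n < k + (n + 1 : ℕ) by push_cast; omega)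
    push_cast at this ⊢
    omega

theorem add_le_of_strictMono (hg : StrictMono g) {k k' : ℤ} (h : k ≤ k') :
    g k + (k' - k) ≤ g k' := by
  have := add_natCast_le_of_strictMono hg k (k' - k).toNat
  rw [show k + ((k' - k).toNat : ℤ) = k' by omega] at this
  omega

theorem exists_block (hg : StrictMono g) (m : ℤ) : ∃ k, g k ≤ m ∧ m < g (k + 1) := by
  obtain ⟨k, hk, hmax⟩ := Int.exists_greatest_of_bdd (P := fun k => g k ≤ m)
    ⟨|m - g 0|, fun k hk => by
      by_contra! h
      have h₁ := abs_nonneg (m - g 0)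
      have h₂ := add_le_of_strictMono hg (show 0 ≤ k by omega)
      have h₃ := le_abs_self (m - g 0)
      omega⟩
    ⟨-|m - g 0|, by
      have h₁ := abs_nonneg (m - g 0)
      have h₂ := add_le_of_strictMono hg (show -|m - g 0| ≤ 0 by omega)
      have h₃ := neg_abs_le (m - g 0)
      omega⟩
  refine ⟨k, hk, ?_⟩
  by_contra! h
  have := hmax _ h
  omega

theorem Expands.strictMono (h : Expands σ g y z) (hσ : ∀ k, σ (y k) ≠ []) : StrictMono g :=
  strictMono_int_of_lt_succ fun k => by
    have := List.length_pos_iff.2 (hσ k)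
    have := (h k).1
    omega

theorem Expands.ne_nil (h : Expands σ g y z) (hg : StrictMono g) (k : ℤ) : σ (y k) ≠ [] := by
  have h₁ := (h k).1
  have h₂ := hg (show k < k + 1 by omega)
  exact List.length_pos_iff.1 (by omega)

theorem Expands.seg_infix (h : Expands σ g y z) (hg : StrictMono g) (i : ℤ) (m : ℕ) :
    ∃ p n, seg z i m <:+: wordApply σ (seg y p n) := by
  obtain ⟨p, hp, -⟩ := exists_block hg i
  obtain ⟨q, -, hq⟩ := exists_block hg (i + m)
  have hpq : p < q + 1 := hg.lt_iff_lt.1 (by omega)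
  obtain ⟨n, hn⟩ : ∃ n : ℕ, q + 1 = p + n := ⟨(q + 1 - p).toNat, by omega⟩
  refine ⟨p, n, ?_⟩
  have := h.add p n
  rw [← h.seg_eq]
  rw [hn] at hq
  exact SubshiftSadic.seg_infix hp (by omega)

theorem Expands.agree {g' : ℤ → ℤ} {y' : ℤ → B} {z' : ℤ → C} (h : Expands σ g y z)
    (h' : Expands σ g' y' z') (hg : StrictMono g) {k k' : ℤ} {n : ℕ}
    (hy : seg y (k - n) (n + n) = seg y' (k' - n) (n + n)) :
    ∀ d, -(n : ℤ) ≤ d → d < n → z (g k + d) = z' (g' k' + d) := by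
  have h₁ := h.seg_eq (k - n) (n + n)
  have h₂ := h'.seg_eq (k' - n) (n + n)
  rw [← hy, ← h₁] at h₂
  rw [length_seg, seg_eq_seg_iff] at h₂
  rw [seg_add, seg_add] at hy
  obtain ⟨hy₁, -⟩ := List.append_inj hy (by simp)
  have e₁ := h.add (k - n) n
  have e₂ := h'.add (k' - n) n
  have e₃ := h.add (k - n) (n + n)
  rw [sub_add_cancel] at e₁ e₂
  rw [← hy₁] at e₂
  have b₁ := add_natCast_le_of_strictMono hg (k - n) n
  have b₂ := add_natCast_le_of_strictMono hg k n
  rw [sub_add_cancel] at b₁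
  rw [show k - n + ((n + n : ℕ) : ℤ) = k + n by push_cast; ring] at e₃
  intro d hd₁ hd₂
  have := h₂ (g k - g (k - n) + d).toNat (by omega)
  rw [show g (k - n) + ((g k - g (k - n) + d).toNat : ℤ) = g k + d by omega,
    show g' (k' - n) + ((g k - g (k - n) + d).toNat : ℤ) = g' k' + d by omega] at this
  exact this.symm

theorem Expands.factor {A : Type*} {f : B → List C} {σ : A → List B} {γ : ℤ → ℤ} {y : ℤ → A}
    {w : ℤ → C} (h : Expands (fun t => wordApply f (σ t)) γ y w) (hσ : ∀ t, σ t ≠ []) :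
    ∃ h₁ g₁ z, Expands f h₁ z w ∧ Expands σ g₁ y z ∧ ∀ k, γ k = h₁ (g₁ k) := by
  set g₁ : ℤ → ℤ := cum fun k => (σ (y k)).length with hg₁
  have hs : ∀ k, g₁ (k + 1) = g₁ k + (σ (y k)).length := fun k => cum_succ _ k
  have hpos : ∀ k, 0 < (σ (y k)).length := fun k => List.length_pos_iff.2 (hσ _)
  have hg : StrictMono g₁ := strictMono_int_of_lt_succ fun k => by
    have := hs k
    have := hpos k
    omega
  choose K hK₁ hK₂ using exists_block hg
  have hu : ∀ m k, g₁ k ≤ m → m < g₁ (k + 1) → K m = k := fun m k h₁ h₂ => by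
    have := hg.lt_iff_lt.1 ((hK₁ m).trans_lt h₂)
    have := hg.lt_iff_lt.1 (h₁.trans_lt (hK₂ m))
    omega
  have hlt : ∀ m, (m - g₁ (K m)).toNat < (σ (y (K m))).length := fun m => by
    have := hK₁ m
    have := hK₂ m
    have := hs (K m)
    omega
  refine ⟨fun m => γ (K m) + (wordApply f ((σ (y (K m))).take (m - g₁ (K m)).toNat)).length, g₁,
    fun m => (σ (y (K m)))[(m - g₁ (K m)).toNat]'(hlt m), fun m => ?_, fun k => ⟨hs k, ?_⟩,
    fun k => ?_⟩
  · obtain ⟨k, hk⟩ : ∃ k, K m = k := ⟨_, rfl⟩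
    obtain ⟨e, he⟩ : ∃ e : ℕ, (m - g₁ (K m)).toNat = e := ⟨_, rfl⟩
    have hle := hK₁ m
    have hm := hlt m
    have hsk := hs k
    simp only [he]
    rw [hk] at hm he hle
    rw [he] at hm
    simp only [hk]
    have hsplit := List.take_append_getElem hm
    have hw : wordApply f ((σ (y k)).take (e + 1)) =
        wordApply f ((σ (y k)).take e) ++ f (σ (y k))[e] := by
      rw [← hsplit, wordApply_append, wordApply_cons, wordApply_nil, List.append_nil]
    constructor
    · rcases Nat.lt_or_ge (e + 1) (σ (y k)).length with hlt' | hge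
      · rw [hu (m + 1) k (by omega) (by omega),
          show (m + 1 - g₁ k).toNat = e + 1 by omega, hw]
        push_cast [List.length_append]
        ring
      · have hp := hpos (k + 1)
        have hs' := hs (k + 1)
        rw [hu (m + 1) (k + 1) (by omega) (by omega),
          show (m + 1 - g₁ (k + 1)).toNat = 0 by omega, (h k).1]
        rw [List.take_of_length_le hge] at hw
        simp [hw, add_assoc]
    · have := (h k).2
      beta_reduce at this
      conv_lhs at this => rw [← List.take_append_drop (e + 1) (σ (y k)), wordApply_append, hw]
      conv_rhs at this => rw [← List.take_append_drop (e + 1) (σ (y k)), wordApply_append, hw]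
      rw [List.length_append, List.length_append, seg_add, seg_add] at this
      have h₁ := (List.append_inj this (by simp)).1
      exact (List.append_inj h₁ (by simp)).2
  · refine List.ext_getElem (by simp) fun e h₁ h₂ => ?_
    have hk := hu (g₁ k + e) k (by omega) (by have := hs k; omega)
    rw [getElem_seg]
    simp [hk]
  · have := hs k
    have := hpos k
    simp [hu (g₁ k) k le_rfl (by omega)]

end Blocks

theorem elem_ne_nil {f : ABC → List ABC} (h : f ∈ elem) (t : ABC) : f t ≠ [] := by
  simp only [elem, Set.mem_insert_iff, Set.mem_singleton_iff] at h
  rcases h with rfl | rfl | rfl | rfl | rfl <;> cases t <;> simp [D, G, Eab, Ebc, M]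

theorem wordApply_ne_nil {B C : Type*} {f : B → List C} (hf : ∀ t, f t ≠ []) {w : List B}
    (hw : w ≠ []) : wordApply f w ≠ [] := by
  cases w with
  | nil => exact absurd rfl hw
  | cons s w => simp [hf s]

theorem Gen.ne_nil {f : ABC → List ABC} (h : Gen f) (t : ABC) : f t ≠ [] := by
  induction h generalizing t with
  | of h => exact elem_ne_nil h t
  | comp _ _ ih₁ ih₂ => exact wordApply_ne_nil ih₁ (ih₂ t)

/-- Desubstitution by one of the five endomorphisms. -/
def Step (s s' : (ℤ → ℤ) × (ℤ → ABC)) : Prop :=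
  ∃ τ ∈ elem, Desub τ s.1 s.2 s'.1 s'.2

theorem Gen.transGen_step {f : ABC → List ABC} (h : Gen f) {c c' : ℤ → ℤ} {y y' : ℤ → ABC}
    (hd : Desub f c y c' y') : Relation.TransGen Step (c, y) (c', y') := by
  induction h generalizing c y c' y' with
  | of h => exact .single ⟨_, h, hd⟩
  | comp hf hg ih₁ ih₂ =>
    obtain ⟨γ, hγ, he⟩ := hd
    obtain ⟨h₁, g₁, z, e₁, e₂, e₃⟩ := he.factor hg.ne_nil
    exact (ih₁ ⟨h₁, fun _ => rfl, e₁⟩).trans (ih₂ (c := fun k => c (h₁ k))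
      ⟨g₁, fun k => by rw [hγ, e₃], e₂⟩)

theorem exists_chain_of_transGen {α : Type*} {r : α → α → Prop} {s t : α}
    (h : Relation.TransGen r s t) :
    ∃ (n : ℕ) (f : ℕ → α), f 0 = s ∧ f (n + 1) = t ∧ ∀ i ≤ n, r (f i) (f (i + 1)) := by
  induction h with
  | single h =>
    rename_i t
    exact ⟨0, fun i => if i = 0 then s else t, by simp, by simp, fun i hi => by
      obtain rfl : i = 0 := by omega
      simpa using h⟩
  | tail _ h ih =>
    rename_i t u _
    obtain ⟨n, f, h₁, h₂, h₃⟩ := ih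
    refine ⟨n + 1, fun i => if i ≤ n + 1 then f i else u, by simp [h₁], by simp, fun i hi => ?_⟩
    rcases Nat.lt_or_ge n i with hn | hn
    · obtain rfl : i = n + 1 := by omega
      simpa [h₂] using h
    · simpa [hn, hi] using h₃ i hn

theorem exists_interpolation {α : Type*} {r : α → α → Prop} {s : ℕ → α}
    (h : ∀ n, Relation.TransGen r (s n) (s (n + 1))) :
    ∃ (u : ℕ → α) (lev : ℕ → ℕ), StrictMono lev ∧ lev 0 = 0 ∧ (∀ n, u (lev n) = s n) ∧
      ∀ k, r (u k) (u (k + 1)) := by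
  choose len f h₁ h₂ h₃ using fun n => exists_chain_of_transGen (h n)
  let lev : ℕ → ℕ := fun n => ∑ i ∈ Finset.range n, (len i + 1)
  have hs : ∀ n, lev (n + 1) = lev n + (len n + 1) := fun n => Finset.sum_range_succ _ _
  have hlev : StrictMono lev := strictMono_nat_of_lt_succ fun n => by
    have := hs n
    omega
  have hex : ∀ k, ∃ n, lev n ≤ k ∧ k < lev (n + 1) := fun k => by
    induction k with
    | zero => exact ⟨0, le_rfl, by have := hs 0; omega⟩
    | succ k ih =>
      obtain ⟨n, hn₁, hn₂⟩ := ih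
      rcases Nat.lt_or_ge (k + 1) (lev (n + 1)) with hlt | hge
      · exact ⟨n, by omega, hlt⟩
      · exact ⟨n + 1, hge, by have := hs (n + 1); omega⟩
  choose K hK₁ hK₂ using hex
  have hu : ∀ k n, lev n ≤ k → k < lev (n + 1) → K k = n := fun k n g₁ g₂ => by
    have := hlev.lt_iff_lt.1 ((hK₁ k).trans_lt g₂)
    have := hlev.lt_iff_lt.1 (g₁.trans_lt (hK₂ k))
    omega
  refine ⟨fun k => f (K k) (k - lev (K k)), lev, hlev, rfl, fun n => ?_, fun k => ?_⟩
  · simp [hu (lev n) n le_rfl (by have := hs n; omega), h₁]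
  · obtain ⟨n, hn⟩ : ∃ n, K k = n := ⟨_, rfl⟩
    have hk₁ := hK₁ k
    have hk₂ := hK₂ k
    have hsn := hs n
    rw [hn] at hk₁ hk₂
    have hr := h₃ n (k - lev n) (by omega)
    simp only [hn]
    rcases Nat.lt_or_ge (k + 1) (lev (n + 1)) with hlt | hge
    · rwa [hu (k + 1) n (by omega) hlt, show k + 1 - lev n = k - lev n + 1 by omega]
    · rw [hu (k + 1) (n + 1) hge (by have := hs (n + 1); omega),
        show k + 1 - lev (n + 1) = 0 by omega, h₁, ← h₂]
      rwa [show k - lev n + 1 = len n + 1 by omega] at hr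

theorem Loc.of_desub {A : Type*} {x : ℤ → A} {τ : ABC → List ABC} {c c' : ℤ → ℤ}
    {y y' : ℤ → ABC} (hl : Loc x c' y') (hd : Desub τ c y c' y') (hc : StrictMono c)
    {ψ : ABC → List A} (hψ : Expands ψ c y x) (hτ : ∀ t, τ t ≠ []) : Loc x c y := by
  obtain ⟨r, hr⟩ := hl
  obtain ⟨g, hg, he⟩ := hd
  obtain ⟨l, hlen⟩ : ∃ l : ℕ, ∀ t, (wordApply ψ (τ t)).length ≤ l :=
    ⟨(wordApply ψ (τ .a)).length + (wordApply ψ (τ .b)).length + (wordApply ψ (τ .c)).length,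
      fun t => by cases t <;> omega⟩
  have hgm := he.strictMono fun k => hτ _
  refine ⟨r + l, fun k i' ha => ?_⟩
  obtain ⟨K, hK₁, hK₂⟩ := exists_block hgm k
  obtain ⟨n, hn⟩ : ∃ n : ℕ, k = g K + n := ⟨(k - g K).toNat, by omega⟩
  have h₁ := (hψ.comp he K).1
  have h₂ := hlen (y' K)
  simp only at h₁
  have h₃ := hc hK₂
  have h₄ := hc.monotone hK₁
  obtain ⟨K', e₁, e₂, e₃⟩ := hr K (i' - (c k - c (g K))) (by
    rw [hg]
    exact ha.at_shift (by ring) (by omega) (by omega))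
  have hy : ∀ d, g (K - 1) ≤ g K + d → d < (τ (y' K)).length → y (g K' + d) = y (g K + d) := by
    intro d hd₁ hd₂
    have s₁ := (he (K - 1)).2
    have s₂ := (he (K' - 1)).2
    have t₁ := (he (K - 1)).1
    have t₂ := (he (K' - 1)).1
    have s₃ := (he K).2
    have s₄ := (he K').2
    rw [e₃, ← s₁] at s₂
    rw [e₂, ← s₃] at s₄
    rw [length_seg, seg_eq_seg_iff] at s₂ s₄
    rw [e₃] at t₂
    rw [sub_add_cancel] at t₁ t₂
    rcases lt_or_ge d 0 with hd | hd
    · have := s₂ (g K + d - g (K - 1)).toNat (by omega)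
      convert this using 2 <;> omega
    · have := s₄ d.toNat (by omega)
      convert this using 2 <;> omega
  have hs := (he K).1
  have hseg : seg y (g K') n = seg y (g K) n :=
    (seg_eq_seg_iff ..).2 fun d hd => hy d (by have := hgm (show K - 1 < K by omega); omega)
      (by omega)
  refine ⟨g K' + n, ?_, ?_, ?_⟩
  · have a₁ := hψ.add (g K') n
    have a₂ := hψ.add (g K) n
    rw [hseg, ← hg, e₁] at a₁
    rw [← hn] at a₂
    omega
  · rw [hn]
    exact hy n (by have := hgm (show K - 1 < K by omega); omega) (by omega)
  · have := hy (n - 1) (by have := hgm (show K - 1 < K by omega); omega) (by omega)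
    convert this using 2 <;> omega

end SubshiftSadic

namespace SubshiftSadic

variable {A : Type*} {x : ℤ → A}

theorem chain_succ (τ : ℕ → ABC → List ABC) (j k : ℕ) :
    chain τ j (k + 1) = fun t => wordApply (chain τ j k) (τ (j + k) t) := rfl

theorem chain_succ_left (τ : ℕ → ABC → List ABC) (j k : ℕ) (t : ABC) :
    chain τ j (k + 1) t = wordApply (τ j) (chain τ (j + 1) k t) := by
  induction k generalizing t with
  | zero => exact (wordApply_singleton _).trans (List.append_nil _).symm
  | succ k ih =>
    have : chain τ j (k + 1) = fun t => wordApply (τ j) (chain τ (j + 1) k t) := funext ih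
    simp only [chain_succ τ j (k + 1), chain_succ τ (j + 1) k]
    rw [this, wordApply_comp, show j + (k + 1) = j + 1 + k by ring]

/-- Images of words under injectively coded morphisms determine the word: two sequences readable in
`w` which have the same image coincide. -/
theorem eq_of_expands {B : Type*} {C C' h : ℤ → ℤ} {w : ℤ → ABC} {w₀ : ℤ → B} {σ : ABC → List B}
    {ψ : B → List A} (hl : Loc x C w) (hC : StrictMono C) (hCh : ∀ k, C k = C' (h k))
    (hC' : StrictMono C') (hψ : Expands ψ C' w₀ x) (hσ : Expands σ h w w₀) (hne : ∀ t, σ t ≠ [])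
    {y y' : ℤ → ABC} (hy : ∀ i m, ∃ p, seg w p m = seg y i m)
    (hy' : ∀ i m, ∃ p, seg w p m = seg y' i m) {z : ℤ → B} (hz : ExtSeq σ y z)
    (hz' : ExtSeq σ y' z) : y = y' := by
  obtain ⟨r, hr⟩ := hl
  set g := cum fun j => (σ (y j)).length with hg
  set g' := cum fun j => (σ (y' j)).length with hg'
  have he : Expands σ g y z := ExtSeq.expands hz
  have he' : Expands σ g' y' z := ExtSeq.expands hz'
  have hgm := he.strictMono fun _ => hne _
  have hgm' := he'.strictMono fun _ => hne _
  have hhm := hσ.strictMono fun _ => hne _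
  have key : ∀ k, g k = g' k → y k = y' k ∧ y (k - 1) = y' (k - 1) := fun k hk => by
    obtain ⟨n, hn₀, hn⟩ : ∃ n : ℕ, 1 ≤ n ∧ r ≤ n := ⟨r.toNat + 1, by omega, by omega⟩
    obtain ⟨p, hp⟩ := hy (k - n) (n + n)
    obtain ⟨p', hp'⟩ := hy' (k - n) (n + n)
    obtain ⟨q, rfl⟩ : ∃ q, p = q - n := ⟨p + n, by ring⟩
    obtain ⟨q', rfl⟩ : ∃ q, p' = q - n := ⟨p' + n, by ring⟩
    have a₁ := hσ.agree he hhm hp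
    have a₂ := hσ.agree he' hhm hp'
    have a₃ : seg w₀ (h q - n) (n + n) = seg w₀ (h q' - n) (n + n) :=
      (seg_eq_seg_iff ..).2 fun d hd => by
        have b₁ := a₁ (d - n) (by omega) (by omega)
        have b₂ := a₂ (d - n) (by omega) (by omega)
        rw [← hk, ← b₁] at b₂
        convert b₂.symm using 2 <;> ring
    have a₄ := hψ.agree hψ hC' a₃
    rw [← hCh, ← hCh] at a₄
    obtain ⟨q'', e₁, e₂, e₃⟩ := hr q (C q') fun d h₁ h₂ => a₄ d (by omega) (by omega)
    obtain rfl := hC.injective e₁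
    have read : ∀ {u : ℤ → ABC} {t : ℤ}, seg w (t - n) (n + n) = seg u (k - n) (n + n) →
        w t = u k ∧ w (t - 1) = u (k - 1) := fun {u t} hs => by
      rw [seg_eq_seg_iff] at hs
      have c₁ := hs n (by omega)
      have c₂ := hs (n - 1) (by omega)
      rw [Nat.cast_sub hn₀] at c₂
      rw [sub_add_cancel, sub_add_cancel] at c₁
      refine ⟨c₁, ?_⟩
      convert c₂ using 2 <;> push_cast <;> ring
    obtain ⟨r₁, r₂⟩ := read hp
    obtain ⟨r₃, r₄⟩ := read hp'
    exact ⟨by rw [← r₁, ← r₃, e₂], by rw [← r₂, ← r₄, e₃]⟩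
  have hcut : ∀ k, g k = g' k := fun k => by
    induction k with
    | zero => simp [hg, hg']
    | succ i ih => rw [(he _).1, (he' _).1, (key _ ih).1, ih]
    | pred i ih =>
      have h₁ := (he (-i - 1)).1
      have h₂ := (he' (-i - 1)).1
      rw [sub_add_cancel] at h₁ h₂
      rw [(key _ ih).2, ih] at h₁
      omega
  exact funext fun k => (key k (hcut k)).1

theorem image_infix {B : Type*} {τ : ℕ → ABC → List ABC} {σ : ABC → List B} (hσ : ∀ t, σ t ≠ [])
    {j : ℕ} {y : ℤ → ABC} {b : ℕ → ABC} (hy : y ∈ Ylevel τ b j) {z : ℤ → B}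
    (hz : ExtSeq σ y z) (i : ℤ) (m : ℕ) :
    ∃ k, seg z i m <:+: wordApply σ (chain τ j k (b (j + k))) := by
  obtain ⟨p, n, hp⟩ := (ExtSeq.expands hz).seg_infix ((ExtSeq.expands hz).strictMono fun _ => hσ _) i m
  obtain ⟨k, hk⟩ := hy p n
  exact ⟨k, hp.trans (wordApply_infix σ hk)⟩

/-- An infinite desubstitution process for `x`. -/
structure Tower (x : ℤ → A) (φ : ABC → List A) (τ : ℕ → ABC → List ABC) (u : ℕ → ℤ → ℤ)
    (v : ℕ → ℤ → ABC) (h : ℕ → ℤ → ℤ) : Prop where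
  mem : ∀ k, τ k ∈ elem
  base : Expands φ (u 0) (v 0) x
  step : ∀ k, Expands (τ k) (h k) (v (k + 1)) (v k)
  cut : ∀ k i, u (k + 1) i = u k (h k i)
  mono : ∀ k, StrictMono (u k)
  loc : ∀ k, Loc x (u k) (v k)
  ne_nil : ∀ t, φ t ≠ []
  full : ∀ n, ∃ q ≥ n, (∀ t, ∃ k, v q k = t) ∧ ∀ k k', Agree x (u q k) (u q k') (-n) n

theorem exists_tower [Finite A] {N : ℤ} (hG : Good x N) :
    ∃ φ τ u v h, Tower x φ τ u v h := by
  obtain ⟨φ, c, y, hφ, H⟩ := exists_full_sequence hG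
  obtain ⟨s, lev, hlev, hlev0, hs, hstep⟩ := exists_interpolation (r := Step)
    (s := fun n => (c n, y n)) fun n => by
      obtain ⟨T, hT, hd⟩ := (H n).2.2
      exact hT.transGen_step hd
  choose τ hτ h hh he using hstep
  have hs0 : s 0 = (c 0, y 0) := by have := hs 0; rwa [hlev0] at this
  have hbase : Expands φ (s 0).1 (s 0).2 x := by rwa [hs0]
  have hmono : ∀ k, StrictMono (s k).1 := fun k => by
    induction k with
    | zero => rw [hs0]; exact (H 0).1.mono
    | succ k ih =>
      have := (he k).strictMono fun _ => elem_ne_nil (hτ k) _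
      intro i j hij
      rw [hh, hh]
      exact ih (this hij)
  have hexp : ∀ k, ∃ ψ : ABC → List A, Expands ψ (s k).1 (s k).2 x := fun k => by
    induction k with
    | zero => exact ⟨φ, hbase⟩
    | succ k ih =>
      obtain ⟨ψ, hψ⟩ := ih
      have := hψ.comp (he k)
      rw [← funext (hh k)] at this
      exact ⟨_, this⟩
  have hloc : ∀ i k, Loc x (s (k + i)).1 (s (k + i)).2 → Loc x (s k).1 (s k).2 := fun i k hl => by
    induction i with
    | zero => exact hl
    | succ i ih =>
      obtain ⟨ψ, hψ⟩ := hexp (k + i)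
      exact ih (hl.of_desub ⟨h (k + i), hh _, he _⟩ (hmono _) hψ (elem_ne_nil (hτ _)))
  refine ⟨φ, τ, fun k => (s k).1, fun k => (s k).2, h, hτ, hbase, he, hh, hmono, fun k => ?_,
    fun t => ?_, fun n => ⟨lev n, hlev.le_apply, ?_⟩⟩
  · have hk : k ≤ lev k := hlev.le_apply
    obtain ⟨i, hi⟩ := Nat.exists_eq_add_of_le hk
    refine hloc i k ?_
    rw [← hi, hs]
    exact (H k).1.loc
  · obtain ⟨k, rfl⟩ := (H 0).1.surj t
    exact hφ.ne_nil (H 0).1.mono k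
  · simp only [hs]
    exact ⟨(H n).1.surj, (H n).2.1⟩

namespace Tower

variable {φ : ABC → List A} {τ : ℕ → ABC → List ABC} {u : ℕ → ℤ → ℤ} {v : ℕ → ℤ → ABC}
  {h : ℕ → ℤ → ℤ}

theorem exists_chain (H : Tower x φ τ u v h) (j k : ℕ) :
    ∃ g, Expands (chain τ j k) g (v (j + k)) (v j) ∧ ∀ i, u (j + k) i = u j (g i) := by
  induction k with
  | zero => exact ⟨id, fun i => by simp [chain, seg_one], fun _ => rfl⟩
  | succ k ih =>
    obtain ⟨g, h₁, h₂⟩ := ih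
    exact ⟨fun i => g (h (j + k) i), h₁.comp (H.step (j + k)), fun i => by
      rw [← h₂]; exact H.cut _ _⟩

theorem exists_expands (H : Tower x φ τ u v h) (k : ℕ) :
    Expands (fun t => wordApply φ (chain τ 0 k t)) (u k) (v k) x := by
  obtain ⟨g, h₁, h₂⟩ := H.exists_chain 0 k
  rw [zero_add] at h₁ h₂
  rw [funext h₂]
  exact H.base.comp h₁

theorem chain_ne_nil (H : Tower x φ τ u v h) (j k : ℕ) (t : ABC) : chain τ j k t ≠ [] := by
  induction k generalizing t with
  | zero => simp [chain]
  | succ k ih => exact wordApply_ne_nil ih (elem_ne_nil (H.mem _) t)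

theorem readable (H : Tower x φ τ u v h) {j : ℕ} {y : ℤ → ABC}
    (hy : y ∈ Ylevel τ (fun k => v k 0) j) (i : ℤ) (m : ℕ) : ∃ p, seg (v j) p m = seg y i m := by
  obtain ⟨k, hk⟩ := hy i m
  obtain ⟨g, h₁, -⟩ := H.exists_chain j k
  rw [← (h₁ 0).2] at hk
  obtain ⟨p, -, -, hp⟩ := infix_seg hk
  exact ⟨p, by simpa using hp⟩

theorem exists_long (H : Tower x φ τ u v h) (hgap : Gap x) (n D : ℕ) :
    ∃ q ≥ n, (∀ t, ∃ k, v q k = t) ∧ (∀ k k', Agree x (u q k) (u q k') (-n) n) ∧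
      ∀ k, u q k + D < u q (k + 1) := by
  obtain ⟨m, hm⟩ := hgap D
  obtain ⟨q, h₁, h₂, h₃⟩ := H.full (max n m)
  refine ⟨q, by omega, h₂, fun k k' => (h₃ k k').mono (by omega) (by omega), fun k => ?_⟩
  have := hm _ _ ((h₃ k (k + 1)).mono (by omega) (by omega)) (H.mono q (by omega))
  omega

theorem seg_infix_iff (H : Tower x φ τ u v h) (hgap : Gap x) (hrec : Recurs x) (w : List A) :
    (∃ k, w <:+: wordApply φ (chain τ 0 k (v k 0))) ↔ ∃ p, seg x p w.length = w := by
  constructor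
  · rintro ⟨k, hk⟩
    have hx := (H.exists_expands k 0).2
    simp only at hx
    rw [← hx] at hk
    obtain ⟨p, -, -, hp⟩ := infix_seg hk
    exact ⟨p, hp⟩
  · rintro ⟨p, hp⟩
    obtain ⟨R, hR⟩ := hrec p 0 w.length
    obtain ⟨q, -, -, -, hq⟩ := H.exists_long hgap 0 (R.toNat + w.length)
    obtain ⟨t, h₁, h₂, h₃⟩ := hR (u q 0)
    have h₄ := (H.exists_expands q 0).1
    have h₅ := hq 0
    have hx := (H.exists_expands q 0).2
    simp only at hx h₄
    refine ⟨q, ?_⟩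
    rw [← hx, ← hp,
      (seg_eq_seg_iff x x p t _).2 fun d hd => h₃ d (by omega) (by omega)]
    exact seg_infix h₁ (by rw [h₄] at h₅; push_cast at h₅; omega)

theorem exists_proper (H : Tower x φ τ u v h) (hgap : Gap x) (hrec : Recurs x) {j : ℕ}
    (hj : ∀ t, ∃ k, v j k = t) :
    ∃ q > j, (∀ t, ∃ k, v q k = t) ∧ ∃ l r, ∀ t, (chain τ j (q - j) t).head? = some l ∧
      (chain τ j (q - j) t).getLast? = some r ∧ ∀ s, s ∈ chain τ j (q - j) t := by
  obtain ⟨r, hr⟩ := H.loc j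
  choose K hK using hj
  choose R hR using fun t => hrec (u j (K t)) (-r) r
  obtain ⟨D, hD⟩ : ∃ D : ℕ, ∀ t, R t ≤ D :=
    ⟨(R .a).toNat + (R .b).toNat + (R .c).toNat, fun t => by cases t <;> omega⟩
  obtain ⟨q, h₁, h₂, h₃, h₄⟩ := H.exists_long hgap (max (j + 1) r.toNat) D
  obtain ⟨i, rfl⟩ := Nat.exists_eq_add_of_le (show j ≤ q by omega)
  refine ⟨j + i, by omega, h₂, ?_⟩
  rw [Nat.add_sub_cancel_left]
  obtain ⟨g, e₁, e₂⟩ := H.exists_chain j i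
  have hg : StrictMono g := e₁.strictMono fun _ => H.chain_ne_nil _ _ _
  have hcut : ∀ k k', v j (g k) = v j (g k') ∧ v j (g k - 1) = v j (g k' - 1) := fun k k' => by
    have ha := (h₃ k k').mono (lo' := -r) (hi' := r) (by omega) (by omega)
    rw [e₂, e₂] at ha
    obtain ⟨k'', f₁, f₂, f₃⟩ := hr _ _ ha
    obtain rfl := (H.mono j).injective f₁
    exact ⟨f₂.symm, f₃.symm⟩
  refine ⟨v j (g 0), v j (g 0 - 1), fun t => ?_⟩
  obtain ⟨k, rfl⟩ := h₂ t
  obtain ⟨f₁, f₂⟩ := e₁ k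
  obtain ⟨m, hm⟩ : ∃ m, (chain τ j i (v (j + i) k)).length = m + 1 :=
    Nat.exists_eq_succ_of_ne_zero (by simpa using H.chain_ne_nil j i _)
  rw [hm] at f₁ f₂
  rw [← f₂]
  refine ⟨?_, ?_, fun s => ?_⟩
  · rw [seg_succ', List.head?_cons, (hcut k 0).1]
  · rw [seg_succ, List.getLast?_append, List.getLast?_singleton, Option.some_or,
      ← (hcut (k + 1) 0).2, f₁]
    congr 2
    push_cast
    ring
  · obtain ⟨t, t₁, t₂, t₃⟩ := hR s (u (j + i) k)
    obtain ⟨k', k₁, k₂, -⟩ := hr _ _ t₃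
    have hs := hD s
    have hlong := h₄ k
    rw [e₂] at t₁ t₂ hlong
    rw [e₂] at hlong
    have g₁ := (H.mono j).le_iff_le.1 (show u j (g k) ≤ u j k' by omega)
    have g₂ := (H.mono j).lt_iff_lt.1 (show u j k' < u j (g (k + 1)) by omega)
    rw [← hK s, ← k₂]
    have : k' = g k + ((k' - g k).toNat : ℤ) := by omega
    rw [this, ← getElem_seg (v j) (g k) (m + 1) (k' - g k).toNat
      (by rw [length_seg]; push_cast at f₁; omega)]
    exact List.getElem_mem _

theorem exists_proper_sequence (H : Tower x φ τ u v h) (hgap : Gap x) (hrec : Recurs x) :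
    ∃ m : ℕ → ℕ, StrictMono m ∧ ∀ i, ProperMorphism (chain τ (m i) (m (i + 1) - m i + 1)) ∧
      ∀ y s, s ∈ chain τ (m i) (m (i + 1) - m i + 1) y := by
  choose next h₁ h₂ h₃ using fun j : {j : ℕ // ∀ t, ∃ k, v j k = t} =>
    H.exists_proper hgap hrec j.2
  obtain ⟨q, -, hq, -⟩ := H.full 0
  let f : ℕ → {j : ℕ // ∀ t, ∃ k, v j k = t} :=
    fun i => Nat.rec ⟨q, hq⟩ (fun _ j => ⟨next j, h₂ j⟩) i
  refine ⟨fun i => (f i).1, strictMono_nat_of_lt_succ fun i => h₁ (f i),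
    fun i => ?_⟩
  obtain ⟨l, r, hlr⟩ := h₃ (f i)
  change ProperMorphism (chain τ (f i).1 (next (f i) - (f i).1 + 1)) ∧
    ∀ y s, s ∈ chain τ (f i).1 (next (f i) - (f i).1 + 1) y
  simp only [chain_succ]
  have hne := fun t => elem_ne_nil (H.mem ((f i).1 + (next (f i) - (f i).1))) t
  refine ⟨⟨l, r, fun t => ⟨?_, ?_⟩⟩, fun t s => ?_⟩
  · obtain ⟨s, w, hw⟩ := List.exists_cons_of_ne_nil (hne t)
    beta_reduce
    rw [hw, wordApply_cons, List.head?_append, (hlr s).1, Option.some_or]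
  · obtain ⟨w, s, hw⟩ := (List.eq_nil_or_concat' _).resolve_left (hne t)
    beta_reduce
    rw [hw, wordApply_append, wordApply_cons, wordApply_nil, List.append_nil,
      List.getLast?_append, (hlr s).2.1, Option.some_or]
  · obtain ⟨t', w, hw⟩ := List.exists_cons_of_ne_nil (hne t)
    rw [hw, wordApply_cons]
    exact List.mem_append_left _ ((hlr t').2.2 s)

end Tower

end SubshiftSadic

/-- **(Durand–Leroy, after Leroy).**  Let `(X, T)` be a non-periodic minimal subshift
over a finite alphabet `A` whose complexity satisfies `p_X(n+1) - p_X(n) ≤ 2` for all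
large enough `n`.  Then `(X, T)` is `S`-adic for `S = {D, G, E_{ab}, E_{bc}, M}`:
there are a morphism `σ₂ : {a,b,c}* → A*`, morphisms `τ k ∈ S` (with `τ k` playing
the role of `σ_{k+3}`) and letters `b k ∈ {a,b,c}` (with `b k` playing the role of
`a_{k+2}`) such that `X` is exactly the set of sequences all of whose factors occur in
some `σ₂ σ₃ ⋯ σ_n (a_n)`.  Moreover the representation can be chosen so that
(i) each morphism of the directive sequence extends by concatenation to a one-to-one
map from `X_n` into `X_{n-1}` (here `Ylevel τ b j` is `X_{j+3}` and `X = X_2`), and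
(ii) there is an increasing sequence `(n_i)` such that each composition
`σ_{n_i} σ_{n_i+1} ⋯ σ_{n_{i+1}}` is proper and every letter of `{a,b,c}` occurs in
every image of this composition. -/
theorem sadic_representation_of_complexity_le_two {A : Type*} [Fintype A]
    [TopologicalSpace A] [DiscreteTopology A] (X : Set (ℤ → A))
    (hclosed : IsClosed X)
    (hinv : ∀ x ∈ X, ∀ p : ℤ, shiftBy p x ∈ X)
    (hmin : ∀ x ∈ X, X ⊆ closure { z | ∃ p : ℤ, z = shiftBy p x })
    (hnonper : ∃ x ∈ X, ∀ p : ℕ, 1 ≤ p → shiftBy (p : ℤ) x ≠ x)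
    (hcompl : ∃ N : ℕ, ∀ n ≥ N, complexity X (n + 1) ≤ complexity X n + 2) :
    ∃ (σ₂ : ABC → List A) (τ : ℕ → ABC → List ABC) (b : ℕ → ABC),
      (∀ k : ℕ, τ k ∈ ({D, G, Eab, Ebc, M} : Set (ABC → List ABC))) ∧
      X = { x : ℤ → A | ∀ (i : ℤ) (m : ℕ), ∃ k : ℕ,
              seg x i m <:+: wordApply σ₂ (chain τ 0 k (b k)) } ∧
      (∀ y ∈ Ylevel τ b 0, ∀ z : ℤ → A, ExtSeq σ₂ y z → z ∈ X) ∧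
      (∀ y ∈ Ylevel τ b 0, ∀ y' ∈ Ylevel τ b 0, ∀ z : ℤ → A,
        ExtSeq σ₂ y z → ExtSeq σ₂ y' z → y = y') ∧
      (∀ j : ℕ, ∀ y ∈ Ylevel τ b (j + 1), ∀ z : ℤ → ABC,
        ExtSeq (τ j) y z → z ∈ Ylevel τ b j) ∧
      (∀ j : ℕ, ∀ y ∈ Ylevel τ b (j + 1), ∀ y' ∈ Ylevel τ b (j + 1), ∀ z : ℤ → ABC,
        ExtSeq (τ j) y z → ExtSeq (τ j) y' z → y = y') ∧
      (∃ m : ℕ → ℕ, StrictMono m ∧ ∀ i : ℕ,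
        ProperMorphism (chain τ (m i) (m (i + 1) - m i + 1)) ∧
        ∀ y x : ABC, x ∈ chain τ (m i) (m (i + 1) - m i + 1) y) := by
  obtain ⟨x, hx, hper⟩ := hnonper
  obtain ⟨N, hN⟩ := hcompl
  simp only [complexity, SubshiftSadic.lang_eq_range hmin hx] at hN
  have hrec := SubshiftSadic.recurs_of_minimal hclosed hinv hmin hx
  have hgap : SubshiftSadic.Gap x := hrec.gap fun e he => by
    by_contra! h
    exact hper e he (funext h)
  obtain ⟨φ, τ, u, v, h, H⟩ := SubshiftSadic.exists_tower (N := N)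
    ⟨by omega, hrec, hgap, SubshiftSadic.rsBound_of_complexity hN,
      SubshiftSadic.rsBound_of_complexity (by simpa only [SubshiftSadic.ncard_range_seg_mirror])⟩
  have hX : X = { x : ℤ → A | ∀ (i : ℤ) (m : ℕ), ∃ k : ℕ,
      seg x i m <:+: wordApply φ (chain τ 0 k (v k 0)) } := by
    ext z
    simp only [Set.mem_ofPred_eq, H.seg_infix_iff hgap hrec, SubshiftSadic.length_seg]
    refine ⟨fun hz i m => ?_, fun hz => SubshiftSadic.mem_of_forall_seg hclosed hinv hx hz⟩
    obtain ⟨p, hp⟩ := SubshiftSadic.exists_occurrence hmin hx hz (i + ·) 0 m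
    refine ⟨i + p, (SubshiftSadic.seg_eq_seg_iff ..).2 fun k hk => ?_⟩
    rw [← hp k (by omega) (by omega)]
    congr 1
    ring
  refine ⟨φ, τ, fun k => v k 0, H.mem, hX, fun y hy z hz => ?_, fun y hy y' hy' z hz hz' => ?_,
    fun j y hy z hz i m => ?_, fun j y hy y' hy' z hz hz' => ?_,
    H.exists_proper_sequence hgap hrec⟩
  · rw [hX]
    exact fun i m => by simpa using SubshiftSadic.image_infix H.ne_nil hy hz i m
  · exact SubshiftSadic.eq_of_expands (ψ := fun t => [t]) (C' := id) (H.loc 0) (H.mono 0)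
      (fun _ => rfl) strictMono_id (fun k => ⟨by simp, by simp [SubshiftSadic.seg_one]⟩) H.base
      H.ne_nil (H.readable hy) (H.readable hy') hz hz'
  · obtain ⟨k, hk⟩ := SubshiftSadic.image_infix (SubshiftSadic.elem_ne_nil (H.mem j)) hy hz i m
    refine ⟨k + 1, ?_⟩
    rwa [SubshiftSadic.chain_succ_left, show j + (k + 1) = j + 1 + k by ring]
  · exact SubshiftSadic.eq_of_expands (H.loc (j + 1)) (H.mono (j + 1)) (H.cut j) (H.mono j)
      (H.exists_expands j) (H.step j) (SubshiftSadic.elem_ne_nil (H.mem j)) (H.readable hy)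
      (H.readable hy') hz hz'
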